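/- There exists a constant C depending only on Λ with the following property. Let R > 0 and let u be a positive function, continuous up to the closure of B⁺_{3R}, C¹ on B⁺_{3R} ∪ ∂'B⁺_{3R} and C² in B⁺_{3R}, satisfying Δu + K(x)u⁵ = 0 in B⁺_{3R} and ∂u/∂x₃ = c(x)u³ on ∂'B⁺_{3R}, where K is C¹ on the closure of B⁺_{3R} with Λ⁻¹ ≤ K ≤ Λ and |∇K| ≤ Λ R⁻¹ there, and c is C¹ on ∂'B⁺_{3R} with |c| ≤ Λ and |∇c| ≤ Λ R⁻¹ there. Then ∫_{B⁺_R} (|∇u|² + u⁶) ≤ C. -/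

import Mathlib

open Metric Set MeasureTheory

noncomputable section

abbrev E3 := EuclideanSpace ℝ (Fin 3)

/-- The Euclidean Laplacian on ℝ³. -/
noncomputable def lap (u : E3 → ℝ) (x : E3) : ℝ :=
  ∑ i : Fin 3, fderiv ℝ (fun y => fderiv ℝ u y (EuclideanSpace.single i 1)) x
    (EuclideanSpace.single i 1)

/-- The third standard basis vector of ℝ³. -/
noncomputable def e3 : E3 := EuclideanSpace.single 2 1

/-- The open upper half-ball `B⁺_r`. -/
def oB (r : ℝ) : Set E3 := {x | ‖x‖ < r ∧ 0 < x 2}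

/-- The flat boundary part `∂'B⁺_r`. -/
def fB (r : ℝ) : Set E3 := {x | ‖x‖ < r ∧ x 2 = 0}

/-- The closure of the upper half-ball `B⁺_r`. -/
def cB (r : ℝ) : Set E3 := {x | ‖x‖ ≤ r ∧ 0 ≤ x 2}

namespace HalfBall
open Filter Topology

/-- The standard basis vectors of `E3`. -/
def eb (i : Fin 3) : E3 := EuclideanSpace.single i 1

@[simp] lemma eb_apply (i j : Fin 3) : eb i j = if j = i then 1 else 0 := by
  simp [eb]

lemma eb_two : eb 2 = e3 := rfl

@[simp] lemma norm_eb (i : Fin 3) : ‖eb i‖ = 1 := by simp [eb]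

lemma norm_sq_eq (x : E3) : ‖x‖ ^ 2 = x 0 ^ 2 + x 1 ^ 2 + x 2 ^ 2 := by
  simp [EuclideanSpace.norm_sq_eq, Fin.sum_univ_three]

lemma sum_smul_eb (x : E3) : ∑ i, x i • eb i = x := by
  ext j
  fin_cases j <;> simp [Fin.sum_univ_three]

lemma abs_coord_le (x : E3) (i : Fin 3) : |x i| ≤ ‖x‖ := by
  simpa using PiLp.norm_apply_le x i

lemma coord_le (x : E3) (i : Fin 3) : x i ≤ ‖x‖ := (le_abs_self _).trans (abs_coord_le x i)

lemma continuous_coord (i : Fin 3) : Continuous fun x : E3 => x i := by fun_prop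

/-- Along each coordinate line through `z`, `f` has a second derivative, and these sum to `ℓ`. -/
def HasLap (f : E3 → ℝ) (z : E3) (ℓ : ℝ) : Prop :=
  ∃ (g : Fin 3 → ℝ → ℝ) (d : Fin 3 → ℝ),
    (∀ i, ∀ᶠ t in 𝓝 (0 : ℝ), HasDerivAt (fun t : ℝ => f (z + t • eb i)) (g i t) t) ∧
    (∀ i, HasDerivAt (g i) (d i) 0) ∧ ∑ i, d i = ℓ

lemma tendsto_line (z e : E3) : Tendsto (fun t : ℝ => z + t • e) (𝓝 0) (𝓝 z) := by
  have : Continuous fun t : ℝ => z + t • e := by fun_prop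
  simpa using this.tendsto 0

lemma HasLap.add {f₁ f₂ : E3 → ℝ} {z : E3} {a b : ℝ} (h₁ : HasLap f₁ z a) (h₂ : HasLap f₂ z b) :
    HasLap (fun y => f₁ y + f₂ y) z (a + b) := by
  obtain ⟨g, d, hg, hd, rfl⟩ := h₁
  obtain ⟨g', d', hg', hd', rfl⟩ := h₂
  refine ⟨fun i t => g i t + g' i t, fun i => d i + d' i, fun i => ?_, fun i => ?_,
    Finset.sum_add_distrib⟩
  · filter_upwards [hg i, hg' i] with t h h'
    exact HasDerivAt.add h h'
  · exact HasDerivAt.add (hd i) (hd' i)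

lemma HasLap.const_mul {f : E3 → ℝ} {z : E3} {a : ℝ} (c : ℝ) (h : HasLap f z a) :
    HasLap (fun y => c * f y) z (c * a) := by
  obtain ⟨g, d, hg, hd, rfl⟩ := h
  refine ⟨fun i t => c * g i t, fun i => c * d i, fun i => ?_, fun i => ?_,
    (Finset.mul_sum _ _ _).symm⟩
  · filter_upwards [hg i] with t h
    exact HasDerivAt.const_mul c h
  · exact HasDerivAt.const_mul c (hd i)

lemma HasLap.sub {f₁ f₂ : E3 → ℝ} {z : E3} {a b : ℝ} (h₁ : HasLap f₁ z a) (h₂ : HasLap f₂ z b) :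
    HasLap (fun y => f₁ y - f₂ y) z (a - b) := by
  have := h₁.add (h₂.const_mul (-1))
  convert this using 1
  · ext y; ring
  · ring

lemma hasLap_const (c : ℝ) (z : E3) : HasLap (fun _ => c) z 0 :=
  ⟨fun _ _ => 0, fun _ => 0, fun _ => Eventually.of_forall fun _ => hasDerivAt_const _ _,
    fun _ => hasDerivAt_const _ _, by simp⟩

lemma HasLap.congr {f₁ f₂ : E3 → ℝ} {z : E3} {a : ℝ} (h₁ : HasLap f₁ z a) (h : f₁ =ᶠ[𝓝 z] f₂) :
    HasLap f₂ z a := by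
  obtain ⟨g, d, hg, hd, rfl⟩ := h₁
  refine ⟨g, d, fun i => ?_, hd, rfl⟩
  filter_upwards [hg i, ((tendsto_line z (eb i)).eventually h).eventually_nhds] with t ht hh
  refine ht.congr_of_eventuallyEq ?_
  filter_upwards [hh] with s hs using hs.symm

/-- The one-dimensional second derivative test at a local minimum. -/
lemma second_deriv_nonneg {F G : ℝ → ℝ} {d : ℝ} (hF : ∀ᶠ t in 𝓝 0, HasDerivAt F (G t) t)
    (hG : HasDerivAt G d 0) (hmin : ∀ᶠ t in 𝓝 (0 : ℝ), F 0 ≤ F t) : 0 ≤ d := by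
  by_contra! hd
  have hG0 : G 0 = 0 := IsLocalMin.hasDerivAt_eq_zero hmin hF.self_of_nhds
  have hEq : deriv F =ᶠ[𝓝 0] G := by
    filter_upwards [hF] with t ht using ht.deriv
  have h2 : deriv (deriv F) 0 = d := by
    rw [hEq.deriv_eq]; exact hG.deriv
  have hmax : IsLocalMax F 0 := isLocalMax_of_deriv_deriv_neg (by rw [h2]; exact hd)
    (by rw [hEq.self_of_nhds, hG0]) hF.self_of_nhds.continuousAt
  have hconst : F =ᶠ[𝓝 0] fun _ => F 0 := by
    filter_upwards [hmin, hmax] with t h1 h2 using le_antisymm h2 h1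
  have : G =ᶠ[𝓝 0] fun _ => (0:ℝ) := by
    filter_upwards [hEq, hconst.eventually_nhds] with t h1 h3
    rw [← h1, (show F =ᶠ[𝓝 t] fun _ => F 0 from h3).deriv_eq]; simp
  have h4 := hG.congr_of_eventuallyEq this.symm
  have := h4.unique (hasDerivAt_const 0 (0:ℝ))
  linarith

lemma HasLap.nonneg_of_min {f : E3 → ℝ} {z : E3} {a : ℝ} (h : HasLap f z a)
    (hmin : ∀ᶠ y in 𝓝 z, f z ≤ f y) : 0 ≤ a := by
  obtain ⟨g, d, hg, hd, rfl⟩ := h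
  refine Finset.sum_nonneg fun i _ => second_deriv_nonneg (hg i) (hd i) ?_
  filter_upwards [(tendsto_line z (eb i)).eventually hmin] with t ht
  simpa using ht

lemma hasDerivAt_line (z e : E3) (t : ℝ) : HasDerivAt (fun t : ℝ => z + t • e) e t := by
  simpa using ((hasDerivAt_id t).smul_const e).const_add z

lemma hasLap_lap {f : E3 → ℝ} {z : E3} (h : ContDiffAt ℝ 2 f z) : HasLap f z (lap f z) := by
  refine ⟨fun i t => fderiv ℝ f (z + t • eb i) (eb i),
    fun i => fderiv ℝ (fun y => fderiv ℝ f y (eb i)) z (eb i), fun i => ?_, fun i => ?_, rfl⟩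
  · have : ∀ᶠ y in 𝓝 z, ContDiffAt ℝ 2 f y := h.eventually (by simp)
    filter_upwards [(tendsto_line z (eb i)).eventually this] with t ht
    exact (ht.differentiableAt (by norm_num)).hasFDerivAt.comp_hasDerivAt t (hasDerivAt_line _ _ _)
  · have h1 : ContDiffAt ℝ 1 (fderiv ℝ f) z := h.fderiv_right (by norm_num)
    have h2 : DifferentiableAt ℝ (fun y => fderiv ℝ f y (eb i)) z :=
      (h1.differentiableAt (by norm_num)).clm_apply (differentiableAt_const _)
    exact h2.hasFDerivAt.hasLineDerivAt _

/-- A one-sided derivative at a minimum over a half-line is nonnegative. -/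
lemma deriv_nonneg_of_min {F : ℝ → ℝ} {d : ℝ} (hF : HasDerivWithinAt F d (Ici 0) 0)
    (hmin : ∀ᶠ t in 𝓝[≥] (0 : ℝ), F 0 ≤ F t) : 0 ≤ d := by
  have h := hF.Ioi_of_Ici
  rw [hasDerivWithinAt_iff_tendsto_slope' (by simp)] at h
  refine ge_of_tendsto h ?_
  have h2 : ∀ᶠ t in 𝓝[>] (0:ℝ), F 0 ≤ F t := hmin.filter_mono (nhdsWithin_mono _ Ioi_subset_Ici_self)
  filter_upwards [h2, self_mem_nhdsWithin] with t ht (ht0 : 0 < t)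
  rw [slope_def_field]
  exact div_nonneg (by linarith) (by linarith)

/-- The closed upper half-space. -/
def up : Set E3 := {z | 0 ≤ z 2}

lemma isClosed_up : IsClosed up := isClosed_le continuous_const (continuous_coord 2)

lemma tendsto_line_up {z : E3} (hz : 0 ≤ z 2) :
    Tendsto (fun t : ℝ => z + t • e3) (𝓝[≥] 0) (𝓝[up] z) := by
  refine tendsto_nhdsWithin_iff.2 ⟨(tendsto_line z e3).mono_left nhdsWithin_le_nhds, ?_⟩
  filter_upwards [self_mem_nhdsWithin] with t (ht : 0 ≤ t)
  simp [up, e3]; linarith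

/-- At a minimum relative to the upper half-space the vertical derivative is nonnegative. -/
lemma vert_deriv_nonneg {f : E3 → ℝ} {z : E3} {d : ℝ} (hz : 0 ≤ z 2)
    (hf : HasDerivWithinAt (fun t : ℝ => f (z + t • e3)) d (Ici 0) 0)
    (hmin : ∀ᶠ y in 𝓝[up] z, f z ≤ f y) : 0 ≤ d := by
  refine deriv_nonneg_of_min hf ?_
  filter_upwards [(tendsto_line_up hz).eventually hmin] with t ht
  simpa using ht

lemma nhdsWithin_up_of_pos {z : E3} (hz : 0 < z 2) : 𝓝[up] z = 𝓝 z := by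
  refine nhdsWithin_eq_nhds.2 ?_
  filter_upwards [(continuous_coord 2).continuousAt.eventually (lt_mem_nhds hz)] with y hy
  exact le_of_lt hy

lemma hasDerivAt_normSq_line (x z : E3) (i : Fin 3) (t : ℝ) :
    HasDerivAt (fun t : ℝ => ‖z + t • eb i - x‖ ^ 2) (2 * (z + t • eb i - x) i) t := by
  have h := ((hasDerivAt_line z (eb i) t).sub_const x).norm_sq
  convert h using 1
  simp [eb, EuclideanSpace.inner_single_right]

lemma hasDerivAt_norm_line {x z : E3} {i : Fin 3} {t : ℝ} (h0 : z + t • eb i ≠ x) :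
    HasDerivAt (fun t : ℝ => ‖z + t • eb i - x‖) ((z + t • eb i - x) i / ‖z + t • eb i - x‖) t := by
  have hn : ‖z + t • eb i - x‖ ≠ 0 := by simpa [sub_eq_zero] using h0
  have h := (hasDerivAt_normSq_line x z i t).sqrt (by positivity)
  convert h using 1
  · ext s; rw [Real.sqrt_sq (norm_nonneg _)]
  · rw [Real.sqrt_sq (norm_nonneg _)]; field_simp

lemma eventually_line_ne {x z : E3} (h : z ≠ x) (e : E3) :
    ∀ᶠ t in 𝓝 (0 : ℝ), z + t • e ≠ x :=
  (tendsto_line z e).eventually (isOpen_ne.mem_nhds h)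

lemma hasDerivAt_coord_line (x z : E3) (i j : Fin 3) (t : ℝ) :
    HasDerivAt (fun t : ℝ => (z + t • eb i - x) j) (if j = i then 1 else 0) t := by
  have : (fun t : ℝ => (z + t • eb i - x) j) = fun t => z j + t * (if j = i then 1 else 0) - x j := by
    ext s; simp
  rw [this]
  simpa using (((hasDerivAt_id t).mul_const (if j = i then (1:ℝ) else 0)).const_add (z j)).sub_const (x j)

lemma sum_sq_div_norm {a : E3} (h : a ≠ 0) :
    (a 0 / ‖a‖) ^ 2 + (a 1 / ‖a‖) ^ 2 + (a 2 / ‖a‖) ^ 2 = 1 := by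
  have h0 : ‖a‖ ≠ 0 := by simpa using h
  have := norm_sq_eq a
  field_simp
  linarith

/-- Laplacian of a product of a function of the height and a radial function. -/
lemma hasLap_height_radial {x z : E3} (hz : z ≠ x) {a a₁ b b₁ : ℝ → ℝ} {a₂ b₂ : ℝ}
    (ha : ∀ᶠ s in 𝓝 ((z - x) 2), HasDerivAt a (a₁ s) s) (ha₁ : HasDerivAt a₁ a₂ ((z - x) 2))
    (hb : ∀ᶠ s in 𝓝 ‖z - x‖, HasDerivAt b (b₁ s) s) (hb₁ : HasDerivAt b₁ b₂ ‖z - x‖) :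
    HasLap (fun y => a ((y - x) 2) * b ‖y - x‖) z
      (a₂ * b ‖z - x‖ + 2 * a₁ ((z - x) 2) * b₁ ‖z - x‖ * ((z - x) 2 / ‖z - x‖)
        + a ((z - x) 2) * (b₂ + 2 * b₁ ‖z - x‖ / ‖z - x‖)) := by
  have hn : ‖z - x‖ ≠ 0 := by simpa [sub_eq_zero] using hz
  refine ⟨fun i t => (a₁ ((z + t • eb i - x) 2) * (if (2 : Fin 3) = i then 1 else 0)) *
      b ‖z + t • eb i - x‖ + a ((z + t • eb i - x) 2) *
      (b₁ ‖z + t • eb i - x‖ * ((z + t • eb i - x) i / ‖z + t • eb i - x‖)),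
    fun i => (a₂ * (if (2 : Fin 3) = i then 1 else 0) * (if (2 : Fin 3) = i then 1 else 0)) *
      b ‖z - x‖ + a₁ ((z - x) 2) * (if (2 : Fin 3) = i then 1 else 0) *
        (b₁ ‖z - x‖ * ((z - x) i / ‖z - x‖)) +
      (a₁ ((z - x) 2) * (if (2 : Fin 3) = i then 1 else 0) *
        (b₁ ‖z - x‖ * ((z - x) i / ‖z - x‖)) + a ((z - x) 2) *
      (b₂ * ((z - x) i / ‖z - x‖) * ((z - x) i / ‖z - x‖) + b₁ ‖z - x‖ *
        ((1 * ‖z - x‖ - (z - x) i * ((z - x) i / ‖z - x‖)) / ‖z - x‖ ^ 2))), ?_, ?_, ?_⟩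
  · intro i
    have c1 : Tendsto (fun t : ℝ => (z + t • eb i - x) 2) (𝓝 0) (𝓝 ((z - x) 2)) := by
      have := (hasDerivAt_coord_line x z i 2 0).continuousAt.tendsto
      simpa using this
    have c2 : Tendsto (fun t : ℝ => ‖z + t • eb i - x‖) (𝓝 0) (𝓝 ‖z - x‖) := by
      have : Continuous (fun t : ℝ => ‖z + t • eb i - x‖) := by fun_prop
      simpa using this.tendsto 0
    filter_upwards [c1.eventually ha, c2.eventually hb, eventually_line_ne hz (eb i)] with t h1 h2 h3
    exact (h1.comp t (hasDerivAt_coord_line x z i 2 t)).mul (h2.comp t (hasDerivAt_norm_line h3))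
  · intro i
    have h3 : z + (0:ℝ) • eb i ≠ x := by simpa using hz
    have k1 := hasDerivAt_coord_line x z i 2 0
    have k2 := hasDerivAt_norm_line h3
    have A0 := HasDerivAt.comp (h := fun t : ℝ => (z + t • eb i - x) 2) 0
      (by simpa using ha.self_of_nhds) k1
    have A1 := HasDerivAt.comp (h := fun t : ℝ => (z + t • eb i - x) 2) 0 (by simpa using ha₁) k1
    have B0 := HasDerivAt.comp (h := fun t : ℝ => ‖z + t • eb i - x‖) 0
      (by simpa using hb.self_of_nhds) k2
    have B1 := HasDerivAt.comp (h := fun t : ℝ => ‖z + t • eb i - x‖) 0 (by simpa using hb₁) k2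
    have D := (hasDerivAt_coord_line x z i i 0).div k2 (by simpa using hn)
    have := ((A1.mul_const (if (2 : Fin 3) = i then (1:ℝ) else 0)).mul B0).add (A0.mul (B1.mul D))
    refine this.congr_deriv ?_
    simp
  · have h1 := sum_sq_div_norm (sub_ne_zero.2 hz)
    simp only [PiLp.sub_apply] at h1
    have e : ∀ s : ℝ, (1 * ‖z - x‖ - s * (s / ‖z - x‖)) / ‖z - x‖ ^ 2
        = 1 / ‖z - x‖ - (s / ‖z - x‖) ^ 2 / ‖z - x‖ := by
      intro s; field_simp
    simp only [e, Fin.sum_univ_three]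
    generalize hN : ‖z - x‖ = N at *
    simp
    linear_combination (a (z.ofLp 2 - x.ofLp 2) * b₂ - a (z.ofLp 2 - x.ofLp 2) * b₁ N / N) * h1

/-- Inversion in the sphere of radius `l` about `x`. -/
def inv (x : E3) (l : ℝ) (y : E3) : E3 := x + (l ^ 2 / ‖y - x‖ ^ 2) • (y - x)

/-- The Kelvin transform of `u`. -/
def kelv (x : E3) (l : ℝ) (u : E3 → ℝ) (y : E3) : ℝ := l / ‖y - x‖ * u (inv x l y)

lemma hasDerivAt_inv_line {x z : E3} {l : ℝ} {i : Fin 3} {t : ℝ} (h0 : z + t • eb i ≠ x) :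
    HasDerivAt (fun t : ℝ => inv x l (z + t • eb i))
      ((-2 * l ^ 2 * (z + t • eb i - x) i / ‖z + t • eb i - x‖ ^ 4) • (z + t • eb i - x) +
        (l ^ 2 / ‖z + t • eb i - x‖ ^ 2) • eb i) t := by
  have hn : ‖z + t • eb i - x‖ ≠ 0 := by simpa [sub_eq_zero] using h0
  have h1 := (hasDerivAt_const t (l ^ 2)).div (hasDerivAt_normSq_line x z i t) (by positivity)
  have h2 := (h1.smul ((hasDerivAt_line z (eb i) t).sub_const x)).const_add x
  refine h2.congr_deriv ?_
  rw [add_comm]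
  congr 2
  rw [← pow_mul]; ring

lemma hasDerivAt_kelv_line {x z : E3} {l : ℝ} {i : Fin 3} {t : ℝ} {u : E3 → ℝ} {G : E3 →L[ℝ] ℝ}
    (h0 : z + t • eb i ≠ x) (hu : HasFDerivAt u G (inv x l (z + t • eb i))) :
    HasDerivAt (fun t : ℝ => kelv x l u (z + t • eb i))
      (-(l * (z + t • eb i - x) i / ‖z + t • eb i - x‖ ^ 3) * u (inv x l (z + t • eb i)) +
        l / ‖z + t • eb i - x‖ *
        G ((-2 * l ^ 2 * (z + t • eb i - x) i / ‖z + t • eb i - x‖ ^ 4) • (z + t • eb i - x) +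
        (l ^ 2 / ‖z + t • eb i - x‖ ^ 2) • eb i)) t := by
  have hn : ‖z + t • eb i - x‖ ≠ 0 := by simpa [sub_eq_zero] using h0
  have h1 := (hasDerivAt_const t l).div (hasDerivAt_norm_line h0) hn
  have h2 := h1.mul (hu.comp_hasDerivAt t (hasDerivAt_inv_line (l := l) h0))
  refine h2.congr_deriv ?_
  simp only [Function.comp]
  congr 2
  field_simp
  ring

lemma clm_expand (G : E3 →L[ℝ] ℝ) (v : E3) :
    G v = v 0 * G (eb 0) + v 1 * G (eb 1) + v 2 * G (eb 2) := by
  conv_lhs => rw [← sum_smul_eb v]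
  simp [Fin.sum_univ_three]

lemma clm2_expand (H : E3 →L[ℝ] E3 →L[ℝ] ℝ) (v w : E3) :
    H v w = v 0 * (H (eb 0) w) + v 1 * (H (eb 1) w) + v 2 * (H (eb 2) w) := by
  conv_lhs => rw [← sum_smul_eb v]
  simp [Fin.sum_univ_three]

lemma lap_eq {u : E3 → ℝ} {z : E3} (hu : ContDiffAt ℝ 2 u z) :
    lap u z = ∑ i, fderiv ℝ (fderiv ℝ u) z (eb i) (eb i) := by
  have h1 : ContDiffAt ℝ 1 (fderiv ℝ u) z := hu.fderiv_right (by norm_num)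
  refine Finset.sum_congr rfl fun i _ => ?_
  have := ((h1.differentiableAt (by norm_num)).hasFDerivAt.clm_apply
    (hasFDerivAt_const (eb i) z)).fderiv
  rw [show (EuclideanSpace.single i (1:ℝ) : E3) = eb i from rfl, this]
  simp

lemma hasLap_kelv {x z : E3} {l : ℝ} {u : E3 → ℝ} (hz : z ≠ x)
    (hu : ContDiffAt ℝ 2 u (inv x l z)) :
    HasLap (kelv x l u) z ((l / ‖z - x‖) ^ 5 * lap u (inv x l z)) := by
  have hn : ‖z - x‖ ≠ 0 := by simpa [sub_eq_zero] using hz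
  have h1 : ContDiffAt ℝ 1 (fderiv ℝ u) (inv x l z) := hu.fderiv_right (by norm_num)
  have hH := (h1.differentiableAt (by norm_num)).hasFDerivAt
  set D := fderiv ℝ u with hD
  set H := fderiv ℝ D (inv x l z) with hHdef
  set W : Fin 3 → ℝ → E3 := fun i t =>
    (-2 * l ^ 2 * (z + t • eb i - x) i / ‖z + t • eb i - x‖ ^ 4) • (z + t • eb i - x) +
        (l ^ 2 / ‖z + t • eb i - x‖ ^ 2) • eb i with hW
  set a := z - x with ha
  have ha0 : ∀ i : Fin 3, z + (0:ℝ) • eb i - x = a := by intro i; simp [ha]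
  set W' : Fin 3 → E3 := fun i => ((-2 * l ^ 2 / ‖a‖ ^ 4 + 8 * l ^ 2 * a i ^ 2 / ‖a‖ ^ 6) • a +
      (-4 * l ^ 2 * a i / ‖a‖ ^ 4) • eb i) with hW'
  have hi0 : ∀ i : Fin 3, inv x l (z + (0:ℝ) • eb i) = inv x l z := by intro i; simp
  refine ⟨fun i t => -(l * (z + t • eb i - x) i / ‖z + t • eb i - x‖ ^ 3) *
      u (inv x l (z + t • eb i)) + l / ‖z + t • eb i - x‖ * D (inv x l (z + t • eb i)) (W i t),
    fun i => (-l / ‖a‖ ^ 3 + 3 * l * a i ^ 2 / ‖a‖ ^ 5) * u (inv x l z)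
      + -(l * a i / ‖a‖ ^ 3) * D (inv x l z) (W i 0)
      + (-(l * a i / ‖a‖ ^ 3) * D (inv x l z) (W i 0) +
      l / ‖a‖ * (H (W i 0) (W i 0) + D (inv x l z) (W' i))), ?_, ?_, ?_⟩
  · intro i
    have e1 : ∀ᶠ y in 𝓝 (inv x l z), ContDiffAt ℝ 2 u y := hu.eventually (by simp)
    have e2 : Tendsto (fun t : ℝ => inv x l (z + t • eb i)) (𝓝 0) (𝓝 (inv x l z)) := by
      have := (hasDerivAt_inv_line (x := x) (z := z) (l := l) (i := i) (t := 0)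
        (by simpa using hz)).continuousAt.tendsto
      simpa using this
    filter_upwards [e2.eventually e1, eventually_line_ne hz (eb i)] with t h1 h2
    exact hasDerivAt_kelv_line h2 (h1.differentiableAt (by norm_num)).hasFDerivAt
  · intro i
    have h00 : z + (0:ℝ) • eb i ≠ x := by simpa using hz
    have dn := hasDerivAt_norm_line h00
    have dc := hasDerivAt_coord_line x z i i 0
    have dI := hasDerivAt_inv_line (l := l) h00
    have du : HasDerivAt (fun t : ℝ => u (inv x l (z + t • eb i))) (D (inv x l z) (W i 0)) 0 := by
      have := HasFDerivAt.comp_hasDerivAt (f := fun t : ℝ => inv x l (z + t • eb i)) (0:ℝ) (l := u)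
        (l' := D (inv x l z)) (by rw [hi0]; exact (hu.differentiableAt (by norm_num)).hasFDerivAt) dI
      exact this
    have dD : HasDerivAt (fun t : ℝ => D (inv x l (z + t • eb i))) (H (W i 0)) 0 := by
      have := HasFDerivAt.comp_hasDerivAt (f := fun t : ℝ => inv x l (z + t • eb i)) (0:ℝ) (l := D)
        (l' := H) (by rw [hi0]; exact hH) dI
      exact this
    have hn0 : ‖z + (0:ℝ) • eb i - x‖ ≠ 0 := by rw [ha0]; exact hn
    have dW : HasDerivAt (W i) (W' i) 0 := by
      have p1 := (((dc.const_mul (-2 * l ^ 2)).div (dn.pow 4) (pow_ne_zero 4 hn0)).smul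
        ((hasDerivAt_line z (eb i) 0).sub_const x)).add
        (((hasDerivAt_const (0:ℝ) (l ^ 2)).div (dn.pow 2) (pow_ne_zero 2 hn0)).smul_const (eb i))
      refine p1.congr_deriv ?_
      simp only [Pi.pow_apply, Pi.div_apply, ha0, hW', if_true]
      ext j
      simp only [PiLp.add_apply, PiLp.smul_apply, smul_eq_mul, eb_apply]
      push_cast
      field_simp
      ring
    have p := (((dc.const_mul l).div (dn.pow 3) (pow_ne_zero 3 hn0)).neg.mul du).add
      (((hasDerivAt_const (0:ℝ) l).div dn hn0).mul (dD.clm_apply dW))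
    refine p.congr_deriv ?_
    simp only [Pi.pow_apply, Pi.div_apply, Pi.neg_apply, ha0, hi0, if_true]
    push_cast
    field_simp
    ring
  · have hs := sum_sq_div_norm (a := a) (sub_ne_zero.2 hz)
    rw [lap_eq hu, ← hD, ← hHdef]
    have hW0 : ∀ i, W i 0 = (-2 * l ^ 2 * a i / ‖a‖ ^ 4) • a + (l ^ 2 / ‖a‖ ^ 2) • eb i := by
      intro i; simp only [hW, ha0]
    simp only [hW0, hW', Fin.sum_univ_three]
    generalize D (inv x l z) = G
    generalize u (inv x l z) = U
    clear_value H
    simp only [map_add, map_smul, smul_eq_mul, add_apply,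
      smul_apply, clm_expand G a, clm2_expand H a, clm_expand (H (eb 0)) a,
      clm_expand (H (eb 1)) a, clm_expand (H (eb 2)) a]
    obtain ⟨P, hP⟩ : ∃ P, P = ‖a‖⁻¹ := ⟨_, rfl⟩
    obtain ⟨n, hn'⟩ : ∃ n : Fin 3 → ℝ, ∀ i, a i = n i / P := ⟨fun i => a i * P, fun i => by
      rw [hP]; field_simp⟩
    have hP0 : P ≠ 0 := by rw [hP]; exact inv_ne_zero hn
    have hnP : ‖a‖ = P⁻¹ := by rw [hP, inv_inv]
    have hs' : n 0 ^ 2 + n 1 ^ 2 + n 2 ^ 2 = 1 := by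
      rw [← hs, hnP, hn' 0, hn' 1, hn' 2]; field_simp
    rw [hnP, hn' 0, hn' 1, hn' 2]
    generalize G (eb 0) = G0
    generalize G (eb 1) = G1
    generalize G (eb 2) = G2
    generalize H (eb 0) (eb 0) = H00
    generalize H (eb 0) (eb 1) = H01
    generalize H (eb 0) (eb 2) = H02
    generalize H (eb 1) (eb 0) = H10
    generalize H (eb 1) (eb 1) = H11
    generalize H (eb 1) (eb 2) = H12
    generalize H (eb 2) (eb 0) = H20
    generalize H (eb 2) (eb 1) = H21
    generalize H (eb 2) (eb 2) = H22
    generalize n 0 = n0 at *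
    generalize n 1 = n1 at *
    generalize n 2 = n2 at *
    field_simp
    linear_combination (3 * U * l + 12 * l ^ 3 * P * (n0 * G0 + n1 * G1 + n2 * G2) +
      4 * l ^ 5 * P ^ 2 * (n0 * n0 * H00 + n0 * n1 * H01 + n0 * n2 * H02 +
        n1 * n0 * H10 + n1 * n1 * H11 + n1 * n2 * H12 +
        n2 * n0 * H20 + n2 * n1 * H21 + n2 * n2 * H22)) * hs'

/-- The part of a closed annulus in the closed upper half-space. -/
def ann (x : E3) (a b : ℝ) : Set E3 := {z | 0 ≤ z 2 ∧ a ≤ ‖z - x‖ ∧ ‖z - x‖ ≤ b}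

lemma isCompact_ann (x : E3) (a b : ℝ) : IsCompact (ann x a b) := by
  refine (isCompact_closedBall x b).of_isClosed_subset ?_ ?_
  · have hn : Continuous fun z : E3 => ‖z - x‖ := by fun_prop
    exact isClosed_up.inter ((isClosed_le continuous_const hn).inter
      (isClosed_le hn continuous_const))
  · rintro z ⟨_, _, h⟩
    simpa [dist_eq_norm] using h

lemma eventually_ann {x z : E3} {a b : ℝ} (ha : a < ‖z - x‖) (hb : ‖z - x‖ < b) :
    ∀ᶠ y in 𝓝[up] z, y ∈ ann x a b := by
  have hc : ContinuousAt (fun y : E3 => ‖y - x‖) z := by fun_prop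
  filter_upwards [self_mem_nhdsWithin, nhdsWithin_le_nhds (hc.eventually (lt_mem_nhds ha)),
    nhdsWithin_le_nhds (hc.eventually (gt_mem_nhds hb))] with y h1 h2 h3
  exact ⟨h1, h2.le, h3.le⟩

lemma shell_le {v f χ : E3 → ℝ} {x : E3} {l δ : ℝ} (hl : 0 < l) (hx : 0 ≤ x 2) (hδ : 0 < δ)
    (hc : ContinuousOn (fun z => v z - f z) (ann x l (l + δ)))
    (hχ : ContinuousOn χ (ann x l (l + δ))) (hχ0 : ∀ z ∈ ann x l (l + δ), 0 < χ z)
    (hin : ∀ z, 0 ≤ z 2 → ‖z - x‖ = l → f z = v z)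
    (hout : ∀ z, 0 ≤ z 2 → ‖z - x‖ = l + δ → f z ≤ v z)
    (touch : ∀ z t, 0 ≤ z 2 → l < ‖z - x‖ → ‖z - x‖ < l + δ → 0 < t → v z - f z + t * χ z = 0 →
      (∀ᶠ y in 𝓝[up] z, 0 ≤ v y - f y + t * χ y) → False) :
    ∀ z ∈ ann x l (l + δ), f z ≤ v z := by
  have hne : (ann x l (l + δ)).Nonempty := by
    refine ⟨x + l • e3, ?_⟩
    simp [ann, e3, norm_smul, abs_of_pos hl]
    constructor <;> linarith
  obtain ⟨z, hz, hmin⟩ := (isCompact_ann x l (l + δ)).exists_isMinOn hne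
    (hc.div hχ fun z hz => (hχ0 z hz).ne')
  rw [isMinOn_iff] at hmin
  have key : 0 ≤ (v z - f z) / χ z := by
    by_contra! hneg
    have hvf : v z - f z < 0 := by
      by_contra! h
      exact absurd (div_nonneg h (hχ0 z hz).le) (by linarith)
    have h1 : l < ‖z - x‖ := lt_of_le_of_ne hz.2.1 fun h => by
      have := hin z hz.1 h.symm; linarith
    have h2 : ‖z - x‖ < l + δ := lt_of_le_of_ne hz.2.2 fun h => by
      have := hout z hz.1 h; linarith
    refine touch z (-((v z - f z) / χ z)) hz.1 h1 h2 (by linarith) ?_ ?_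
    · have := (hχ0 z hz).ne'
      field_simp; ring
    · filter_upwards [eventually_ann h1 h2] with y hy
      have := hmin y hy
      simp only [Pi.div_apply] at this
      rw [le_div_iff₀ (hχ0 y hy)] at this
      linarith
  intro y hy
  have := key.trans (hmin y hy)
  have h2 := (le_div_iff₀ (hχ0 y hy)).1 this
  linarith

/-- The abstract method of moving spheres. -/
theorem moving_spheres {v : E3 → ℝ} {F χ : ℝ → E3 → ℝ} {x : E3} {l₀ l₁ δ ρ : ℝ}
    (hx : 0 ≤ x 2) (hδ : 0 < δ) (hl₀ : 0 < l₀) (hρ : l₁ + δ < ρ)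
    (hc : ContinuousOn (fun p : ℝ × E3 => v p.2 - F p.1 p.2)
      {p | (0 < p.1 ∧ p.1 ≤ l₁) ∧ p.2 ∈ ann x p.1 ρ})
    (hχ : ∀ l, 0 < l → l ≤ l₁ → ContinuousOn (χ l) (ann x l (l + δ)))
    (hχ0 : ∀ l, 0 < l → l ≤ l₁ → ∀ z ∈ ann x l (l + δ), 0 < χ l z)
    (hin : ∀ l, 0 < l → l ≤ l₁ → ∀ z, 0 ≤ z 2 → ‖z - x‖ = l → F l z = v z)
    (hout : ∀ l, 0 < l → l ≤ l₁ → ∀ z, 0 ≤ z 2 → ‖z - x‖ = ρ → F l z < v z)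
    (hst : ∀ l, 0 < l → l ≤ l₁ → l ≤ l₀ → ∀ z ∈ ann x (l + δ) ρ, F l z < v z)
    (touch : ∀ l z t, 0 < l → l ≤ l₁ → 0 ≤ z 2 → l < ‖z - x‖ → ‖z - x‖ < ρ → 0 ≤ t →
      (t = 0 ∨ ‖z - x‖ < l + δ) → v z - F l z + t * χ l z = 0 →
      (∀ᶠ y in 𝓝[up] z, 0 ≤ v y - F l y + t * χ l y) → False) :
    ∀ l, 0 < l → l ≤ l₁ → ∀ z ∈ ann x l ρ, F l z ≤ v z := by
  have hcl : ∀ l, 0 < l → l ≤ l₁ → ContinuousOn (fun z => v z - F l z) (ann x l ρ) := by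
    intro l h1 h2
    have : ContinuousOn (fun z : E3 => ((l, z) : ℝ × E3)) (ann x l ρ) := by fun_prop
    exact hc.comp this fun z hz => ⟨⟨h1, h2⟩, hz⟩
  have hfull : ∀ l, 0 < l → l ≤ l₁ → (∀ z ∈ ann x (l + δ) ρ, F l z ≤ v z) →
      ∀ z ∈ ann x l ρ, F l z ≤ v z := by
    intro l h1 h2 h z hz
    by_cases hr : l + δ ≤ ‖z - x‖
    · exact h z ⟨hz.1, hr, hz.2.2⟩
    · push Not at hr
      refine shell_le h1 hx hδ ((hcl l h1 h2).mono fun y hy => ⟨hy.1, hy.2.1, by linarith [hy.2.2]⟩)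
        (hχ l h1 h2) (hχ0 l h1 h2) (hin l h1 h2)
        (fun y hy hy' => h y ⟨hy, hy'.ge, by linarith⟩) ?_ z ⟨hz.1, hz.2.1, hr.le⟩
      intro y t hy h3 h4 ht h5 h6
      exact touch l y t h1 h2 hy h3 (by linarith) ht.le (Or.inr h4) h5 h6
  set Q : Set (ℝ × E3) := {p | (l₀ ≤ p.1 ∧ p.1 ≤ l₁) ∧ (0 ≤ p.2 2 ∧ p.1 + δ ≤ ‖p.2 - x‖ ∧
    ‖p.2 - x‖ ≤ ρ)} with hQ
  have hQc : IsCompact Q := by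
    refine ((isCompact_Icc (a := l₀) (b := l₁)).prod (isCompact_closedBall x ρ)).of_isClosed_subset
      ?_ ?_
    · have c1 : Continuous fun p : ℝ × E3 => p.1 := continuous_fst
      have c2 : Continuous fun p : ℝ × E3 => ‖p.2 - x‖ := by fun_prop
      have c3 : Continuous fun p : ℝ × E3 => p.2 2 := by fun_prop
      exact ((isClosed_le continuous_const c1).inter (isClosed_le c1 continuous_const)).inter
        ((isClosed_le continuous_const c3).inter
          ((isClosed_le (c1.add continuous_const) c2).inter (isClosed_le c2 continuous_const)))
    · rintro ⟨l, z⟩ ⟨h1, _, _, h⟩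
      exact ⟨h1, by simpa [dist_eq_norm] using h⟩
  have hcQ : ContinuousOn (fun p : ℝ × E3 => v p.2 - F p.1 p.2) Q :=
    hc.mono fun p hp => ⟨⟨hl₀.trans_le hp.1.1, hp.1.2⟩, hp.2.1, by linarith [hp.2.2.1], hp.2.2.2⟩
  have hPc : IsCompact (Q ∩ (fun p : ℝ × E3 => v p.2 - F p.1 p.2) ⁻¹' Iic 0) :=
    hQc.of_isClosed_subset (hcQ.preimage_isClosed_of_isClosed hQc.isClosed isClosed_Iic)
      inter_subset_left
  have hempty : ¬ (Q ∩ (fun p : ℝ × E3 => v p.2 - F p.1 p.2) ⁻¹' Iic 0).Nonempty := by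
    intro hne
    obtain ⟨⟨l, z⟩, ⟨⟨⟨ha, hb⟩, h0, h1, h2⟩, h3⟩, hmin⟩ :=
      hPc.exists_isMinOn hne (continuous_fst.continuousOn)
    rw [isMinOn_iff] at hmin
    simp only [mem_preimage, mem_Iic] at ha hb h0 h1 h2 h3
    have hl : 0 < l := hl₀.trans_le ha
    have hlt : l₀ < l := lt_of_le_of_ne ha fun h => by
      have := hst l hl hb h.ge z ⟨h0, h1, h2⟩
      linarith
    have hsmall : ∀ s, l₀ ≤ s → s < l → ∀ y ∈ ann x s ρ, F s y ≤ v y := by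
      intro s hs1 hs2
      refine hfull s (by linarith) (by linarith) fun y hy => ?_
      by_contra! hcon
      have := hmin (s, y) ⟨⟨⟨hs1, by linarith⟩, hy⟩, by simp; linarith⟩
      simp at this; linarith
    have hle : ∀ y ∈ ann x l ρ, F l y ≤ v y := by
      intro y hy
      have hcy : ContinuousOn (fun s : ℝ => v y - F s y) (Ioc 0 l) := by
        have : ContinuousOn (fun s : ℝ => ((s, y) : ℝ × E3)) (Ioc 0 l) := by fun_prop
        exact hc.comp this fun s hs => ⟨⟨hs.1, hs.2.trans hb⟩, hy.1, hs.2.trans hy.2.1, hy.2.2⟩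
      have h4 := (hcy l ⟨hl, le_rfl⟩).tendsto
      have h5 : (𝓝[<] l) ≤ 𝓝[Ioc 0 l] l := by
        rw [← nhdsWithin_Ioo_eq_nhdsLT hl]
        exact nhdsWithin_mono _ fun s hs => ⟨hs.1, hs.2.le⟩
      have h6 := h4.mono_left h5
      have : 0 ≤ v y - F l y := by
        refine ge_of_tendsto h6 ?_
        filter_upwards [Ioo_mem_nhdsLT hlt] with s hs
        have := hsmall s hs.1.le hs.2 y ⟨hy.1, by linarith [hs.2, hy.2.1], hy.2.2⟩
        linarith
      linarith
    have h2' : ‖z - x‖ < ρ := lt_of_le_of_ne h2 fun h => by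
      have := hout l hl hb z h0 h
      linarith
    have hz := hle z ⟨h0, by linarith, h2⟩
    refine touch l z 0 hl hb h0 (by linarith) h2' le_rfl (Or.inl rfl) (by linarith) ?_
    filter_upwards [eventually_ann (show l < ‖z - x‖ by linarith) h2'] with y hy
    have := hle y hy
    linarith
  intro l h1 h2
  refine hfull l h1 h2 fun z hz => ?_
  rcases le_or_gt l l₀ with h | h
  · exact (hst l h1 h2 h z hz).le
  · by_contra! hcon
    exact hempty ⟨(l, z), ⟨⟨h.le, h2⟩, hz⟩, by simp; linarith⟩

/-- The radial profile of the barrier. -/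
def prof (S r : ℝ) : ℝ := Real.exp (-S / √(1 + r))

lemma hasDerivAt_sqrt_one_add {r : ℝ} (hr : 0 < 1 + r) :
    HasDerivAt (fun r : ℝ => √(1 + r)) (1 / (2 * √(1 + r))) r :=
  ((hasDerivAt_id r).const_add 1).sqrt hr.ne'

lemma hasDerivAt_prof {S r : ℝ} (hr : 0 < 1 + r) :
    HasDerivAt (prof S) (prof S r * (S / (2 * √(1 + r) ^ 3))) r := by
  have h0 : √(1 + r) ≠ 0 := (Real.sqrt_pos.2 hr).ne'
  have h := ((hasDerivAt_const r (-S)).div (hasDerivAt_sqrt_one_add hr) h0).exp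
  refine h.congr_deriv ?_
  simp only [prof, Pi.div_apply]
  congr 1
  field_simp
  ring

lemma hasDerivAt_prof' {S r : ℝ} (hr : 0 < 1 + r) :
    HasDerivAt (fun r => prof S r * (S / (2 * √(1 + r) ^ 3)))
      (prof S r * (S ^ 2 / (4 * √(1 + r) ^ 6) - 3 * S / (4 * √(1 + r) ^ 5))) r := by
  have h0 : √(1 + r) ≠ 0 := (Real.sqrt_pos.2 hr).ne'
  have h := (hasDerivAt_prof (S := S) hr).mul ((hasDerivAt_const r S).div
    (((hasDerivAt_sqrt_one_add hr).pow 3).const_mul 2) (by simpa using h0))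
  refine h.congr_deriv ?_
  simp only [Pi.div_apply, Pi.pow_apply]
  push_cast
  field_simp
  ring

lemma prof_le_one {S r : ℝ} (hS : 0 ≤ S) : prof S r ≤ 1 := by
  unfold prof
  rw [Real.exp_le_one_iff, neg_div]
  have : 0 ≤ S / √(1 + r) := by positivity
  linarith

lemma prof_pos (S r : ℝ) : 0 < prof S r := Real.exp_pos _

lemma exp_le_prof {S r : ℝ} (hS : 0 ≤ S) (hr : 0 ≤ r) : Real.exp (-S) ≤ prof S r := by
  unfold prof
  rw [Real.exp_le_exp, neg_div, neg_le_neg_iff]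
  refine div_le_self hS ?_
  rw [Real.one_le_sqrt]; linarith

lemma prof_sub_ge {S l r : ℝ} (hS : 0 ≤ S) (hl : 0 ≤ l) (hr : l ≤ r) :
    Real.exp (-S) * S * (r - l) / (2 * (1 + r) * (1 + l)) ≤ prof S r - prof S l := by
  set a := √(1 + l) with ha
  set b := √(1 + r) with hb
  have ha1 : 1 ≤ a := by rw [ha, Real.one_le_sqrt]; linarith
  have hab : a ≤ b := Real.sqrt_le_sqrt (by linarith)
  have haa : a ^ 2 = 1 + l := Real.sq_sqrt (by linarith)
  have hbb : b ^ 2 = 1 + r := Real.sq_sqrt (by linarith)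
  have hE : Real.exp (-S / b) = Real.exp (-S / a) * Real.exp (S / a - S / b) := by
    rw [← Real.exp_add]; congr 1; ring
  have h1 := Real.add_one_le_exp (S / a - S / b)
  have h2 := exp_le_prof hS hl
  have h3 : 0 ≤ S / a - S / b := by
    rw [sub_nonneg]; exact div_le_div_of_nonneg_left hS (by linarith) hab
  have h4 : prof S l * (S / a - S / b) ≤ prof S r - prof S l := by
    unfold prof at h2 ⊢
    rw [← ha, ← hb, hE]
    nlinarith [Real.exp_pos (-S / a)]
  refine le_trans ?_ h4
  refine le_trans ?_ (mul_le_mul_of_nonneg_right h2 h3)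
  rw [mul_assoc, mul_div_assoc]
  refine mul_le_mul_of_nonneg_left ?_ (Real.exp_pos _).le
  have hb0 : 0 < b := by linarith
  have ha0 : 0 < a := by linarith
  rw [div_sub_div _ _ ha0.ne' hb0.ne', ← haa, ← hbb, div_le_div_iff₀ (by positivity) (by positivity)]
  have e1 : r - l = (b - a) * (b + a) := by linarith [hbb, haa, sq_sub_sq b a]
  rw [e1]
  have e2 : 0 ≤ S * (b - a) * (a * b) := mul_nonneg (mul_nonneg hS (by linarith)) (by positivity)
  have e3 : b + a ≤ 2 * b * a := by nlinarith
  nlinarith [mul_le_mul_of_nonneg_left e3 e2]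

/-- The barrier. -/
def bar (S β : ℝ) (x : E3) (l : ℝ) (z : E3) : ℝ :=
  1 * (prof S ‖z - x‖ - prof S l) +
    β * (z - x) 2 * ((prof S ‖z - x‖ - prof S l) / (1 + ‖z - x‖) ^ 2)

lemma prof_mono {S l r : ℝ} (hS : 0 ≤ S) (hl : 0 ≤ l) (hr : l ≤ r) : prof S l ≤ prof S r := by
  have := prof_sub_ge hS hl hr
  have h2 : 0 ≤ Real.exp (-S) * S * (r - l) / (2 * (1 + r) * (1 + l)) := by
    have : 0 ≤ r - l := by linarith
    have : 0 ≤ r := by linarith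
    positivity
  linarith

lemma bar_lap_bound {q r p g s β S : ℝ} (hq : 1 ≤ q) (hr : 0 < r) (hrq : 1 + r = q ^ 2)
    (hp : 0 < p) (hg : 0 ≤ g) (hgp : g ≤ p) (hβ : 0 ≤ β) (hs : 0 ≤ β * s) (hsr : β * s ≤ β * r)
    (hS : S = 4 * β + 8) :
    p / q ^ 6 ≤ (p * (S ^ 2 / (4 * q ^ 6) - 3 * S / (4 * q ^ 5)) +
        2 * (p * (S / (2 * q ^ 3))) / r) +
      β * s * ((p * (S ^ 2 / (4 * q ^ 6) - 3 * S / (4 * q ^ 5)) / (q ^ 2) ^ 2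
        - 4 * (p * (S / (2 * q ^ 3))) / (q ^ 2) ^ 3 + 6 * g / (q ^ 2) ^ 4) +
        4 * (p * (S / (2 * q ^ 3)) / (q ^ 2) ^ 2 - 2 * g / (q ^ 2) ^ 3) / r) := by
  have hS0 : 0 ≤ S := by rw [hS]; positivity
  have hq0 : 0 < q := by linarith
  have h1 : p * (S ^ 2 / (4 * q ^ 6)) ≤ p * (S ^ 2 / (4 * q ^ 6) - 3 * S / (4 * q ^ 5)) +
        2 * (p * (S / (2 * q ^ 3))) / r := by
    have : p * S / q ^ 5 ≤ 2 * (p * (S / (2 * q ^ 3))) / r := by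
      rw [show 2 * (p * (S / (2 * q ^ 3))) / r = p * S / (q ^ 3 * r) by field_simp]
      refine div_le_div_of_nonneg_left (by positivity) (by positivity) ?_
      have : q ^ 3 * r ≤ q ^ 3 * q ^ 2 := by gcongr; linarith
      nlinarith
    have h2 : 0 ≤ p * S / q ^ 5 := by positivity
    have h3 : p * (3 * S / (4 * q ^ 5)) = 3 / 4 * (p * S / q ^ 5) := by field_simp
    rw [mul_sub, h3]; linarith
  have h2 : -(3 * S * p / (4 * q ^ 9) + 8 * p / (r * q ^ 6)) ≤
      (p * (S ^ 2 / (4 * q ^ 6) - 3 * S / (4 * q ^ 5)) / (q ^ 2) ^ 2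
        - 4 * (p * (S / (2 * q ^ 3))) / (q ^ 2) ^ 3 + 6 * g / (q ^ 2) ^ 4) +
        4 * (p * (S / (2 * q ^ 3)) / (q ^ 2) ^ 2 - 2 * g / (q ^ 2) ^ 3) / r := by
    have e : (p * (S ^ 2 / (4 * q ^ 6) - 3 * S / (4 * q ^ 5)) / (q ^ 2) ^ 2
        - 4 * (p * (S / (2 * q ^ 3))) / (q ^ 2) ^ 3 + 6 * g / (q ^ 2) ^ 4) +
        4 * (p * (S / (2 * q ^ 3)) / (q ^ 2) ^ 2 - 2 * g / (q ^ 2) ^ 3) / r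
        = p * S ^ 2 / (4 * q ^ 10) - 3 * S * p / (4 * q ^ 9) + 2 * p * S * (q ^ 2 - r) / (q ^ 9 * r)
          + 6 * g / q ^ 8 - 8 * g / (r * q ^ 6) := by
      field_simp
      ring
    rw [e]
    have t1 : 0 ≤ p * S ^ 2 / (4 * q ^ 10) := by positivity
    have t2 : 0 ≤ 2 * p * S * (q ^ 2 - r) / (q ^ 9 * r) := by
      have : 0 ≤ q ^ 2 - r := by linarith
      positivity
    have t3 : 0 ≤ 6 * g / q ^ 8 := by positivity
    have t4 : 8 * g / (r * q ^ 6) ≤ 8 * p / (r * q ^ 6) := by gcongr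
    linarith
  have h3 := mul_le_mul_of_nonneg_left h2 hs
  have h4 : β * s * (3 * S * p / (4 * q ^ 9) + 8 * p / (r * q ^ 6)) ≤
      β * r * (3 * S * p / (4 * q ^ 9) + 8 * p / (r * q ^ 6)) :=
    mul_le_mul_of_nonneg_right hsr (by positivity)
  have h5 : β * r * (3 * S * p / (4 * q ^ 9) + 8 * p / (r * q ^ 6)) ≤
      p / q ^ 6 * (β * (3 * S / 4 + 8)) := by
    have : r * (3 * S * p / (4 * q ^ 9)) ≤ p / q ^ 6 * (3 * S / 4) := by
      rw [show p / q ^ 6 * (3 * S / 4) = (3 * S * p / (4 * q ^ 9)) * q ^ 3 by field_simp]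
      rw [mul_comm]
      refine mul_le_mul_of_nonneg_left ?_ (by positivity)
      nlinarith [pow_le_pow_right₀ hq (show 2 ≤ 3 by norm_num)]
    have h8 : r * (8 * p / (r * q ^ 6)) = p / q ^ 6 * 8 := by field_simp
    nlinarith
  have h6 : p * (S ^ 2 / (4 * q ^ 6)) = p / q ^ 6 * (S ^ 2 / 4) := by field_simp
  have h7 : 0 < p / q ^ 6 := by positivity
  have h8 : 1 ≤ S ^ 2 / 4 - β * (3 * S / 4 + 8) := by rw [hS]; nlinarith
  nlinarith [mul_le_mul_of_nonneg_left h8 h7.le]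

lemma hasLap_bar {S β l : ℝ} {x z : E3} (hl : 0 ≤ l) (hr : l ≤ ‖z - x‖) (hz : z ≠ x) (hβ : 0 ≤ β)
    (hs : β = 0 ∨ 0 ≤ (z - x) 2) (hS : S = 4 * β + 8) :
    ∃ L, HasLap (bar S β x l) z L ∧ Real.exp (-S) / (1 + ‖z - x‖) ^ 3 ≤ L := by
  have hn : 0 < ‖z - x‖ := norm_pos_iff.2 (sub_ne_zero.2 hz)
  have hS0 : 0 ≤ S := by rw [hS]; positivity
  have hnear : ∀ᶠ s in 𝓝 ‖z - x‖, 0 < s := lt_mem_nhds hn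
  have d1 : ∀ s, 0 < s → HasDerivAt (fun r => prof S r - prof S l)
      (prof S s * (S / (2 * √(1 + s) ^ 3))) s := fun s hs =>
    (hasDerivAt_prof (by linarith)).sub_const _
  have d2 : ∀ s, 0 < s → HasDerivAt (fun r => (prof S r - prof S l) / (1 + r) ^ 2)
      (prof S s * (S / (2 * √(1 + s) ^ 3)) / (1 + s) ^ 2 - 2 * (prof S s - prof S l) / (1 + s) ^ 3)
      s := fun s hs => by
    refine ((d1 s hs).div (((hasDerivAt_id s).const_add 1).pow 2) (by simp; positivity)).congr_deriv ?_
    simp only [Pi.pow_apply, id]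
    have : 1 + s ≠ 0 := by positivity
    push_cast
    field_simp
  have d3 := hasDerivAt_prof' (S := S) (show 0 < 1 + ‖z - x‖ by linarith)
  have d4 : HasDerivAt (fun s => prof S s * (S / (2 * √(1 + s) ^ 3)) / (1 + s) ^ 2 -
      2 * (prof S s - prof S l) / (1 + s) ^ 3)
      (prof S ‖z - x‖ * (S ^ 2 / (4 * √(1 + ‖z - x‖) ^ 6) - 3 * S / (4 * √(1 + ‖z - x‖) ^ 5))
        / (1 + ‖z - x‖) ^ 2 - 4 * (prof S ‖z - x‖ * (S / (2 * √(1 + ‖z - x‖) ^ 3))) /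
        (1 + ‖z - x‖) ^ 3 + 6 * (prof S ‖z - x‖ - prof S l) / (1 + ‖z - x‖) ^ 4) ‖z - x‖ := by
    refine ((d3.div (((hasDerivAt_id ‖z - x‖).const_add 1).pow 2) (by simp; positivity)).sub
      (((d1 _ hn).const_mul 2).div (((hasDerivAt_id ‖z - x‖).const_add 1).pow 3)
        (by simp; positivity))).congr_deriv ?_
    simp only [Pi.pow_apply, id]
    have : 1 + ‖z - x‖ ≠ 0 := by positivity
    push_cast
    generalize prof S ‖z - x‖ * (S ^ 2 / (4 * √(1 + ‖z - x‖) ^ 6) -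
      3 * S / (4 * √(1 + ‖z - x‖) ^ 5)) = X
    generalize prof S ‖z - x‖ * (S / (2 * √(1 + ‖z - x‖) ^ 3)) = Y
    field_simp
    ring
  have A := hasLap_height_radial (a := fun _ => 1) (a₁ := fun _ => 0) (a₂ := 0) hz
    (Eventually.of_forall fun s => hasDerivAt_const s (1 : ℝ)) (hasDerivAt_const _ (0 : ℝ))
    (hnear.mono fun s hs => d1 s hs) d3
  have B := hasLap_height_radial (a := fun s => β * s) (a₁ := fun _ => β) (a₂ := 0) hz
    (Eventually.of_forall fun s => by simpa using (hasDerivAt_id s).const_mul β)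
    (hasDerivAt_const _ β) (hnear.mono fun s hs => d2 s hs) d4
  refine ⟨_, A.add B, ?_⟩
  have hq : 1 ≤ √(1 + ‖z - x‖) := by rw [Real.one_le_sqrt]; linarith
  have hqq : 1 + ‖z - x‖ = √(1 + ‖z - x‖) ^ 2 := (Real.sq_sqrt (by linarith)).symm
  have hb := bar_lap_bound (p := prof S ‖z - x‖) (g := prof S ‖z - x‖ - prof S l) (s := (z - x) 2)
    hq hn hqq (prof_pos _ _) (by linarith [prof_mono hS0 hl hr])
    (by linarith [prof_pos S l]) hβ ?_ ?_ hS
  · have e := exp_le_prof hS0 hn.le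
    have h6 : (1 + ‖z - x‖) ^ 3 = √(1 + ‖z - x‖) ^ 6 := by
      calc (1 + ‖z - x‖) ^ 3 = (√(1 + ‖z - x‖) ^ 2) ^ 3 := by rw [← hqq]
        _ = _ := by ring
    have h7 : Real.exp (-S) / (1 + ‖z - x‖) ^ 3 ≤ prof S ‖z - x‖ / √(1 + ‖z - x‖) ^ 6 := by
      rw [h6]; gcongr
    refine h7.trans (hb.trans (le_of_eq ?_))
    rw [← hqq]
    ring
  · rcases hs with h | h
    · simp [h]
    · exact mul_nonneg hβ h
  · exact mul_le_mul_of_nonneg_left (coord_le _ _) hβ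

lemma bar_nonneg {S β l : ℝ} {x z : E3} (hl : 0 ≤ l) (hr : l ≤ ‖z - x‖) (hβ : 0 ≤ β)
    (hs : β = 0 ∨ 0 ≤ (z - x) 2) (hS : 0 ≤ S) : 0 ≤ bar S β x l z := by
  have h1 := prof_mono hS hl hr
  have h2 : 0 ≤ prof S ‖z - x‖ - prof S l := by linarith
  have h3 : 0 ≤ β * (z - x) 2 := by
    rcases hs with h | h
    · simp [h]
    · exact mul_nonneg hβ h
  unfold bar
  positivity

lemma bar_le {S β l : ℝ} {x z : E3} (hl : 0 ≤ l) (hr : l ≤ ‖z - x‖) (hβ : 0 ≤ β)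
    (hS : 0 ≤ S) : bar S β x l z ≤ 1 + β := by
  have h1 := prof_mono hS hl hr
  have h2 : 0 ≤ prof S ‖z - x‖ - prof S l := by linarith
  have h2' : prof S ‖z - x‖ - prof S l ≤ 1 := by
    linarith [prof_le_one (S := S) (r := ‖z - x‖) hS, prof_pos S l]
  have h3 : β * (z - x) 2 ≤ β * ‖z - x‖ := mul_le_mul_of_nonneg_left (coord_le _ _) hβ
  have hn := norm_nonneg (z - x)
  unfold bar
  have h5 : 0 ≤ (prof S ‖z - x‖ - prof S l) / (1 + ‖z - x‖) ^ 2 := by positivity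
  have h4 : (prof S ‖z - x‖ - prof S l) / (1 + ‖z - x‖) ^ 2 * ‖z - x‖ ≤ 1 := by
    rw [div_mul_eq_mul_div, div_le_one (by positivity)]
    nlinarith
  nlinarith [mul_le_mul_of_nonneg_right h3 h5]

lemma bar_inner {S β l : ℝ} {x z : E3} (h : ‖z - x‖ = l) : bar S β x l z = 0 := by
  simp [bar, h]

lemma continuousOn_bar (S β : ℝ) (x : E3) :
    ContinuousOn (fun p : ℝ × E3 => bar S β x p.1 p.2) {p | 0 ≤ p.1} := by
  have h1 : ContinuousOn (prof S) (Ici 0) := fun r (hr : 0 ≤ r) =>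
    (hasDerivAt_prof (S := S) (show 0 < 1 + r by linarith)).continuousAt.continuousWithinAt
  have h2 : ContinuousOn (fun p : ℝ × E3 => prof S ‖p.2 - x‖ - prof S p.1) {p | 0 ≤ p.1} :=
    ((h1.comp (by fun_prop) fun p _ => norm_nonneg (p.2 - x)).sub
      (h1.comp (by fun_prop) fun p hp => hp))
  have h3 : ContinuousOn (fun p : ℝ × E3 => β * (p.2 - x) 2) {p | 0 ≤ p.1} := by fun_prop
  unfold bar
  refine (continuousOn_const.mul h2).add (h3.mul (h2.div (by fun_prop) fun p _ => ?_))
  positivity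

/-- Vertical derivative of the barrier at a point of the plane. -/
lemma hasDerivAt_bar_vert {S β l : ℝ} {x z : E3} (hz : z ≠ x) (hs : β = 0 ∨ (z - x) 2 = 0) :
    HasDerivAt (fun t : ℝ => bar S β x l (z + t • e3))
      (prof S ‖z - x‖ * (S / (2 * √(1 + ‖z - x‖) ^ 3)) * ((z - x) 2 / ‖z - x‖) +
        β * ((prof S ‖z - x‖ - prof S l) / (1 + ‖z - x‖) ^ 2)) 0 := by
  have hn : 0 < ‖z - x‖ := norm_pos_iff.2 (sub_ne_zero.2 hz)
  have h00 : z + (0:ℝ) • eb 2 ≠ x := by simpa using hz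
  have dn := hasDerivAt_norm_line h00
  have dc := hasDerivAt_coord_line x z 2 2 0
  simp only [zero_smul, add_zero] at dn dc
  have d1 : HasDerivAt (fun t : ℝ => prof S ‖z + t • eb 2 - x‖ - prof S l)
      (prof S ‖z - x‖ * (S / (2 * √(1 + ‖z - x‖) ^ 3)) * ((z - x) 2 / ‖z - x‖)) 0 := by
    have := HasDerivAt.comp (h := fun t : ℝ => ‖z + t • eb 2 - x‖) 0
      (by simpa using hasDerivAt_prof (S := S) (show 0 < 1 + ‖z - x‖ by linarith)) dn
    exact this.sub_const _
  have d2 := d1.div ((dn.const_add 1).pow 2) (by simp; positivity)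
  have d3 := (d1.const_mul 1).add ((dc.const_mul β).mul d2)
  refine d3.congr_deriv ?_
  simp only [Pi.pow_apply, Pi.div_apply, zero_smul, add_zero, if_true]
  rcases hs with h | h
  · simp [h]
  · simp [h]

/-- The auxiliary function used close to the sphere. -/
def shf (k μ : ℝ) (x : E3) (l : ℝ) (z : E3) : ℝ :=
  Real.exp (-k * (z - x) 2) * (1 - μ ^ 2 * (‖z - x‖ - l) ^ 2)

lemma shf_pos {k μ l : ℝ} {x z : E3} (hμ : 0 < μ) (h1 : l ≤ ‖z - x‖)
    (h2 : ‖z - x‖ ≤ l + 1 / (2 * μ)) : 0 < shf k μ x l z := by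
  refine mul_pos (Real.exp_pos _) ?_
  have h3 : μ * (‖z - x‖ - l) ≤ 1 / 2 := by
    calc μ * (‖z - x‖ - l) ≤ μ * (1 / (2 * μ)) := by gcongr; linarith
      _ = 1 / 2 := by field_simp
  have h4 : 0 ≤ μ * (‖z - x‖ - l) := mul_nonneg hμ.le (by linarith)
  nlinarith

lemma hasLap_shf {k μ l M : ℝ} {x z : E3} (hμ : 0 < μ) (h1 : l ≤ ‖z - x‖)
    (h2 : ‖z - x‖ ≤ l + 1 / (2 * μ)) (hz : z ≠ x) (hk : 0 ≤ k) (hM : 0 ≤ M)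
    (hkμ : k ^ 2 + 2 * k * μ + M ≤ 2 * μ ^ 2) :
    ∃ L, HasLap (shf k μ x l) z L ∧ L ≤ -M * shf k μ x l z := by
  have hn : 0 < ‖z - x‖ := norm_pos_iff.2 (sub_ne_zero.2 hz)
  have e1 : ∀ s : ℝ, HasDerivAt (fun s => Real.exp (-k * s)) (-k * Real.exp (-k * s)) s := by
    intro s
    have := ((hasDerivAt_id s).const_mul (-k)).exp
    refine this.congr_deriv ?_
    simp; ring
  have e2 : ∀ s : ℝ, HasDerivAt (fun r => 1 - μ ^ 2 * (r - l) ^ 2) (-(2 * μ ^ 2) * (s - l)) s := by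
    intro s
    have := ((((hasDerivAt_id s).sub_const l).pow 2).const_mul (μ ^ 2)).const_sub 1
    refine this.congr_deriv ?_
    simp; ring
  have e3 : HasDerivAt (fun s => -(2 * μ ^ 2) * (s - l)) (-(2 * μ ^ 2)) ‖z - x‖ := by
    simpa using ((hasDerivAt_id ‖z - x‖).sub_const l).const_mul (-(2 * μ ^ 2))
  have A := hasLap_height_radial hz (Eventually.of_forall e1) ((e1 ((z - x) 2)).const_mul (-k))
    (Eventually.of_forall e2) e3
  refine ⟨_, A, ?_⟩
  unfold shf
  set E := Real.exp (-k * (z - x) 2)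
  have hE : 0 < E := Real.exp_pos _
  set y := ‖z - x‖ - l
  have hy : 0 ≤ y := by simp only [y]; linarith
  have h3 : μ * y ≤ 1 / 2 := by
    calc μ * y ≤ μ * (1 / (2 * μ)) := by gcongr; simp only [y]; linarith
      _ = 1 / 2 := by field_simp
  have h4 : 0 ≤ μ * y := by positivity
  have h5 : 2 * (-k * E) * (-(2 * μ ^ 2) * y) * ((z - x) 2 / ‖z - x‖) ≤ E * (2 * k * μ) := by
    have t1 : (z - x) 2 / ‖z - x‖ ≤ 1 := (div_le_one hn).2 (coord_le _ _)
    have t2 : 2 * (-k * E) * (-(2 * μ ^ 2) * y) = E * (4 * k * μ * (μ * y)) := by ring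
    rw [t2]
    have t3 : 0 ≤ E * (4 * k * μ * (μ * y)) := by positivity
    calc E * (4 * k * μ * (μ * y)) * ((z - x) 2 / ‖z - x‖) ≤ E * (4 * k * μ * (μ * y)) * 1 := by
          gcongr
      _ ≤ E * (2 * k * μ) := by
          rw [mul_one]
          have : 0 ≤ 4 * k * μ := by positivity
          refine mul_le_mul_of_nonneg_left ?_ hE.le
          nlinarith
  have h6 : 2 * (-(2 * μ ^ 2) * y) / ‖z - x‖ ≤ 0 := by
    rw [show 2 * (-(2 * μ ^ 2) * y) / ‖z - x‖ = -(4 * μ ^ 2 * y / ‖z - x‖) by ring]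
    have : 0 ≤ 4 * μ ^ 2 * y / ‖z - x‖ := by positivity
    linarith
  have h7 : E * (-(2 * μ ^ 2) + 2 * (-(2 * μ ^ 2) * y) / ‖z - x‖) ≤ E * (-(2 * μ ^ 2)) := by
    gcongr; linarith
  have h8 : 0 ≤ μ ^ 2 * y ^ 2 := by positivity
  have h9 : -k * (-k * E) * (1 - μ ^ 2 * y ^ 2) ≤ E * k ^ 2 := by
    have : 0 ≤ k ^ 2 * E := by positivity
    nlinarith
  have h10 : -M * (E * (1 - μ ^ 2 * y ^ 2)) ≥ E * (-M) := by
    have : 0 ≤ M * E := by positivity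
    nlinarith
  have h11 : E * (k ^ 2 + 2 * k * μ + M) ≤ E * (2 * μ ^ 2) := by gcongr
  nlinarith

lemma hasDerivAt_shf_vert {k μ l : ℝ} {x z : E3} (hz : z ≠ x) (hs : (z - x) 2 = 0) :
    HasDerivAt (fun t : ℝ => shf k μ x l (z + t • e3)) (-k * shf k μ x l z) 0 := by
  have h00 : z + (0:ℝ) • eb 2 ≠ x := by simpa using hz
  have dn := hasDerivAt_norm_line h00
  have dc := hasDerivAt_coord_line x z 2 2 0
  simp only [zero_smul, add_zero] at dn dc
  have := (dc.const_mul (-k)).exp.mul ((((dn.sub_const l).pow 2).const_mul (μ ^ 2)).const_sub 1)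
  refine this.congr_deriv ?_
  simp only [Pi.pow_apply, zero_smul, add_zero, if_true, hs, shf]
  simp

/-- The upper half-ball together with its flat boundary. -/
def hB (ρ : ℝ) : Set E3 := {x | ‖x‖ < ρ ∧ 0 ≤ x 2}

lemma hB_eq_union (ρ : ℝ) : hB ρ = oB ρ ∪ fB ρ := by
  ext x
  simp only [hB, oB, fB, mem_union, mem_ofPred_eq, le_iff_lt_or_eq, eq_comm (a := (0 : ℝ))]
  tauto

/-- Positive solutions on a half-ball of the equation with nonlinear boundary condition, with
`ε` measuring the Lipschitz constants of the coefficients. -/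
structure Sol (Λ ε ρ : ℝ) (v K c : E3 → ℝ) : Prop where
  pos : ∀ z ∈ hB ρ, 0 < v z
  cont : ContinuousOn v (hB ρ)
  c2 : ∀ z ∈ hB ρ, 0 < z 2 → ContDiffAt ℝ 2 v z
  eqn : ∀ z ∈ hB ρ, 0 < z 2 → lap v z = -(K z * v z ^ 5)
  bdry : ∀ z ∈ hB ρ, z 2 = 0 → ∃ G : E3 →L[ℝ] ℝ, HasFDerivWithinAt v G up z ∧
    G e3 = c z * v z ^ 3
  Klow : ∀ z ∈ hB ρ, Λ⁻¹ ≤ K z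
  Kup : ∀ z ∈ hB ρ, K z ≤ Λ
  Klip : ∀ y ∈ hB ρ, ∀ z ∈ hB ρ, |K y - K z| ≤ Λ * ε * ‖y - z‖
  cbd : ∀ z ∈ hB ρ, z 2 = 0 → |c z| ≤ Λ
  clip : ∀ y ∈ hB ρ, ∀ z ∈ hB ρ, y 2 = 0 → z 2 = 0 → |c y - c z| ≤ Λ * ε * ‖y - z‖

lemma norm_inv_sub {x z : E3} (l : ℝ) (hz : z ≠ x) : ‖inv x l z - x‖ = l ^ 2 / ‖z - x‖ := by
  have hn : ‖z - x‖ ≠ 0 := by simpa [sub_eq_zero] using hz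
  rw [inv, add_sub_cancel_left, norm_smul, Real.norm_of_nonneg (by positivity)]
  field_simp

lemma inv_coord (x z : E3) (l : ℝ) (i : Fin 3) :
    inv x l z i = x i + l ^ 2 / ‖z - x‖ ^ 2 * (z i - x i) := by
  simp [inv]

lemma inv_height {x z : E3} {l : ℝ} (hl : 0 ≤ l) (hr : l ≤ ‖z - x‖) (hz : z ≠ x) (hx : 0 ≤ x 2)
    (hz2 : 0 ≤ z 2) : 0 ≤ inv x l z 2 ∧ (0 < l → 0 < z 2 → 0 < inv x l z 2) := by
  have hn : 0 < ‖z - x‖ := norm_pos_iff.2 (sub_ne_zero.2 hz)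
  have h1 : l ^ 2 / ‖z - x‖ ^ 2 ≤ 1 := by
    rw [div_le_one (by positivity)]; gcongr
  have h0 : 0 ≤ l ^ 2 / ‖z - x‖ ^ 2 := by positivity
  rw [inv_coord]
  refine ⟨by nlinarith, fun h2 h3 => ?_⟩
  have h0 : 0 < l ^ 2 / ‖z - x‖ ^ 2 := by positivity
  nlinarith [mul_pos h0 h3]

lemma norm_sub_inv {x z : E3} {l : ℝ} (hl : 0 ≤ l) (hr : l ≤ ‖z - x‖) (hz : z ≠ x) :
    ‖inv x l z - z‖ = ‖z - x‖ - l ^ 2 / ‖z - x‖ := by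
  have hn : 0 < ‖z - x‖ := norm_pos_iff.2 (sub_ne_zero.2 hz)
  have e : inv x l z - z = -((1 - l ^ 2 / ‖z - x‖ ^ 2) • (z - x)) := by
    simp only [inv, sub_smul, one_smul]; abel
  have h1 : l ^ 2 / ‖z - x‖ ^ 2 ≤ 1 := by
    rw [div_le_one (by positivity)]; gcongr
  rw [e, norm_neg, norm_smul, Real.norm_of_nonneg (by linarith)]
  field_simp

lemma kelv_inner {x z : E3} {l : ℝ} (hl : 0 < l) (hr : ‖z - x‖ = l) (v : E3 → ℝ) :
    kelv x l v z = v z := by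
  simp [kelv, inv, hr, hl.ne']

lemma hasDerivWithinAt_kelv_vert {x z : E3} {l : ℝ} {v : E3 → ℝ} {G : E3 →L[ℝ] ℝ} (hz : z ≠ x)
    (hx2 : x 2 = 0) (hz2 : z 2 = 0) (hv : HasFDerivWithinAt v G up (inv x l z)) :
    HasDerivWithinAt (fun t : ℝ => kelv x l v (z + t • e3)) ((l / ‖z - x‖) ^ 3 * G e3)
      (Ici 0) 0 := by
  have hn : ‖z - x‖ ≠ 0 := by simpa [sub_eq_zero] using hz
  have h0 : z + (0:ℝ) • eb 2 ≠ x := by simpa using hz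
  have h1 := (hasDerivAt_const (0:ℝ) l).div (hasDerivAt_norm_line h0) (by simpa using hn)
  have dI := hasDerivAt_inv_line (l := l) h0
  have hm : MapsTo (fun t : ℝ => inv x l (z + t • eb 2)) (Ici 0) up := by
    intro t (ht : 0 ≤ t)
    show 0 ≤ inv x l (z + t • eb 2) 2
    rw [inv_coord]
    simp only [PiLp.add_apply, PiLp.smul_apply, eb_apply, if_true, smul_eq_mul, mul_one, hx2, hz2]
    have : 0 ≤ l ^ 2 / ‖z + t • eb 2 - x‖ ^ 2 := by positivity
    nlinarith [mul_nonneg this ht]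
  have h2 := HasFDerivWithinAt.comp_hasDerivWithinAt (f := fun t : ℝ => inv x l (z + t • eb 2))
    (0:ℝ) (by simpa using hv) dI.hasDerivWithinAt hm
  refine (h1.hasDerivWithinAt.mul h2).congr_deriv ?_
  simp only [zero_smul, add_zero, PiLp.sub_apply, hx2, hz2, Function.comp, Pi.div_apply, eb_two]
  simp
  field_simp

lemma interior_contact {Λ ε C L l l₁ r E Kz KI vz w b T X : ℝ} (hΛ : 0 < Λ) (hε : 0 < ε)
    (hC0 : 0 < C) (hr0 : 0 < r) (h1 : 0 < l) (h2 : l ≤ l₁) (h3 : l < r)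
    (hC : 32 * Λ * l₁ * (1 + l₁) ^ 4 < C * E) (hw0 : 0 < w) (hw : w ≤ 2 * (l / r))
    (hvp : 0 < vz) (hKz0 : 0 < Kz) (hKz : Kz ≤ Λ) (hKl : KI - Kz ≤ Λ * ε * r) (hb : 0 ≤ b)
    (hT : 0 ≤ T) (hvw : w - vz = T - b) (hL : E / (1 + r) ^ 3 ≤ L) (hX : X ≤ -(80 * Λ) * T)
    (key : 0 ≤ -(Kz * vz ^ 5) - (-(KI * w ^ 5) + ε * C * L) + X) : False := by
  have hlr : l / r ≤ 1 := (div_le_one hr0).2 h3.le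
  have hlr0 : 0 < l / r := by positivity
  have hE : (KI - Kz) * w ^ 5 ≤ Λ * ε * r * (2 * (l / r)) ^ 5 := by
    calc (KI - Kz) * w ^ 5 ≤ Λ * ε * r * w ^ 5 := by gcongr
      _ ≤ _ := by gcongr
  have hN : Kz * (w ^ 5 - vz ^ 5) ≤ 80 * Λ * T := by
    rcases le_total w vz with h | h
    · have : w ^ 5 ≤ vz ^ 5 := by gcongr
      have h8 : Kz * (w ^ 5 - vz ^ 5) ≤ 0 := mul_nonpos_of_nonneg_of_nonpos hKz0.le (by linarith)
      have : 0 ≤ 80 * Λ * T := by positivity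
      linarith
    · have hw2 : w ≤ 2 := by linarith
      have e : w ^ 5 - vz ^ 5 = (w - vz) * (w ^ 4 + w ^ 3 * vz + w ^ 2 * vz ^ 2 +
        w * vz ^ 3 + vz ^ 4) := by ring
      have e2 : w ^ 4 + w ^ 3 * vz + w ^ 2 * vz ^ 2 + w * vz ^ 3 + vz ^ 4 ≤ 80 := by
        have hv2' : vz ≤ 2 := by linarith
        calc _ ≤ (2:ℝ) ^ 4 + 2 ^ 3 * 2 + 2 ^ 2 * 2 ^ 2 + 2 * 2 ^ 3 + 2 ^ 4 := by gcongr
          _ = 80 := by norm_num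
      have e3 : w ^ 5 - vz ^ 5 ≤ T * 80 := by
        rw [e]
        have : w - vz ≤ T := by linarith
        gcongr
      have e4 : 0 ≤ w ^ 5 - vz ^ 5 := by
        have : vz ^ 5 ≤ w ^ 5 := by gcongr
        linarith
      calc Kz * (w ^ 5 - vz ^ 5) ≤ Λ * (T * 80) := by gcongr
        _ = _ := by ring
  have hfin : C * L ≤ Λ * r * (2 * (l / r)) ^ 5 := by
    have : ε * (C * L) ≤ ε * (Λ * r * (2 * (l / r)) ^ 5) := by linarith
    exact le_of_mul_le_mul_left this hε
  have hl₁ : 0 < l₁ := by linarith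
  have hlr4 : l / r ≤ (1 + l₁) / (1 + r) := by
    rw [div_le_div_iff₀ hr0 (by positivity)]; nlinarith
  have h10 : Λ * r * (2 * (l / r)) ^ 5 ≤ 32 * Λ * l₁ * (1 + l₁) ^ 4 / (1 + r) ^ 4 := by
    calc Λ * r * (2 * (l / r)) ^ 5 = 32 * Λ * l * (l / r) ^ 4 := by
          field_simp; ring
      _ ≤ 32 * Λ * l₁ * ((1 + l₁) / (1 + r)) ^ 4 := by gcongr
      _ = _ := by rw [div_pow]; ring
  have h11 : C * (E / (1 + r) ^ 3) ≤ C * L := by gcongr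
  have h12 : 32 * Λ * l₁ * (1 + l₁) ^ 4 / (1 + r) ^ 4 ≤
      32 * Λ * l₁ * (1 + l₁) ^ 4 / (1 + r) ^ 3 := by
    refine div_le_div_of_nonneg_left (by positivity) (by positivity) ?_
    exact pow_le_pow_right₀ (by linarith) (by norm_num)
  have h13 : 32 * Λ * l₁ * (1 + l₁) ^ 4 / (1 + r) ^ 3 < C * (E / (1 + r) ^ 3) := by
    rw [← mul_div_assoc]; gcongr
  linarith

/-- Moving spheres with an `ε`-small barrier, up to contact points on the flat boundary. -/
theorem ms_core {Λ ε ρ : ℝ} {v K c : E3 → ℝ} (hv : Sol Λ ε ρ v K c) {x : E3} (hx : 0 ≤ x 2)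
    {l₁ β k C A μ : ℝ} (hΛ : 0 < Λ) (hε : 0 < ε) (hl₁ : 1 ≤ l₁) (hβ : 0 ≤ β) (hk : 0 ≤ k)
    (hor : x 2 = 0 ∨ β = 0) (hC0 : 0 < C)
    (hC : 32 * Λ * l₁ * (1 + l₁) ^ 4 < C * Real.exp (-(4 * β + 8)))
    (hA : 4 * (C * (1 + β)) ≤ A) (hμ : 1 / 2 ≤ μ) (hkμ : k ^ 2 + 2 * k * μ + 80 * Λ ≤ 2 * μ ^ 2)
    (hv2 : ∀ z, 0 ≤ z 2 → ‖z - x‖ ≤ l₁ → z ∈ hB ρ ∧ v z ≤ 2)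
    (hvA : ∀ z, 0 ≤ z 2 → ‖z - x‖ ≤ 8 * l₁ / (A * ε) → z ∈ hB ρ ∧ A * ε ≤ v z)
    (htouch : ∀ l z t, 0 < l → l ≤ l₁ → z 2 = 0 → l < ‖z - x‖ → 0 ≤ t →
      (t = 0 ∨ ‖z - x‖ < l + 1 / (2 * μ)) → A * ε * ‖z - x‖ ≤ 4 * l → z ∈ hB ρ →
      v z = kelv x l v z + ε * C * bar (4 * β + 8) β x l z - t * shf k μ x l z →
      (∀ᶠ y in 𝓝[up] z, 0 ≤ v y - (kelv x l v y + ε * C * bar (4 * β + 8) β x l y)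
        + t * shf k μ x l y) → False) :
    ∀ l, 0 < l → l ≤ l₁ → ∀ z ∈ ann x l (8 * l₁ / (A * ε)), kelv x l v z ≤ v z := by
  have hμ0 : 0 < μ := by linarith
  have hA0 : 0 < A := lt_of_lt_of_le (by positivity) hA
  have hAε : 0 < A * ε := by positivity
  set S := 4 * β + 8 with hS
  have hS0 : 0 ≤ S := by positivity
  have hxx := hvA x hx (by simp; positivity)
  have hAε2 : A * ε ≤ 2 := hxx.2.trans (hv2 x hx (by simp; linarith)).2
  set δ := 1 / (2 * μ) with hδ
  have hδ0 : 0 < δ := by positivity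
  have hδ1 : δ ≤ 1 := by rw [hδ, div_le_one (by positivity)]; linarith
  set P := 8 * l₁ / (A * ε) with hP
  have hP4 : 4 * l₁ ≤ P := by
    rw [hP, le_div_iff₀ hAε]; nlinarith
  have hs : ∀ z : E3, 0 ≤ z 2 → β = 0 ∨ 0 ≤ (z - x) 2 := by
    intro z hz
    rcases hor with h | h
    · right; simp [h, hz]
    · left; exact h
  have hne : ∀ {l : ℝ} {z : E3}, 0 < l → l ≤ ‖z - x‖ → z ≠ x := by
    rintro l z h1 h2 rfl
    simp at h2; linarith
  -- facts about the reflected point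
  have hI : ∀ l z, 0 < l → l ≤ l₁ → 0 ≤ z 2 → l ≤ ‖z - x‖ →
      inv x l z ∈ hB ρ ∧ v (inv x l z) ≤ 2 := by
    intro l z h1 h2 h3 h4
    refine hv2 _ (inv_height h1.le h4 (hne h1 h4) hx h3).1 ?_
    rw [norm_inv_sub l (hne h1 h4), div_le_iff₀ (by linarith)]
    nlinarith
  have hkle : ∀ l z, 0 < l → l ≤ l₁ → 0 ≤ z 2 → l ≤ ‖z - x‖ →
      0 < kelv x l v z ∧ kelv x l v z ≤ 2 * (l / ‖z - x‖) := by
    intro l z h1 h2 h3 h4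
    have h5 : 0 < ‖z - x‖ := by linarith
    have h6 := hI l z h1 h2 h3 h4
    have h7 := hv.pos _ h6.1
    unfold kelv
    have : 0 < l / ‖z - x‖ := by positivity
    exact ⟨by positivity, by nlinarith [h6.2]⟩
  have hHle : ∀ l z, 0 < l → l ≤ ‖z - x‖ → ε * C * bar S β x l z ≤ A * ε / 4 := by
    intro l z h1 h2
    have := bar_le (S := S) h1.le h2 hβ hS0
    have : ε * C * bar S β x l z ≤ ε * C * (1 + β) := by gcongr
    nlinarith
  have main := moving_spheres (v := v) (F := fun l z => kelv x l v z + ε * C * bar S β x l z)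
    (χ := fun l z => shf k μ x l z) (x := x) (l₀ := δ * A * ε / 8) (l₁ := l₁) (δ := δ) (ρ := P)
    hx hδ0 (by positivity) (by linarith) ?_ ?_ ?_ ?_ ?_ ?_ ?_
  · intro l h1 h2 z hz
    have h3 := main l h1 h2 z hz
    have h4 := bar_nonneg (S := S) h1.le hz.2.1 hβ (hs z hz.1) hS0
    have : 0 ≤ ε * C * bar S β x l z := by positivity
    beta_reduce at h3
    linarith
  · have hsub : ∀ p ∈ {p : ℝ × E3 | (0 < p.1 ∧ p.1 ≤ l₁) ∧ p.2 ∈ ann x p.1 P},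
      ‖p.2 - x‖ ≠ 0 := by
      rintro p ⟨⟨h1, h2⟩, h3⟩
      have := h3.2.1
      exact (by linarith : 0 < ‖p.2 - x‖).ne'
    have c0 : ContinuousOn (fun p : ℝ × E3 => inv x p.1 p.2)
        {p : ℝ × E3 | (0 < p.1 ∧ p.1 ≤ l₁) ∧ p.2 ∈ ann x p.1 P} := by
      unfold inv
      refine continuousOn_const.add (ContinuousOn.smul (ContinuousOn.div (by fun_prop) (by fun_prop)
        fun p hp => pow_ne_zero 2 (hsub p hp)) (by fun_prop))
    have c1 : ContinuousOn (fun p : ℝ × E3 => kelv x p.1 v p.2)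
        {p : ℝ × E3 | (0 < p.1 ∧ p.1 ≤ l₁) ∧ p.2 ∈ ann x p.1 P} := by
      unfold kelv
      exact (ContinuousOn.div (by fun_prop) (by fun_prop) hsub).mul
        (hv.cont.comp c0 fun p hp => (hI p.1 p.2 hp.1.1 hp.1.2 hp.2.1 hp.2.2.1).1)
    have c2 := (continuousOn_bar S β x).mono
      (show {p : ℝ × E3 | (0 < p.1 ∧ p.1 ≤ l₁) ∧ p.2 ∈ ann x p.1 P} ⊆ {p | 0 ≤ p.1} from
        fun p hp => hp.1.1.le)
    have c3 : ContinuousOn (fun p : ℝ × E3 => v p.2)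
        {p : ℝ × E3 | (0 < p.1 ∧ p.1 ≤ l₁) ∧ p.2 ∈ ann x p.1 P} :=
      hv.cont.comp (by fun_prop) fun p hp => (hvA p.2 hp.2.1 hp.2.2.2).1
    exact c3.sub (c1.add (continuousOn_const.mul c2))
  · intro l _ _
    refine Continuous.continuousOn ?_
    unfold shf
    fun_prop
  · intro l _ _ z hz
    exact shf_pos hμ0 hz.2.1 hz.2.2
  · intro l h1 _ z _ hz
    rw [kelv_inner h1 hz, bar_inner hz]; ring
  · intro l h1 h2 z hz hr
    have h4 : l ≤ ‖z - x‖ := by linarith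
    have h5 := hkle l z h1 h2 hz h4
    have h6 := hHle l z h1 h4
    have h7 := (hvA z hz hr.le).2
    have h8 : l / ‖z - x‖ ≤ A * ε / 8 := by
      rw [hr, hP, div_le_iff₀ (by positivity)]
      calc l ≤ l₁ := h2
        _ = _ := by field_simp
    linarith
  · intro l h1 h2 h3 z hz
    have h4 : l ≤ ‖z - x‖ := by linarith [hz.2.1]
    have h5 := hkle l z h1 h2 hz.1 h4
    have h6 := hHle l z h1 h4
    have h7 := (hvA z hz.1 hz.2.2).2
    have h8 : l / ‖z - x‖ ≤ A * ε / 8 := by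
      rw [div_le_iff₀ (by linarith)]
      have : δ ≤ ‖z - x‖ := by linarith [hz.2.1]
      nlinarith
    linarith
  · intro l z t h1 h2 hz h3 h4 ht hto heq hmin
    have hzx := hne h1 h3.le
    have hr0 : 0 < ‖z - x‖ := by linarith
    have hzB := (hvA z hz h4.le).1
    have hzA := (hvA z hz h4.le).2
    have hvz : v z = kelv x l v z + ε * C * bar S β x l z - t * shf k μ x l z := by linarith
    have hχ0 : 0 ≤ t * shf k μ x l z := by
      rcases hto with h | h
      · simp [h]
      · exact mul_nonneg ht (shf_pos hμ0 h3.le h.le).le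
    have hk1 := hkle l z h1 h2 hz h3.le
    have hH1 := hHle l z h1 h3.le
    have hεr : A * ε * ‖z - x‖ ≤ 4 * l := by
      have : A * ε / 2 ≤ 2 * (l / ‖z - x‖) := by linarith
      rw [← mul_div_assoc, le_div_iff₀ hr0] at this
      linarith
    rcases hz.eq_or_lt with hz0 | hz0
    · exact htouch l z t h1 h2 hz0.symm h3 ht hto hεr hzB hvz hmin
    · have hinv := hI l z h1 h2 hz h3.le
      have hinv2 := (inv_height h1.le h3.le hzx hx hz).2 h1 hz0
      have L1 := hasLap_lap (hv.c2 z hzB hz0)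
      have L2 := hasLap_kelv hzx (hv.c2 _ hinv.1 hinv2)
      obtain ⟨L, L3, hL⟩ := hasLap_bar (S := S) h1.le h3.le hzx hβ (hs z hz) hS
      obtain ⟨X, L4, hX⟩ : ∃ X, HasLap (fun y => t * shf k μ x l y) z X ∧
          X ≤ -(80 * Λ) * (t * shf k μ x l z) := by
        rcases hto with h | h
        · refine ⟨0, ?_, by simp [h]⟩
          have := hasLap_const 0 z
          simpa [h] using this
        · obtain ⟨X, h5, h6⟩ := hasLap_shf hμ0 h3.le h.le hzx hk (by positivity) hkμ
          refine ⟨t * X, h5.const_mul t, ?_⟩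
          nlinarith [mul_le_mul_of_nonneg_left h6 ht]
      have key := ((L1.sub (L2.add (L3.const_mul (ε * C)))).add L4).nonneg_of_min (by
        rw [nhdsWithin_up_of_pos hz0] at hmin
        filter_upwards [hmin] with y hy
        linarith)
      rw [hv.eqn z hzB hz0, hv.eqn _ hinv.1 hinv2] at key
      set w := kelv x l v z with hw
      have hw5 : (l / ‖z - x‖) ^ 5 * -(K (inv x l z) * v (inv x l z) ^ 5)
          = -(K (inv x l z) * w ^ 5) := by
        rw [hw, kelv, mul_pow]; ring
      rw [hw5] at key
      have hKl := hv.Klip _ hinv.1 _ hzB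
      have hd : ‖inv x l z - z‖ ≤ ‖z - x‖ := by
        rw [norm_sub_inv h1.le h3.le hzx]
        have : 0 ≤ l ^ 2 / ‖z - x‖ := by positivity
        linarith
      have hKl' : K (inv x l z) - K z ≤ Λ * ε * ‖z - x‖ :=
        (le_abs_self _).trans (hKl.trans (by gcongr))
      have hb0 := bar_nonneg (S := S) h1.le h3.le hβ (hs z hz) hS0
      have hb0' : 0 ≤ ε * C * bar S β x l z := by positivity
      have hKz0 : 0 < K z := lt_of_lt_of_le (by positivity) (hv.Klow z hzB)
      exact interior_contact hΛ hε hC0 hr0 h1 h2 h3 hC hk1.1 hk1.2 (hv.pos z hzB) hKz0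
        (hv.Kup z hzB) hKl' hb0' hχ0 (by linarith) hL hX key

lemma hasDerivWithinAt_vert {v : E3 → ℝ} {G : E3 →L[ℝ] ℝ} {z : E3} (hz : 0 ≤ z 2)
    (hv : HasFDerivWithinAt v G up z) :
    HasDerivWithinAt (fun t : ℝ => v (z + t • e3)) (G e3) (Ici 0) 0 := by
  have hm : MapsTo (fun t : ℝ => z + t • eb 2) (Ici 0) up := by
    intro t (ht : 0 ≤ t)
    show 0 ≤ (z + t • eb 2) 2
    simp only [PiLp.add_apply, PiLp.smul_apply, eb_apply, if_true, smul_eq_mul, mul_one]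
    linarith
  exact HasFDerivWithinAt.comp_hasDerivWithinAt (f := fun t : ℝ => z + t • eb 2)
    (0:ℝ) (by simpa using hv) (hasDerivAt_line z (eb 2) 0).hasDerivWithinAt hm

lemma boundary_contact {Λ ε C l l₁ r E S B cz cy vz w g T : ℝ} (hΛ : 0 < Λ) (hε : 0 < ε)
    (hC0 : 0 < C) (hr0 : 0 < r) (h1 : 0 < l) (h2 : l ≤ l₁) (h3 : l < r)
    (hB : B = 27 * Λ * (1 + l₁) ^ 2)
    (hC : 16 * Λ * (1 + l₁) ^ 3 < C * B * (E * S) / (2 * (1 + l₁)))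
    (hS : 0 ≤ E * S)
    (hw0 : 0 < w) (hw : w ≤ 2 * (l / r)) (hvp : 0 < vz) (hcz : |cz| ≤ Λ)
    (hcl : |cy - cz| ≤ Λ * ε * (r - l ^ 2 / r)) (hH : ε * C * g ≤ l / r)
    (hg : E * S * (r - l) / (2 * (1 + r) * (1 + l)) ≤ g)
    (hT : 0 ≤ T) (hvw : vz = w + ε * C * g - T)
    (key : 0 ≤ cz * vz ^ 3 - (cy * w ^ 3 + ε * C * (2 * B * (g / (1 + r) ^ 2))) - 12 * Λ * T) :
    False := by
  have hl₁ : 0 < l₁ := by linarith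
  have hq0 : 0 < l / r := by positivity
  have hrl : 0 < r - l := by linarith
  have hlr4 : l / r ≤ (1 + l₁) / (1 + r) := by
    rw [div_le_div_iff₀ hr0 (by positivity)]; nlinarith
  have hg0 : 0 ≤ g := le_trans (by positivity) hg
  have hg1 : E * S * (r - l) / (2 * (1 + r) * (1 + l₁)) ≤ g := by
    refine le_trans ?_ hg
    gcongr
  obtain ⟨H, hHd⟩ : ∃ H, H = ε * C * g := ⟨_, rfl⟩
  rw [← hHd] at hH hvw
  have hH0 : 0 ≤ H := by rw [hHd]; positivity
  have hB0 : 0 < B := by rw [hB]; positivity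
  have a1 : cz * (vz ^ 3 - w ^ 3) ≤ B * H / (1 + r) ^ 2 + 12 * Λ * T := by
    have e : vz ^ 3 - w ^ 3 = (vz - w) * (vz ^ 2 + vz * w + w ^ 2) := by ring
    have hp : 0 < vz ^ 2 + vz * w + w ^ 2 := by positivity
    rcases le_total w vz with h | h
    · have h4 : vz ≤ 3 * (l / r) := by linarith
      have h5 : w ≤ 3 * (l / r) := by linarith
      have h6 : vz ^ 2 + vz * w + w ^ 2 ≤ 27 * ((1 + l₁) / (1 + r)) ^ 2 := by
        calc vz ^ 2 + vz * w + w ^ 2 ≤ (3 * (l / r)) ^ 2 + (3 * (l / r)) * (3 * (l / r))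
              + (3 * (l / r)) ^ 2 := by gcongr
          _ = 27 * (l / r) ^ 2 := by ring
          _ ≤ _ := by gcongr
      have h7 : vz - w ≤ H := by linarith
      calc cz * (vz ^ 3 - w ^ 3) ≤ Λ * (H * (27 * ((1 + l₁) / (1 + r)) ^ 2)) := by
            rw [e]
            have : 0 ≤ vz - w := by linarith
            have : cz ≤ Λ := (le_abs_self _).trans hcz
            gcongr
        _ = B * H / (1 + r) ^ 2 := by rw [hB, div_pow]; ring
        _ ≤ _ := by
            have : 0 ≤ 12 * Λ * T := by positivity
            linarith
    · have hlr : l / r ≤ 1 := (div_le_one hr0).2 h3.le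
      have hw2 : w ≤ 2 := by linarith
      have h6 : vz ^ 2 + vz * w + w ^ 2 ≤ 12 := by
        have hv2 : vz ≤ 2 := by linarith
        calc vz ^ 2 + vz * w + w ^ 2 ≤ 2 ^ 2 + 2 * 2 + 2 ^ 2 := by gcongr
          _ = 12 := by norm_num
      have h7 : w - vz ≤ T := by linarith
      have h8 : cz * (vz ^ 3 - w ^ 3) ≤ Λ * (T * 12) := by
        calc cz * (vz ^ 3 - w ^ 3) = (-cz) * ((w - vz) * (vz ^ 2 + vz * w + w ^ 2)) := by
              rw [e]; ring
          _ ≤ Λ * (T * 12) := by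
            have : 0 ≤ w - vz := by linarith
            have : -cz ≤ Λ := (neg_le_abs _).trans hcz
            gcongr
      have : 0 ≤ B * H / (1 + r) ^ 2 := by positivity
      linarith
  have a2 : (cz - cy) * w ^ 3 ≤ 16 * Λ * ε * (r - l) * ((1 + l₁) / (1 + r)) ^ 3 := by
    have h4 : cz - cy ≤ 2 * Λ * ε * (r - l) := by
      have : cz - cy ≤ |cy - cz| := by rw [abs_sub_comm]; exact le_abs_self _
      have h5 : r - l ^ 2 / r ≤ 2 * (r - l) := by
        have : r - l ^ 2 / r = (r - l) * ((r + l) / r) := by field_simp; ring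
        have h7 : (r + l) / r ≤ 2 := by rw [div_le_iff₀ hr0]; linarith
        rw [this]; nlinarith
      have : Λ * ε * (r - l ^ 2 / r) ≤ Λ * ε * (2 * (r - l)) := by gcongr
      linarith
    calc (cz - cy) * w ^ 3 ≤ 2 * Λ * ε * (r - l) * w ^ 3 := by gcongr
      _ ≤ 2 * Λ * ε * (r - l) * (2 * ((1 + l₁) / (1 + r))) ^ 3 := by
        have : w ≤ 2 * ((1 + l₁) / (1 + r)) := by linarith
        gcongr
      _ = _ := by ring
  have a3 : ε * ((r - l) / (1 + r) ^ 3) * (C * B * (E * S) / (2 * (1 + l₁))) ≤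
      B * H / (1 + r) ^ 2 := by
    calc _ = B * (ε * C * (E * S * (r - l) / (2 * (1 + r) * (1 + l₁)))) / (1 + r) ^ 2 := by
          field_simp
      _ ≤ _ := by rw [hHd]; gcongr
  have a4 : ε * ((r - l) / (1 + r) ^ 3) * (16 * Λ * (1 + l₁) ^ 3) <
      ε * ((r - l) / (1 + r) ^ 3) * (C * B * (E * S) / (2 * (1 + l₁))) := by gcongr
  have a5 : ε * ((r - l) / (1 + r) ^ 3) * (16 * Λ * (1 + l₁) ^ 3) =
      16 * Λ * ε * (r - l) * ((1 + l₁) / (1 + r)) ^ 3 := by rw [div_pow]; ring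
  have a6 : ε * C * (2 * B * (g / (1 + r) ^ 2)) = 2 * (B * H / (1 + r) ^ 2) := by
    rw [hHd]; ring
  linarith

/-- Moving spheres centered on the flat boundary. -/
theorem ms_boundary {Λ l₁ : ℝ} (hΛ : 1 ≤ Λ) (hl₁ : 1 ≤ l₁) : ∃ A₀ : ℝ, 0 < A₀ ∧
    ∀ A ≥ A₀, ∀ (ε ρ : ℝ) (v K c : E3 → ℝ), 0 < ε → Sol Λ ε ρ v K c → ∀ x : E3, x 2 = 0 →
    (∀ z, 0 ≤ z 2 → ‖z - x‖ ≤ l₁ → z ∈ hB ρ ∧ v z ≤ 2) →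
    (∀ z, 0 ≤ z 2 → ‖z - x‖ ≤ 8 * l₁ / (A * ε) → z ∈ hB ρ ∧ A * ε ≤ v z) →
    ∀ l, 0 < l → l ≤ l₁ → ∀ z ∈ ann x l (8 * l₁ / (A * ε)), kelv x l v z ≤ v z := by
  have hΛ0 : 0 < Λ := by linarith
  obtain ⟨B, hB⟩ : ∃ B, B = 27 * Λ * (1 + l₁) ^ 2 := ⟨_, rfl⟩
  have hB0 : 0 < B := by rw [hB]; positivity
  obtain ⟨S, hS⟩ : ∃ S, S = 4 * (2 * B) + 8 := ⟨_, rfl⟩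
  have hS8 : 8 ≤ S := by rw [hS]; linarith
  obtain ⟨C, hC⟩ : ∃ C, C = 33 * Λ * l₁ * (1 + l₁) ^ 4 * Real.exp S := ⟨_, rfl⟩
  have hC0 : 0 < C := by rw [hC]; positivity
  have hCE : C * Real.exp (-S) = 33 * Λ * l₁ * (1 + l₁) ^ 4 := by
    rw [hC, mul_assoc, ← Real.exp_add]; simp
  have hCE' : 32 * Λ * l₁ * (1 + l₁) ^ 4 < C * Real.exp (-S) := by
    rw [hCE]
    gcongr
    norm_num
  have hCB : 16 * Λ * (1 + l₁) ^ 3 < C * B * (Real.exp (-S) * S) / (2 * (1 + l₁)) := by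
    have e : C * B * (Real.exp (-S) * S) / (2 * (1 + l₁)) =
        (C * Real.exp (-S)) * B * S / (2 * (1 + l₁)) := by ring
    rw [e, hCE, lt_div_iff₀ (by positivity)]
    have b1 : 1 ≤ B := by rw [hB]; nlinarith
    calc 16 * Λ * (1 + l₁) ^ 3 * (2 * (1 + l₁)) = 32 * Λ * 1 * (1 + l₁) ^ 4 * 1 * 1 := by ring
      _ < 33 * Λ * l₁ * (1 + l₁) ^ 4 * B * S := by
        have : 33 * Λ * l₁ * (1 + l₁) ^ 4 * 1 * 1 ≤ 33 * Λ * l₁ * (1 + l₁) ^ 4 * B * S := by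
          gcongr
          linarith
        refine lt_of_lt_of_le ?_ this
        gcongr ?_ * _ * _ * _
        nlinarith
  refine ⟨4 * (C * (1 + 2 * B)), by positivity, ?_⟩
  intro A hA ε ρ v K c hε hv x hx hv2 hvA
  have hA0 : 0 < A := lt_of_lt_of_le (by positivity) hA
  refine ms_core hv hx.ge (β := 2 * B) (k := 12 * Λ) (μ := 24 * Λ) (C := C) hΛ0 hε hl₁
    (by positivity) (by positivity) (Or.inl hx) hC0 (by rw [← hS]; exact hCE') hA
    (by linarith) (by nlinarith) hv2 hvA ?_
  rw [← hS]
  intro l z t h1 h2 hz0 h3 ht hto hεr hzB hvz hmin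
  have hr0 : 0 < ‖z - x‖ := by linarith
  have hzx : z ≠ x := by rintro rfl; simp at hr0
  have hzx2 : (z - x) 2 = 0 := by simp [hx, hz0]
  have hI2 : inv x l z 2 = 0 := by rw [inv_coord, hx, hz0]; simp
  have hI := hv2 (inv x l z) hI2.ge (by
    rw [norm_inv_sub l hzx, div_le_iff₀ hr0, sq]
    exact mul_le_mul h2 h3.le h1.le (by linarith))
  obtain ⟨G, hG, hGc⟩ := hv.bdry z hzB hz0
  obtain ⟨G', hG', hGc'⟩ := hv.bdry _ hI.1 hI2
  have d1 := hasDerivWithinAt_vert hz0.ge hG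
  have d2 := hasDerivWithinAt_kelv_vert (l := l) hzx hx hz0 hG'
  have d3 := (hasDerivAt_bar_vert (S := S) (β := 2 * B) (l := l) hzx (Or.inr hzx2)).hasDerivWithinAt
    (s := Ici 0)
  have d4 := (hasDerivAt_shf_vert (k := 12 * Λ) (μ := 24 * Λ) (l := l) hzx hzx2).hasDerivWithinAt
    (s := Ici 0)
  have key := vert_deriv_nonneg (f := fun y => v y - (kelv x l v y + ε * C * bar S (2 * B) x l y)
        + t * shf (12 * Λ) (24 * Λ) x l y) hz0.ge
    ((d1.sub (d2.add (d3.const_mul (ε * C)))).add (d4.const_mul t)) (by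
      filter_upwards [hmin] with y hy
      linarith)
  have hT : 0 ≤ t * shf (12 * Λ) (24 * Λ) x l z := by
    rcases hto with h | h
    · simp [h]
    · exact mul_nonneg ht (shf_pos (by positivity) h3.le h.le).le
  have hbar : bar S (2 * B) x l z = prof S ‖z - x‖ - prof S l := by
    simp [bar, hzx2]
  have hb := bar_le (S := S) (β := 2 * B) h1.le h3.le (by positivity) (by linarith)
  rw [hbar] at hvz hb
  have hH : ε * C * (prof S ‖z - x‖ - prof S l) ≤ l / ‖z - x‖ := by
    rw [le_div_iff₀ hr0]
    have : ε * C * (prof S ‖z - x‖ - prof S l) ≤ ε * C * (1 + 2 * B) := by gcongr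
    have h8 : 4 * (ε * C * (1 + 2 * B)) ≤ A * ε := by
      calc _ = 4 * (C * (1 + 2 * B)) * ε := by ring
        _ ≤ A * ε := by gcongr
    have h9 : ε * C * (prof S ‖z - x‖ - prof S l) * ‖z - x‖ ≤ A * ε / 4 * ‖z - x‖ := by
      gcongr; linarith
    linarith
  have hvI := hv.pos _ hI.1
  have hl0 : 0 < l / ‖z - x‖ := by positivity
  refine boundary_contact (E := Real.exp (-S)) hΛ0 hε hC0 hr0 h1 h2 h3 hB hCB (by positivity)
    (w := kelv x l v z) (cy := c (inv x l z)) (cz := c z) (vz := v z)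
    (g := prof S ‖z - x‖ - prof S l) ?_ ?_ (hv.pos z hzB) (hv.cbd z hzB hz0) ?_ hH
    (prof_sub_ge (by linarith) h1.le h3.le) hT hvz ?_
  · unfold kelv; positivity
  · unfold kelv; rw [mul_comm]; gcongr; exact hI.2
  · have := hv.clip _ hI.1 _ hzB hI2 hz0
    rwa [norm_sub_inv h1.le h3.le hzx] at this
  · rw [hGc, hGc', hzx2] at key
    have e : (l / ‖z - x‖) ^ 3 * (c (inv x l z) * v (inv x l z) ^ 3) =
        c (inv x l z) * kelv x l v z ^ 3 := by unfold kelv; ring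
    rw [e] at key
    simp only [zero_div, mul_zero, zero_add] at key
    linarith

lemma interior_center_contact {Λ ε C A κ Cg T l l₁ r s cz vz kd b : ℝ} (hΛ : 0 < Λ)
    (hε : 0 < ε)
    (hC0 : 0 < C) (hr0 : 0 < r) (h1 : 0 < l) (h2 : l ≤ l₁) (hCg : 0 ≤ Cg)
    (hA0 : 0 < A) (hA : 32 * C ≤ κ * A) (hT : 0 < T)
    (hTκ : (27 * Λ + 3 * Cg) * l₁ ^ 2 < T * κ / 2) (hs : r ≤ s)
    (hεr : A * ε * r ≤ 4 * l) (hv0 : 0 < vz) (hv : vz ≤ 3 * (l / r)) (hcz : cz ≤ Λ)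
    (hkd : l * T * κ / r ^ 3 - 3 * l ^ 3 * Cg / r ^ 3 ≤ kd) (hb0 : 0 ≤ b) (hb : b ≤ 1)
    (key : 0 ≤ cz * vz ^ 3 - (kd + ε * C * (b * (8 / (2 * s)) * (-T / r)))) : False := by
  have hs0 : 0 < s := by linarith
  have a1 : cz * vz ^ 3 ≤ 27 * Λ * l ^ 3 / r ^ 3 := by
    calc cz * vz ^ 3 ≤ Λ * (3 * (l / r)) ^ 3 := by gcongr
      _ = _ := by rw [mul_pow, div_pow]; ring
  have a2 : -(ε * C * (b * (8 / (2 * s)) * (-T / r))) ≤ l * T * κ / 2 / r ^ 3 := by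
    have hε' : ε ≤ 4 * l / (A * r) := by
      rw [le_div_iff₀ (by positivity)]; linarith
    have hC' : C / A ≤ κ / 32 := by
      rw [div_le_div_iff₀ hA0 (by norm_num)]; linarith
    calc -(ε * C * (b * (8 / (2 * s)) * (-T / r))) = ε * C * (b * (4 / s) * (T / r)) := by
          field_simp; ring
      _ ≤ (4 * l / (A * r)) * C * (1 * (4 / r) * (T / r)) := by gcongr
      _ = 16 * l * T * (C / A) / r ^ 3 := by field_simp; ring
      _ ≤ 16 * l * T * (κ / 32) / r ^ 3 := by gcongr
      _ = _ := by ring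
  have a3 : 0 ≤ (27 * Λ * l ^ 3 - (l * T * κ - 3 * l ^ 3 * Cg) + l * T * κ / 2) / r ^ 3 := by
    have e : (27 * Λ * l ^ 3 - (l * T * κ - 3 * l ^ 3 * Cg) + l * T * κ / 2) / r ^ 3 =
      27 * Λ * l ^ 3 / r ^ 3 - (l * T * κ / r ^ 3 - 3 * l ^ 3 * Cg / r ^ 3) +
        l * T * κ / 2 / r ^ 3 := by ring
    rw [e]; linarith
  have a4 : 0 ≤ l * ((27 * Λ + 3 * Cg) * l ^ 2 - T * κ / 2) := by
    by_contra h
    push Not at h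
    have : (27 * Λ * l ^ 3 - (l * T * κ - 3 * l ^ 3 * Cg) + l * T * κ / 2) / r ^ 3 < 0 :=
      div_neg_of_neg_of_pos (by linarith) (by positivity)
    linarith
  have a5 := nonneg_of_mul_nonneg_right a4 h1
  have : (27 * Λ + 3 * Cg) * l ^ 2 ≤ (27 * Λ + 3 * Cg) * l₁ ^ 2 := by gcongr
  linarith

/-- Moving spheres centered far from the flat boundary. -/
theorem ms_interior {Λ l₁ κ : ℝ} (hΛ : 1 ≤ Λ) (hl₁ : 1 ≤ l₁) (hκ : 0 < κ) : ∃ A₀ : ℝ, 0 < A₀ ∧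
    ∀ A ≥ A₀, ∀ (Cg ε ρ : ℝ) (v K c : E3 → ℝ), 0 ≤ Cg → 0 < ε → Sol Λ ε ρ v K c →
    ∀ x : E3, l₁ + 1 < x 2 → (27 * Λ + 3 * Cg) * l₁ ^ 2 < x 2 * κ / 2 →
    (∀ z, ‖z - x‖ ≤ l₁ → z ∈ hB ρ ∧ κ ≤ v z ∧ v z ≤ 2 ∧ ‖fderiv ℝ v z‖ ≤ Cg) →
    (∀ z, 0 ≤ z 2 → ‖z - x‖ ≤ 8 * l₁ / (A * ε) → z ∈ hB ρ ∧ A * ε ≤ v z) →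
    ∀ l, 0 < l → l ≤ l₁ → ∀ z ∈ ann x l (8 * l₁ / (A * ε)), kelv x l v z ≤ v z := by
  have hΛ0 : 0 < Λ := by linarith
  obtain ⟨C, hC⟩ : ∃ C, C = 33 * Λ * l₁ * (1 + l₁) ^ 4 * Real.exp 8 := ⟨_, rfl⟩
  have hC0 : 0 < C := by rw [hC]; positivity
  have hCE : C * Real.exp (-8) = 33 * Λ * l₁ * (1 + l₁) ^ 4 := by
    rw [hC, mul_assoc, ← Real.exp_add]; simp
  refine ⟨4 * C + 32 * C / κ, by positivity, ?_⟩
  intro A hA Cg ε ρ v K c hCg hε hv x hx hTκ hv2 hvA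
  have hA0 : 0 < A := lt_of_lt_of_le (by positivity) hA
  have hA1 : 4 * C ≤ A := by
    have : 0 < 32 * C / κ := by positivity
    linarith
  have hA2 : 32 * C ≤ κ * A := by
    have : 32 * C / κ ≤ A := by linarith
    rw [div_le_iff₀ hκ] at this
    linarith
  refine ms_core hv (by linarith) (β := 0) (k := 0) (μ := 7 * Λ) (C := C) hΛ0 hε hl₁
    le_rfl le_rfl (Or.inr rfl) hC0 ?_ (by linarith)
    (by linarith) (by nlinarith) (fun z _ hz => ⟨(hv2 z hz).1, (hv2 z hz).2.2.1⟩) hvA ?_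
  · norm_num
    rw [hCE]
    gcongr
    norm_num
  rw [show (4 * 0 + 8 : ℝ) = 8 by norm_num]
  intro l z t h1 h2 hz0 h3 ht hto hεr hzB hvz hmin
  have hr0 : 0 < ‖z - x‖ := by linarith
  have hzx : z ≠ x := by rintro rfl; simp at hr0
  have hzx2 : (z - x) 2 = -x 2 := by simp [hz0]
  have hTr : x 2 ≤ ‖z - x‖ := by
    have := abs_coord_le (z - x) 2
    rw [hzx2, abs_neg] at this
    exact (le_abs_self _).trans this
  have ht0 : t = 0 := by
    rcases hto with h | h
    · exact h
    · have : 1 / (2 * (7 * Λ)) ≤ 1 := by rw [div_le_one (by positivity)]; linarith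
      linarith
  subst ht0
  have hI := hv2 (inv x l z) (by
    rw [norm_inv_sub l hzx, div_le_iff₀ hr0, sq]
    exact mul_le_mul h2 h3.le h1.le (by linarith))
  have hIx : ‖inv x l z - x‖ ≤ l₁ := by
    rw [norm_inv_sub l hzx, div_le_iff₀ hr0, sq]
    exact mul_le_mul h2 h3.le h1.le (by linarith)
  have hI2 : 0 < inv x l z 2 := by
    have h5 := abs_coord_le (inv x l z - x) 2
    have h6 := neg_abs_le ((inv x l z - x) 2)
    have h7 : (inv x l z - x) 2 = inv x l z 2 - x 2 := rfl
    linarith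
  obtain ⟨G, hG, hGc⟩ := hv.bdry z hzB hz0
  have hG' : HasFDerivAt v (fderiv ℝ v (inv x l z)) (inv x l z) :=
    ((hv.c2 _ hI.1 hI2).differentiableAt (by norm_num)).hasFDerivAt
  have d1 := hasDerivWithinAt_vert hz0.ge hG
  have d2 := hasDerivAt_kelv_line (x := x) (z := z) (l := l) (i := 2) (t := 0) (u := v)
    (by simpa using hzx) (by simpa using hG')
  have d3 := (hasDerivAt_bar_vert (S := 8) (β := 0) (l := l) hzx (Or.inl rfl)).hasDerivWithinAt
    (s := Ici 0)
  have key := vert_deriv_nonneg (f := fun y => v y - (kelv x l v y + ε * C * bar 8 0 x l y))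
    hz0.ge (d1.sub (d2.hasDerivWithinAt.add (d3.const_mul (ε * C)))) (by
      filter_upwards [hmin] with y hy
      linarith)
  have hb := bar_le (S := 8) (β := 0) h1.le h3.le le_rfl (by norm_num)
  have hvI := hv.pos _ hI.1
  have hl0 : 0 < l / ‖z - x‖ := by positivity
  simp only [zero_smul, add_zero, hzx2, hGc, zero_mul] at key
  refine interior_center_contact (T := x 2) (s := √(1 + ‖z - x‖) ^ 3) hΛ0 hε hC0 hr0 h1 h2
    hCg hA0 hA2 (by linarith) hTκ ?_ hεr (hv.pos z hzB) ?_
    ((le_abs_self _).trans (hv.cbd z hzB hz0)) ?_ (prof_pos 8 ‖z - x‖).le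
    (prof_le_one (by norm_num)) key
  · have h5 : 1 ≤ √(1 + ‖z - x‖) := by rw [Real.one_le_sqrt]; linarith
    have h6 := Real.sq_sqrt (show 0 ≤ 1 + ‖z - x‖ by linarith)
    nlinarith
  · have h5 : ε * C * bar 8 0 x l z ≤ ε * C * 1 := by gcongr; linarith
    have h6 : ε * C ≤ l / ‖z - x‖ := by
      rw [le_div_iff₀ hr0]
      have : 4 * C * (ε * ‖z - x‖) ≤ A * (ε * ‖z - x‖) := by gcongr
      linarith
    have h7 : kelv x l v z ≤ 2 * (l / ‖z - x‖) := by
      unfold kelv; rw [mul_comm]; gcongr; exact hI.2.2.1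
    linarith
  · have hGn : ‖fderiv ℝ v (inv x l z) ((-2 * l ^ 2 * -x 2 / ‖z - x‖ ^ 4) • (z - x) +
        (l ^ 2 / ‖z - x‖ ^ 2) • eb 2)‖ ≤ Cg * (3 * l ^ 2 / ‖z - x‖ ^ 2) := by
      refine (ContinuousLinearMap.le_opNorm _ _).trans ?_
      gcongr
      · exact hI.2.2.2
      · refine (norm_add_le _ _).trans ?_
        rw [norm_smul, norm_smul, norm_eb, Real.norm_of_nonneg (by
          have : 0 < x 2 := by linarith
          have : -2 * l ^ 2 * -x 2 = 2 * l ^ 2 * x 2 := by ring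
          rw [this]; positivity), Real.norm_of_nonneg (by positivity)]
        calc -2 * l ^ 2 * -x 2 / ‖z - x‖ ^ 4 * ‖z - x‖ + l ^ 2 / ‖z - x‖ ^ 2 * 1
            = 2 * l ^ 2 * x 2 / ‖z - x‖ ^ 3 + l ^ 2 / ‖z - x‖ ^ 2 := by field_simp
          _ ≤ 2 * l ^ 2 * ‖z - x‖ / ‖z - x‖ ^ 3 + l ^ 2 / ‖z - x‖ ^ 2 := by gcongr
          _ = _ := by field_simp; ring
    have h8 := (neg_le_abs _).trans hGn
    have h9 : l * x 2 * κ / ‖z - x‖ ^ 3 ≤ l * x 2 * v (inv x l z) / ‖z - x‖ ^ 3 := by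
      have : 0 < x 2 := by linarith
      gcongr
      exact hI.2.1
    have h10 : -(l / ‖z - x‖ * fderiv ℝ v (inv x l z) ((-2 * l ^ 2 * -x 2 / ‖z - x‖ ^ 4) • (z - x) +
        (l ^ 2 / ‖z - x‖ ^ 2) • eb 2)) ≤ l / ‖z - x‖ * (Cg * (3 * l ^ 2 / ‖z - x‖ ^ 2)) := by
      rw [← mul_neg]
      gcongr
    have h11 : l / ‖z - x‖ * (Cg * (3 * l ^ 2 / ‖z - x‖ ^ 2)) = 3 * l ^ 3 * Cg / ‖z - x‖ ^ 3 := by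
      field_simp
    have h12 : -(l * -x 2 / ‖z - x‖ ^ 3) * v (inv x l z) =
      l * x 2 * v (inv x l z) / ‖z - x‖ ^ 3 := by ring
    rw [h12]
    linarith

lemma nonneg_of_no_min {D : Set E3} (hD : IsCompact D) {f : E3 → ℝ} (hf : ContinuousOn f D)
    (h : ∀ z ∈ D, f z < 0 → (∀ y ∈ D, f z ≤ f y) → False) : ∀ z ∈ D, 0 ≤ f z := by
  intro z hz
  obtain ⟨w, hw, hmin⟩ := hD.exists_isMinOn ⟨z, hz⟩ hf
  by_contra hneg
  push Not at hneg
  exact h w hw (lt_of_le_of_lt (hmin hz) hneg) fun y hy => hmin hy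

lemma hasLap_normSq (x z : E3) : HasLap (fun y => ‖y - x‖ ^ 2) z 6 := by
  refine ⟨fun i t => 2 * (z + t • eb i - x) i, fun _ => 2, fun i => ?_, fun i => ?_, ?_⟩
  · exact Eventually.of_forall fun t => hasDerivAt_normSq_line x z i t
  · simpa using (hasDerivAt_coord_line x z i i 0).const_mul 2
  · simp; norm_num

lemma hasLap_coord (x z : E3) (i : Fin 3) : HasLap (fun y => (y - x) i) z 0 := by
  refine ⟨fun j t => if i = j then 1 else 0, fun _ => 0, fun j => ?_, fun j => ?_, by simp⟩
  · exact Eventually.of_forall fun t => hasDerivAt_coord_line x z j i t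
  · exact hasDerivAt_const _ _

lemma hasLap_coord_sq (x z : E3) (i : Fin 3) : HasLap (fun y => (y - x) i ^ 2) z 2 := by
  refine ⟨fun j t => 2 * (z + t • eb j - x) i * (if i = j then 1 else 0),
    fun j => if i = j then 2 else 0, fun j => ?_, fun j => ?_, by simp⟩
  · refine Eventually.of_forall fun t => ?_
    refine ((hasDerivAt_coord_line x z j i t).pow 2).congr_deriv ?_
    push_cast
    ring
  · have := ((hasDerivAt_coord_line x z j i 0).const_mul 2).mul_const (if i = j then (1:ℝ) else 0)
    refine this.congr_deriv ?_
    split_ifs <;> simp_all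

lemma hasLap_inv_norm {x z : E3} (hz : z ≠ x) : HasLap (fun y => 1 / ‖y - x‖) z 0 := by
  have hn : 0 < ‖z - x‖ := norm_pos_iff.2 (sub_ne_zero.2 hz)
  have h := hasLap_height_radial hz (a := fun _ => 1) (a₁ := fun _ => 0) (a₂ := 0)
    (b := fun r => 1 / r) (b₁ := fun r => -1 / r ^ 2) (b₂ := 2 / ‖z - x‖ ^ 3)
    (Eventually.of_forall fun s => hasDerivAt_const _ _) (hasDerivAt_const _ _)
    (by
      filter_upwards [lt_mem_nhds hn] with s hs
      have := (hasDerivAt_const s (1:ℝ)).div (hasDerivAt_id s) hs.ne'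
      refine this.congr_deriv ?_
      simp)
    (by
      have := (hasDerivAt_const ‖z - x‖ (-1:ℝ)).div ((hasDerivAt_id ‖z - x‖).pow 2) (by simp; positivity)
      refine this.congr_deriv ?_
      simp
      field_simp)
  convert h using 1
  · ext y; simp
  · field_simp; ring

/-- Reflection in the plane through `y` orthogonal to the `i`-th axis. -/
def refl (y : E3) (i : Fin 3) (x : E3) : E3 := x - (2 * (x - y) i) • eb i

lemma refl_line (y z : E3) (i j : Fin 3) (t : ℝ) :
    refl y i (z + t • eb j) = refl y i z + ((if j = i then -1 else 1) * t) • eb j := by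
  ext k
  simp only [refl, PiLp.add_apply, PiLp.sub_apply, PiLp.smul_apply, smul_eq_mul, eb_apply]
  by_cases h : j = i
  · subst h
    by_cases h2 : k = j
    · subst h2; simp; ring
    · simp [h2]
  · by_cases h2 : k = i
    · subst h2; simp [h, Ne.symm h]
    · simp [h2, h, Ne.symm h]

lemma norm_refl_sub (y x : E3) (i : Fin 3) : ‖refl y i x - y‖ = ‖x - y‖ := by
  have : ‖refl y i x - y‖ ^ 2 = ‖x - y‖ ^ 2 := by
    rw [norm_sq_eq, norm_sq_eq]
    fin_cases i <;> simp [refl] <;> ring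
  exact (sq_eq_sq₀ (norm_nonneg _) (norm_nonneg _)).1 this

lemma refl_of_eq {y x : E3} {i : Fin 3} (h : (x - y) i = 0) : refl y i x = x := by
  simp only [refl, h, mul_zero, zero_smul, sub_zero]

lemma HasLap.comp_refl {f : E3 → ℝ} {y z : E3} {i : Fin 3} {a : ℝ} (h : HasLap f (refl y i z) a) :
    HasLap (fun x => f (refl y i x)) z a := by
  obtain ⟨g, d, hg, hd, rfl⟩ := h
  have hs : ∀ s : ℝ, HasDerivAt (fun t : ℝ => s * t) s 0 := fun s => by
    simpa using (hasDerivAt_id (0:ℝ)).const_mul s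
  have ht : ∀ s : ℝ, Tendsto (fun t : ℝ => s * t) (𝓝 0) (𝓝 0) := fun s => by
    simpa using (hs s).continuousAt.tendsto
  refine ⟨fun j t => g j ((if j = i then -1 else 1) * t) * (if j = i then -1 else 1), d,
    fun j => ?_, fun j => ?_, rfl⟩
  · filter_upwards [(ht (if j = i then -1 else 1)).eventually (hg j)] with t h1
    simp only [refl_line]
    have h2 : HasDerivAt (fun t : ℝ => (if j = i then -1 else 1) * t)
        (if j = i then -1 else 1 : ℝ) t := by
      simpa using (hasDerivAt_id t).const_mul (if j = i then -1 else 1 : ℝ)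
    exact HasDerivAt.comp t h1 h2
  · have h1 : HasDerivAt (g j) (d j) ((if j = i then -1 else 1) * 0) := by simpa using hd j
    have := (HasDerivAt.comp (0:ℝ) h1 (hs (if j = i then -1 else 1))).mul_const
      (if j = i then -1 else 1 : ℝ)
    refine this.congr_deriv ?_
    split_ifs <;> simp

lemma partial_le {v : E3 → ℝ} {y : E3} {F : ℝ} (i : Fin 3)
    (hc : ∀ x, ‖x - y‖ ≤ 1 → ContinuousAt v x)
    (hl : ∀ x, ‖x - y‖ < 1 → ∃ ℓ, HasLap v x ℓ ∧ |ℓ| ≤ F)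
    (ho : ∀ x x', ‖x - y‖ ≤ 1 → ‖x' - y‖ ≤ 1 → v x - v x' ≤ 2)
    {D : ℝ} (hD : HasDerivAt (fun t : ℝ => v (y + t • eb i)) D 0) : D ≤ (F + 7) / 2 := by
  have hF : 0 ≤ F := by
    obtain ⟨ℓ, _, h⟩ := hl y (by simp)
    exact (abs_nonneg _).trans h
  have hcomp : IsCompact {x : E3 | ‖x - y‖ ≤ 1 ∧ 0 ≤ (x - y) i} := by
    have : {x : E3 | ‖x - y‖ ≤ 1 ∧ 0 ≤ (x - y) i} = closedBall y 1 ∩ {x | 0 ≤ (x - y) i} := by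
      ext x; simp [mem_closedBall, dist_eq_norm]
    rw [this]
    exact (isCompact_closedBall y 1).inter_right (isClosed_le (by fun_prop) (by fun_prop))
  have hrc : Continuous (refl y i) := by unfold refl; fun_prop
  have key := nonneg_of_no_min hcomp (f := fun x => 2 * ‖x - y‖ ^ 2 + (F + 7) * (x - y) i -
      (F + 7) * (x - y) i ^ 2 - (v x - v (refl y i x))) ?_ ?_
  · -- conclude by differentiating along the axis
    have hD2 : HasDerivAt (fun t : ℝ => v (y + t • eb i)) D (-1 * 0) := by simpa using hD
    have h2 : HasDerivAt (fun t : ℝ => (-1:ℝ) * t) (-1) 0 := by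
      simpa using (hasDerivAt_id (0:ℝ)).const_mul (-1)
    have h3 := HasDerivAt.comp (0:ℝ) hD2 h2
    have h4 : HasDerivAt (fun t : ℝ => 2 * t ^ 2 + (F + 7) * t - (F + 7) * t ^ 2 -
        (v (y + t • eb i) - v (y + (-1 * t) • eb i))) ((F + 7) - (D - D * -1)) 0 := by
      have e1 := (hasDerivAt_id (0:ℝ)).pow 2
      have := (((e1.const_mul 2).add ((hasDerivAt_id (0:ℝ)).const_mul (F + 7))).sub
        (e1.const_mul (F + 7))).sub (hD.sub h3)
      refine this.congr_deriv ?_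
      simp
    have h5 := deriv_nonneg_of_min h4.hasDerivWithinAt (by
      have : ∀ᶠ t in 𝓝[≥] (0:ℝ), t ≤ 1 := mem_nhdsWithin_of_mem_nhds (Iic_mem_nhds one_pos)
      filter_upwards [this, self_mem_nhdsWithin] with t ht (ht0 : 0 ≤ t)
      have h6 := key (y + t • eb i) ⟨by simp [norm_smul, abs_of_nonneg ht0, ht], by simp [ht0]⟩
      have h7 : refl y i (y + t • eb i) = y + (-1 * t) • eb i := by
        rw [refl_line]; simp [refl]
      simp only [h7, add_sub_cancel_left, norm_smul, norm_eb, mul_one, Real.norm_eq_abs,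
        sq_abs, PiLp.smul_apply, eb_apply, if_true, smul_eq_mul] at h6
      simpa using h6)
    linarith
  · refine ContinuousOn.sub (by fun_prop) (ContinuousOn.sub ?_ ?_)
    · exact fun x hx => (hc x hx.1).continuousWithinAt
    · exact fun x hx => (ContinuousAt.comp (hc _ (by rw [norm_refl_sub]; exact hx.1))
        hrc.continuousAt).continuousWithinAt
  · intro z ⟨hz1, hz2⟩ hneg hmin
    have hzi : (z - y) i ≤ ‖z - y‖ := coord_le _ _
    rcases hz2.eq_or_lt with h0 | h0
    · rw [refl_of_eq h0.symm, ← h0] at hneg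
      nlinarith [sq_nonneg ‖z - y‖]
    rcases hz1.eq_or_lt with h1 | h1
    · have := ho z (refl y i z) hz1 (by rw [norm_refl_sub]; exact hz1)
      rw [h1] at hneg hzi
      have : (F + 7) * (z - y) i ^ 2 ≤ (F + 7) * (z - y) i := by
        gcongr; nlinarith
      linarith
    obtain ⟨ℓ, hℓ, hℓF⟩ := hl z h1
    obtain ⟨ℓ', hℓ', hℓF'⟩ := hl (refl y i z) (by rw [norm_refl_sub]; exact h1)
    have hL := ((((hasLap_normSq y z).const_mul 2).add ((hasLap_coord y z i).const_mul (F + 7))).sub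
      ((hasLap_coord_sq y z i).const_mul (F + 7))).sub (hℓ.sub hℓ'.comp_refl)
    have := hL.nonneg_of_min (by
      have hD : {x : E3 | ‖x - y‖ < 1 ∧ 0 < (x - y) i} ∈ 𝓝 z :=
        ((isOpen_lt (f := fun x : E3 => ‖x - y‖) (g := fun _ => 1) (by fun_prop)
          (by fun_prop)).inter (isOpen_lt (f := fun _ => (0:ℝ)) (g := fun x : E3 => (x - y) i)
          (by fun_prop) (by fun_prop))).mem_nhds ⟨h1, h0⟩
      filter_upwards [hD] with x hx using hmin x ⟨hx.1.le, hx.2.le⟩)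
    have := abs_le.1 hℓF
    have := abs_le.1 hℓF'
    linarith

/-- Interior gradient bound. -/
theorem fderiv_le {v : E3 → ℝ} {y : E3} {F : ℝ}
    (hc : ∀ x, ‖x - y‖ ≤ 1 → ContDiffAt ℝ 2 v x)
    (hl : ∀ x, ‖x - y‖ < 1 → |lap v x| ≤ F)
    (h0 : ∀ x, ‖x - y‖ ≤ 1 → 0 ≤ v x ∧ v x ≤ 2) : ‖fderiv ℝ v y‖ ≤ 2 * (F + 7) := by
  have hF : 0 ≤ F := (abs_nonneg _).trans (hl y (by simp))
  have hv : HasFDerivAt v (fderiv ℝ v y) y :=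
    ((hc y (by simp)).differentiableAt (by norm_num)).hasFDerivAt
  have hd : ∀ i, HasDerivAt (fun t : ℝ => v (y + t • eb i)) (fderiv ℝ v y (eb i)) 0 :=
    fun i => hv.hasLineDerivAt (eb i)
  have hp : ∀ i, |fderiv ℝ v y (eb i)| ≤ (F + 7) / 2 := by
    intro i
    rw [abs_le]
    constructor
    · have := partial_le (v := fun x => -1 * v x) (F := F) i
        (fun x hx => (hc x hx).continuousAt.const_mul (-1))
        (fun x hx => ⟨_, (hasLap_lap (hc x hx.le)).const_mul (-1), by simpa using hl x hx⟩)
        (fun x x' hx hx' => by linarith [h0 x hx, h0 x' hx']) ((hd i).const_mul (-1))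
      linarith
    · exact partial_le i (fun x hx => (hc x hx).continuousAt)
        (fun x hx => ⟨_, hasLap_lap (hc x hx.le), hl x hx⟩)
        (fun x x' hx hx' => by linarith [h0 x hx, h0 x' hx']) (hd i)
  refine ContinuousLinearMap.opNorm_le_bound _ (by positivity) fun w => ?_
  rw [clm_expand, Real.norm_eq_abs]
  have hw : ∀ i, |w i * fderiv ℝ v y (eb i)| ≤ ‖w‖ * ((F + 7) / 2) := fun i => by
    rw [abs_mul]
    exact mul_le_mul (abs_coord_le w i) (hp i) (abs_nonneg _) (norm_nonneg _)
  have h3 := abs_add_three (w 0 * fderiv ℝ v y (eb 0)) (w 1 * fderiv ℝ v y (eb 1))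
    (w 2 * fderiv ℝ v y (eb 2))
  have : 0 ≤ (F + 7) * ‖w‖ := by positivity
  linarith [hw 0, hw 1, hw 2]

/-- Comparison principle for (super)solutions. -/
lemma Sol.compare {Λ ε ρ : ℝ} {v K c ψ : E3 → ℝ} (hv : Sol Λ ε ρ v K c) {D : Set E3}
    (hD : IsCompact D) (hDB : D ⊆ hB ρ) (hψ : ContinuousOn ψ D)
    (h : ∀ z ∈ D, ψ z ≤ v z ∨ (0 < z 2 ∧ D ∈ 𝓝 z ∧
      ∃ ℓ, HasLap ψ z ℓ ∧ -(Λ⁻¹ * v z ^ 5) < ℓ)) : ∀ z ∈ D, ψ z ≤ v z := by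
  have := nonneg_of_no_min hD (f := fun z => v z - ψ z) ((hv.cont.mono hDB).sub hψ) ?_
  · intro z hz; linarith [this z hz]
  · intro z hz hneg hmin
    rcases h z hz with h1 | ⟨h1, h2, ℓ, h3, h4⟩
    · linarith
    · have h5 := ((hasLap_lap (hv.c2 z (hDB hz) h1)).sub h3).nonneg_of_min (by
        filter_upwards [h2] with y hy using hmin y hy)
      rw [hv.eqn z (hDB hz) h1] at h5
      have h6 := hv.pos z (hDB hz)
      have : Λ⁻¹ * v z ^ 5 ≤ K z * v z ^ 5 := by
        gcongr
        exact hv.Klow z (hDB hz)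
      linarith

lemma height_ge {x z : E3} {a : ℝ} (h : ‖z - x‖ ≤ a) : x 2 - a ≤ z 2 := by
  have h5 := abs_coord_le (z - x) 2
  have h6 := neg_abs_le ((z - x) 2)
  have h7 : (z - x) 2 = z 2 - x 2 := rfl
  linarith

lemma closedBall_mem {x z : E3} {a : ℝ} (h : ‖z - x‖ < a) : closedBall x a ∈ 𝓝 z :=
  mem_of_superset (isOpen_ball.mem_nhds (by simpa [mem_ball, dist_eq_norm] using h))
    ball_subset_closedBall

lemma mem_closedBall_norm {x z : E3} {a : ℝ} : z ∈ closedBall x a ↔ ‖z - x‖ ≤ a := by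
  rw [mem_closedBall, dist_eq_norm]

/-- A solution which is at least `m` on an interior ball is large at its center. -/
lemma Sol.center_ge {Λ ε ρ : ℝ} {v K c : E3 → ℝ} (hv : Sol Λ ε ρ v K c) (hΛ : 0 < Λ) {P : E3}
    {a m : ℝ} (ha : 0 ≤ a) (hm : 0 < m) (hP : a < P 2)
    (h : ∀ z, ‖z - P‖ ≤ a → z ∈ hB ρ ∧ m ≤ v z) : m ^ 5 * a ^ 2 / (12 * Λ) ≤ v P := by
  have := hv.compare (isCompact_closedBall P a)
    (fun z hz => (h z (mem_closedBall_norm.1 hz)).1)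
    (ψ := fun z => m ^ 5 * a ^ 2 / (12 * Λ) - m ^ 5 / (12 * Λ) * ‖z - P‖ ^ 2) (by fun_prop)
    (fun z hz => ?_) P (by simpa using ha)
  · simpa using this
  · rw [mem_closedBall_norm] at hz
    have h1 := h z hz
    have h0 : 0 < v z := lt_of_lt_of_le hm h1.2
    rcases hz.eq_or_lt with h2 | h2
    · left
      have : m ^ 5 * a ^ 2 / (12 * Λ) - m ^ 5 / (12 * Λ) * a ^ 2 = 0 := by ring
      rw [h2]; linarith
    · right
      refine ⟨?_, closedBall_mem h2, _, (hasLap_const _ z).sub ((hasLap_normSq P z).const_mul _), ?_⟩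
      · linarith [height_ge hz]
      · have h3 : Λ⁻¹ * m ^ 5 ≤ Λ⁻¹ * v z ^ 5 := by gcongr; exact h1.2
        have h4 : m ^ 5 / (12 * Λ) * 6 = Λ⁻¹ * m ^ 5 / 2 := by field_simp; norm_num
        have : 0 < Λ⁻¹ * m ^ 5 := by positivity
        linarith

lemma kelv_ray {x p : E3} (hp : p ≠ x) {τ : ℝ} (hτ : 0 ≤ τ) (v : E3 → ℝ) :
    kelv x (√(1 + τ) * ‖p - x‖) v (x + (1 + τ) • (p - x)) = v p / √(1 + τ) := by
  have hn : 0 < ‖p - x‖ := norm_pos_iff.2 (sub_ne_zero.2 hp)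
  have hs : √(1 + τ) ^ 2 = 1 + τ := Real.sq_sqrt (by linarith)
  have hs0 : 0 < √(1 + τ) := Real.sqrt_pos.2 (by linarith)
  have hi : inv x (√(1 + τ) * ‖p - x‖) (x + (1 + τ) • (p - x)) = p := by
    rw [inv, add_sub_cancel_left, norm_smul, smul_smul, Real.norm_of_nonneg (by linarith), mul_pow,
      hs]
    have : (1 + τ) * ‖p - x‖ ^ 2 / ((1 + τ) * ‖p - x‖) ^ 2 * (1 + τ) = 1 := by field_simp
    rw [this, one_smul]; abel
  rw [kelv, hi, add_sub_cancel_left, norm_smul, Real.norm_of_nonneg (by linarith)]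
  have : √(1 + τ) * ‖p - x‖ / ((1 + τ) * ‖p - x‖) = 1 / √(1 + τ) := by
    rw [div_eq_div_iff (by positivity) (by positivity)]
    linear_combination ‖p - x‖ * hs
  rw [this]; ring

/-- Comparison along rays as a consequence of moving spheres. -/
lemma ray_ge {x p z : E3} {v : E3 → ℝ} {l₁ s τ : ℝ} (hs0 : 0 < s) (hs : s ≤ 1)
    (h : ∀ l, 0 < l → l ≤ l₁ → ∀ z ∈ ann x l (8 * l₁ / s), kelv x l v z ≤ v z)
    (hp : p ≠ x) (hpx : 2 * ‖p - x‖ ≤ l₁) (hτ0 : 0 ≤ τ) (hτ1 : τ ≤ 1)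
    (hz : z = x + (1 + τ) • (p - x)) (hz2 : 0 ≤ z 2) (hvp : 0 ≤ v p) : v p / 2 ≤ v z := by
  have hn : 0 < ‖p - x‖ := norm_pos_iff.2 (sub_ne_zero.2 hp)
  have hq : √(1 + τ) ^ 2 = 1 + τ := Real.sq_sqrt (by linarith)
  have hq1 : 1 ≤ √(1 + τ) := by rw [Real.one_le_sqrt]; linarith
  have hq2 : √(1 + τ) ≤ 2 := by nlinarith
  have hzx : ‖z - x‖ = (1 + τ) * ‖p - x‖ := by
    rw [hz, add_sub_cancel_left, norm_smul, Real.norm_of_nonneg (by linarith)]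
  have := h (√(1 + τ) * ‖p - x‖) (by positivity) (by nlinarith) z ⟨hz2, by
    rw [hzx]; gcongr; nlinarith, by
    rw [hzx, le_div_iff₀ hs0]
    calc (1 + τ) * ‖p - x‖ * s ≤ (1 + 1) * ‖p - x‖ * 1 := by gcongr
      _ ≤ 8 * l₁ := by linarith⟩
  rw [hz, kelv_ray hp hτ0] at this
  rw [hz]
  refine le_trans ?_ this
  gcongr

/-- Gradient bound for solutions. -/
lemma Sol.fderiv_le {Λ ε ρ : ℝ} {v K c : E3 → ℝ} (hv : Sol Λ ε ρ v K c) (hΛ : 0 < Λ) {y : E3}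
    (hy : 1 < y 2) (h : ∀ z, ‖z - y‖ ≤ 1 → z ∈ hB ρ ∧ v z ≤ 2) :
    ‖fderiv ℝ v y‖ ≤ 2 * (32 * Λ + 7) := by
  have h2 : ∀ z, ‖z - y‖ ≤ 1 → 0 < z 2 := fun z hz => by linarith [height_ge hz]
  refine HalfBall.fderiv_le (fun x hx => hv.c2 x (h x hx).1 (h2 x hx)) (fun x hx => ?_)
    (fun x hx => ⟨(hv.pos x (h x hx).1).le, (h x hx).2⟩)
  have hx' := h x hx.le
  have h0 := hv.pos x hx'.1
  have hK0 : 0 < K x := lt_of_lt_of_le (by positivity) (hv.Klow x hx'.1)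
  rw [hv.eqn x hx'.1 (h2 x hx.le), abs_neg, abs_of_pos (by positivity)]
  calc K x * v x ^ 5 ≤ Λ * 2 ^ 5 := by
        gcongr
        · exact hv.Kup x hx'.1
        · exact hx'.2
    _ = 32 * Λ := by ring

/-- Exclusion of concentration far from the flat boundary. -/
theorem no_bubble_interior {Λ : ℝ} (hΛ : 1 ≤ Λ) : ∃ T₀ L A₀ : ℝ, 0 < T₀ ∧ 0 < L ∧ 0 < A₀ ∧
    ∀ A ≥ A₀, ∀ (ε ρ : ℝ) (v K c : E3 → ℝ), 0 < ε → Sol Λ ε ρ v K c → ∀ x₀ : E3, T₀ ≤ x₀ 2 →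
    v x₀ = 1 → (∀ z, 0 ≤ z 2 → ‖z - x₀‖ ≤ L → z ∈ hB ρ ∧ v z ≤ 2) →
    (∀ z, 0 ≤ z 2 → ‖z - x₀‖ ≤ L + 1 / (64 * ε) → z ∈ hB ρ ∧ A * ε ≤ v z) → False := by
  have hΛ0 : 0 < Λ := by linarith
  obtain ⟨Cg, hCg⟩ : ∃ Cg, Cg = 2 * (32 * Λ + 7) := ⟨_, rfl⟩
  have hCg0 : 1 < Cg := by rw [hCg]; linarith
  obtain ⟨r, hr⟩ : ∃ r, r = 20 * Λ := ⟨_, rfl⟩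
  have hr1 : 20 ≤ r := by rw [hr]; linarith
  obtain ⟨d, hd⟩ : ∃ d, d = 1 / (2 * Cg) := ⟨_, rfl⟩
  have hd0 : 0 < d := by rw [hd]; positivity
  have hd1 : d ≤ 1 := by rw [hd, div_le_one (by positivity)]; linarith
  obtain ⟨κ, hκ⟩ : ∃ κ, κ = d / (12 * r) := ⟨_, rfl⟩
  have hκ0 : 0 < κ := by rw [hκ]; positivity
  have hκ1 : κ ≤ 1 / 2 := by rw [hκ, div_le_iff₀ (by positivity)]; linarith
  obtain ⟨A₁, hA₁, hms⟩ := ms_interior (l₁ := 2 * r) hΛ (by linarith) hκ0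
  obtain ⟨T₀, hT₀⟩ : ∃ T₀, T₀ = 8 * r + 2 * ((27 * Λ + 3 * Cg) * (2 * r) ^ 2) / κ := ⟨_, rfl⟩
  have hT0 : 8 * r ≤ T₀ := by
    have : 0 ≤ 2 * ((27 * Λ + 3 * Cg) * (2 * r) ^ 2) / κ := by positivity
    linarith
  refine ⟨T₀, 6 * r, A₁ + 1024 * r, by linarith, by linarith, by linarith, ?_⟩
  intro A hA ε ρ v K c hε hv x₀ hx₀ hv1 hv2 hvA
  have hA0 : 0 < A := by linarith
  have hs0 : 0 < A * ε := by positivity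
  have hs1 : A * ε ≤ 1 := by
    rw [← hv1]; exact (hvA x₀ (by linarith) (by simp; positivity)).2
  have hup : ∀ z, ‖z - x₀‖ ≤ 6 * r → z ∈ hB ρ ∧ v z ≤ 2 ∧ 0 < z 2 := fun z hz => by
    have := height_ge hz
    exact ⟨(hv2 z (by linarith) hz).1, (hv2 z (by linarith) hz).2, by linarith⟩
  have hgr : ∀ y, ‖y - x₀‖ ≤ 3 * r → ‖fderiv ℝ v y‖ ≤ Cg := fun y hy => by
    rw [hCg]
    refine hv.fderiv_le hΛ0 (by linarith [height_ge hy]) fun z hz => ?_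
    have : ‖z - x₀‖ ≤ 6 * r := by
      have := norm_sub_le_norm_sub_add_norm_sub z y x₀
      linarith
    exact ⟨(hup z this).1, (hup z this).2.1⟩
  have hhalf : ∀ y, ‖y - x₀‖ ≤ d → 1 / 2 ≤ v y := fun y hy => by
    have := (convex_closedBall x₀ d).norm_image_sub_le_of_norm_fderiv_le (𝕜 := ℝ) (f := v) (C := Cg)
      (fun z hz => by
        rw [mem_closedBall_norm] at hz
        have h3 := hup z (by linarith)
        exact (hv.c2 z h3.1 h3.2.2).differentiableAt (by norm_num))
      (fun z hz => by
        rw [mem_closedBall_norm] at hz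
        exact hgr z (by linarith))
      (mem_closedBall_self hd0.le) (mem_closedBall_norm.2 hy)
    rw [hv1, Real.norm_eq_abs] at this
    have h5 := neg_abs_le (v y - 1)
    have h6 : Cg * ‖y - x₀‖ ≤ Cg * d := by gcongr
    have h7 : Cg * d = 1 / 2 := by rw [hd]; field_simp
    linarith
  have hlow : ∀ y, ‖y - x₀‖ ≤ 3 * r → κ ≤ v y := fun y hy => by
    rcases le_total ‖y - x₀‖ d with h | h
    · linarith [hhalf y h]
    have h6r : ‖y - x₀‖ ≤ 6 * r := by linarith
    have := hv.compare (D := closedBall x₀ (6 * r) ∩ {z | d ≤ ‖z - x₀‖})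
      ((isCompact_closedBall _ _).inter_right (isClosed_le (by fun_prop) (by fun_prop)))
      (fun z hz => (hup z (mem_closedBall_norm.1 hz.1)).1)
      (ψ := fun z => d / 2 * (1 / ‖z - x₀‖) - d / (12 * r)) ?_ ?_ y
      ⟨mem_closedBall_norm.2 h6r, h⟩
    · refine le_trans ?_ this
      have h8 : 1 / (3 * r) ≤ 1 / ‖y - x₀‖ := by
        apply one_div_le_one_div_of_le (by linarith) hy
      have h9 : d / 2 * (1 / (3 * r)) ≤ d / 2 * (1 / ‖y - x₀‖) := by gcongr
      have h10 : d / 2 * (1 / (3 * r)) = 2 * κ := by rw [hκ]; field_simp; norm_num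
      rw [hκ] at *
      linarith
    · refine ContinuousOn.sub (ContinuousOn.mul (by fun_prop)
        (ContinuousOn.div (by fun_prop) (by fun_prop) fun z hz => ?_)) (by fun_prop)
      have : d ≤ ‖z - x₀‖ := hz.2
      exact (by linarith : 0 < ‖z - x₀‖).ne'
    · rintro z ⟨hz1, hz2 : d ≤ ‖z - x₀‖⟩
      rw [mem_closedBall_norm] at hz1
      have hz := hup z hz1
      have hzv := hv.pos z hz.1
      rcases hz2.eq_or_lt with h3 | h3
      · left
        have := hhalf z h3.ge
        have h8 : d / 2 * (1 / ‖z - x₀‖) = 1 / 2 := by rw [← h3]; field_simp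
        have : 0 < d / (12 * r) := by positivity
        linarith
      rcases hz1.eq_or_lt with h4 | h4
      · left
        have : d / 2 * (1 / ‖z - x₀‖) = d / (12 * r) := by rw [h4]; field_simp; norm_num
        linarith
      · right
        refine ⟨hz.2.2, inter_mem (closedBall_mem h4) ?_, _,
          ((hasLap_inv_norm (by rintro rfl; simp at h3; linarith)).const_mul _).sub
            (hasLap_const _ z), ?_⟩
        · exact mem_of_superset ((isOpen_lt (f := fun _ => d) (g := fun z : E3 => ‖z - x₀‖)
            (by fun_prop) (by fun_prop)).mem_nhds h3) fun w (hw : d < ‖w - x₀‖) => hw.le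
        · have : 0 < Λ⁻¹ * v z ^ 5 := by positivity
          linarith
  have hball : ∀ y, ‖y - x₀‖ ≤ r → 1 / 2 ≤ v y := fun y hy => by
    rcases eq_or_ne y x₀ with rfl | hne
    · rw [hv1]; norm_num
    have hn : 0 < ‖y - x₀‖ := norm_pos_iff.2 (sub_ne_zero.2 hne)
    set x := x₀ - (r / ‖y - x₀‖) • (y - x₀) with hx
    have hxx : x₀ - x = (r / ‖y - x₀‖) • (y - x₀) := by rw [hx]; abel
    have hxn : ‖x₀ - x‖ = r := by
      rw [hxx, norm_smul, Real.norm_of_nonneg (by positivity)]; field_simp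
    have hxn' : ‖x - x₀‖ = r := by rw [norm_sub_rev, hxn]
    have hx2 := height_ge hxn'.le
    have hM := hms A (by linarith) Cg ε ρ v K c (by linarith) hε hv x (by linarith) ?_ ?_ ?_
    · have := ray_ge (z := y) (p := x₀) (τ := ‖y - x₀‖ / r) hs0 hs1 hM
        (by rintro h; rw [← h] at hxn; simp at hxn; linarith) (by rw [hxn]) (by positivity)
        ((div_le_one (by linarith)).2 hy) ?_ (hup y (by linarith)).2.2.le (by rw [hv1]; norm_num)
      · rwa [hv1] at this
      · rw [hxx, hx, smul_smul]
        have : (1 + ‖y - x₀‖ / r) * (r / ‖y - x₀‖) = r / ‖y - x₀‖ + 1 := by field_simp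
        rw [this, add_smul, one_smul]; abel
    · have h1 : 2 * ((27 * Λ + 3 * Cg) * (2 * r) ^ 2) / κ < x 2 := by linarith
      rw [div_lt_iff₀ hκ0] at h1
      linarith
    · intro z hz
      have h1 := norm_sub_le_norm_sub_add_norm_sub z x x₀
      have h2 : ‖z - x₀‖ ≤ 3 * r := by linarith
      exact ⟨(hup z (by linarith)).1, hlow z h2, (hup z (by linarith)).2.1, hgr z h2⟩
    · intro z hz0 hz
      refine hvA z hz0 ?_
      have h1 := norm_sub_le_norm_sub_add_norm_sub z x x₀
      have : 8 * (2 * r) / (A * ε) ≤ 1 / (64 * ε) := by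
        rw [div_le_div_iff₀ (by positivity) (by positivity)]
        nlinarith
      linarith
  have := hv.center_ge hΛ0 (P := x₀) (a := r) (m := 1 / 2) (by linarith) (by norm_num)
    (by linarith) (fun z hz => ⟨(hup z (by linarith)).1, hball z hz⟩)
  rw [hv1, div_le_one (by positivity), hr] at this
  nlinarith

/-- Horizontal part of a vector. -/
def hor (y : E3) : E3 := y - y 2 • eb 2

lemma hor_two (y : E3) : hor y 2 = 0 := by simp [hor]

lemma norm_hor_sq (y : E3) : ‖hor y‖ ^ 2 + y 2 ^ 2 = ‖y‖ ^ 2 := by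
  rw [norm_sq_eq, norm_sq_eq]; simp [hor]

lemma norm_hor_le (y : E3) : ‖hor y‖ ≤ ‖y‖ := by
  have := norm_hor_sq y
  exact le_of_sq_le_sq (by nlinarith [sq_nonneg (y 2)]) (norm_nonneg y)

lemma hor_add_height (y : E3) : hor y + y 2 • eb 2 = y := by simp [hor]

/-- Exclusion of concentration near the flat boundary. -/
theorem no_bubble_boundary {Λ T₀ : ℝ} (hΛ : 1 ≤ Λ) (hT₀ : 0 < T₀) : ∃ L A₀ : ℝ, 0 < L ∧ 0 < A₀ ∧
    ∀ A ≥ A₀, ∀ (ε ρ : ℝ) (v K c : E3 → ℝ), 0 < ε → Sol Λ ε ρ v K c → ∀ x₀ : E3, 0 ≤ x₀ 2 →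
    x₀ 2 ≤ T₀ →
    v x₀ = 1 → (∀ z, 0 ≤ z 2 → ‖z - x₀‖ ≤ L → z ∈ hB ρ ∧ v z ≤ 2) →
    (∀ z, 0 ≤ z 2 → ‖z - x₀‖ ≤ L + 1 / (64 * ε) → z ∈ hB ρ ∧ A * ε ≤ v z) → False := by
  have hΛ0 : 0 < Λ := by linarith
  obtain ⟨q, hq⟩ : ∃ q, q = 20000 * Λ + 8 * T₀ := ⟨_, rfl⟩
  have hq1 : 20000 ≤ q := by rw [hq]; linarith
  have hqT : 8 * T₀ ≤ q := by rw [hq]; linarith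
  obtain ⟨A₁, hA₁, hms⟩ := ms_boundary (l₁ := 2 * (2 * q + T₀)) hΛ (by linarith)
  refine ⟨4 * (2 * q + T₀), A₁ + 1024 * (2 * q + T₀), by linarith, by linarith, ?_⟩
  intro A hA ε ρ v K c hε hv x₀ hx₀ hxT hv1 hv2 hvA
  have hA0 : 0 < A := by linarith
  have hs0 : 0 < A * ε := by positivity
  have hs1 : A * ε ≤ 1 := by
    rw [← hv1]; exact (hvA x₀ hx₀ (by simp; positivity)).2
  obtain ⟨Q, hQ⟩ : ∃ Q, Q = x₀ - (x₀ 2 + q) • eb 2 := ⟨_, rfl⟩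
  have hQ2 : Q 2 = -q := by rw [hQ]; simp
  have hQx : ‖Q - x₀‖ ≤ T₀ + q := by
    rw [hQ, sub_sub_cancel_left, norm_neg, norm_smul, norm_eb, Real.norm_of_nonneg (by linarith)]
    linarith
  have hup : ∀ z, 0 ≤ z 2 → ‖z - Q‖ ≤ 2 * q → z ∈ hB ρ ∧ v z ≤ 2 := fun z h1 h2 => by
    have := norm_sub_le_norm_sub_add_norm_sub z Q x₀
    exact hv2 z h1 (by linarith)
  -- lower bound on the cone
  have hcone : ∀ z, ‖z - Q‖ ≤ 2 * q → z 2 = x₀ 2 * (1 + ‖hor (z - Q)‖ / (2 * q)) →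
      1 / 2 ≤ v z := by
    intro z hz1 hz2
    have hz0 : 0 ≤ z 2 := by rw [hz2]; positivity
    have hzd : z - Q = hor (z - Q) + (z 2 + q) • eb 2 := by
      conv_lhs => rw [← hor_add_height (z - Q)]
      simp [hQ2]
    rcases eq_or_ne (hor (z - Q)) 0 with h | h
    · rw [h] at hz2 hzd
      have : z = x₀ := by
        simp only [norm_zero, zero_div, add_zero, mul_one] at hz2
        rw [hz2, zero_add, hQ, sub_eq_iff_eq_add] at hzd
        rw [hzd]; abel
      rw [this, hv1]; norm_num
    have hs : 0 < ‖hor (z - Q)‖ := norm_pos_iff.2 h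
    have hs2 : ‖hor (z - Q)‖ ≤ 2 * q := (norm_hor_le _).trans hz1
    set s := ‖hor (z - Q)‖ with hsd
    obtain ⟨x, hx⟩ : ∃ x, x = x₀ - x₀ 2 • eb 2 - (2 * q / s) • hor (z - Q) := ⟨_, rfl⟩
    have hxx : x₀ - x = x₀ 2 • eb 2 + (2 * q / s) • hor (z - Q) := by rw [hx]; abel
    have hx2 : x 2 = 0 := by rw [hx]; simp [hor_two]
    have hxn : ‖x₀ - x‖ ≤ 2 * q + T₀ := by
      rw [hxx]
      refine (norm_add_le _ _).trans ?_
      rw [norm_smul, norm_smul, norm_eb, Real.norm_of_nonneg hx₀,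
        Real.norm_of_nonneg (by positivity), ← hsd]
      have : 2 * q / s * s = 2 * q := by field_simp
      linarith
    have hzx : z = x + (1 + s / (2 * q)) • (x₀ - x) := by
      have e1 : x + (1 + s / (2 * q)) • (x₀ - x) = x₀ + (s / (2 * q)) • (x₀ - x) := by
        rw [add_smul, one_smul]; abel
      have e2 : s / (2 * q) * (2 * q / s) = 1 := by field_simp
      rw [e1, hxx, smul_add, smul_smul, smul_smul, e2, one_smul, ← sub_eq_zero]
      have e3 : z = Q + (hor (z - Q) + (z 2 + q) • eb 2) := by rw [← hzd]; abel
      nth_rw 1 [e3]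
      rw [hz2, hQ]
      module
    have hne : x₀ ≠ x := by
      intro h1
      have h2 : z = x₀ := by rw [hzx, ← h1]; simp
      apply h
      rw [h2, hQ]
      simp [hor]
    have hxn' : ‖x - x₀‖ ≤ 2 * q + T₀ := by rwa [norm_sub_rev]
    have hM := hms A (by linarith) ε ρ v K c hε hv x hx2 ?_ ?_
    · have := ray_ge (z := z) (p := x₀) (τ := s / (2 * q)) hs0 hs1 hM hne
        (by linarith) (by positivity) ((div_le_one (by linarith)).2 hs2) hzx hz0
        (by rw [hv1]; norm_num)
      rwa [hv1] at this
    · intro w hw0 hw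
      have h1 := norm_sub_le_norm_sub_add_norm_sub w x x₀
      exact hv2 w hw0 (by linarith)
    · intro w hw0 hw
      refine hvA w hw0 ?_
      have h1 := norm_sub_le_norm_sub_add_norm_sub w x x₀
      have : 8 * (2 * (2 * q + T₀)) / (A * ε) ≤ 1 / (64 * ε) := by
        rw [div_le_div_iff₀ (by positivity) (by positivity)]
        nlinarith
      linarith
  -- comparison above the cone
  have hcmp := hv.compare
    (D := closedBall Q (2 * q) ∩ {z | x₀ 2 * (1 + ‖hor (z - Q)‖ / (2 * q)) ≤ z 2})
    ((isCompact_closedBall _ _).inter_right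
      (isClosed_le (by unfold hor; fun_prop) (by fun_prop)))
    (fun z hz => (hup z (le_trans (by positivity) hz.2) (mem_closedBall_norm.1 hz.1)).1)
    (ψ := fun z => q * (1 / ‖z - Q‖) - 1 / 2)
    (by
      refine ContinuousOn.sub (ContinuousOn.mul (by fun_prop)
        (ContinuousOn.div (by fun_prop) (by fun_prop) ?_)) (by fun_prop)
      rintro z ⟨_, hz2 : _ ≤ z 2⟩
      have h1 : 0 ≤ z 2 := le_trans (by positivity) hz2
      have h2 := coord_le (z - Q) 2
      have h3 : (z - Q) 2 = z 2 - Q 2 := rfl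
      exact (by linarith : 0 < ‖z - Q‖).ne')
    (by
      rintro z ⟨hz1, hz2 : _ ≤ z 2⟩
      rw [mem_closedBall_norm] at hz1
      have h1 : 0 ≤ z 2 := le_trans (by positivity) hz2
      have h2 := coord_le (z - Q) 2
      have h3 : (z - Q) 2 = z 2 - Q 2 := rfl
      have h4 : q ≤ ‖z - Q‖ := by linarith
      have hz := hup z h1 hz1
      have hvz := hv.pos z hz.1
      rcases hz2.eq_or_lt with h5 | h5
      · left
        have := hcone z hz1 h5.symm
        have : q * (1 / ‖z - Q‖) ≤ 1 := by
          rw [mul_one_div, div_le_one (by linarith)]; exact h4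
        linarith
      rcases hz1.eq_or_lt with h6 | h6
      · left
        have : q * (1 / ‖z - Q‖) = 1 / 2 := by rw [h6]; field_simp
        linarith
      · right
        refine ⟨lt_of_le_of_lt (by positivity) h5, inter_mem (closedBall_mem h6) ?_, _,
          ((hasLap_inv_norm (by rintro rfl; simp at h4; linarith)).const_mul _).sub
            (hasLap_const _ z), ?_⟩
        · exact mem_of_superset ((isOpen_lt
            (f := fun z => x₀ 2 * (1 + ‖hor (z - Q)‖ / (2 * q))) (g := fun z : E3 => z 2)
            (by unfold hor; fun_prop) (by fun_prop)).mem_nhds h5)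
            fun w (hw : x₀ 2 * (1 + ‖hor (w - Q)‖ / (2 * q)) < w 2) => hw.le
        · have : 0 < Λ⁻¹ * v z ^ 5 := by positivity
          linarith)
  obtain ⟨P, hP⟩ : ∃ P, P = Q + (3 * q / 2) • eb 2 := ⟨_, rfl⟩
  have hP2 : P 2 = q / 2 := by rw [hP]; simp [hQ2]; ring
  have hPQ : ‖P - Q‖ = 3 * q / 2 := by
    rw [hP, add_sub_cancel_left, norm_smul, norm_eb, Real.norm_of_nonneg (by linarith), mul_one]
  have hball : ∀ z, ‖z - P‖ ≤ q / 4 → z ∈ hB ρ ∧ 1 / 14 ≤ v z := by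
    intro z hz
    have h1 := norm_sub_le_norm_sub_add_norm_sub z P Q
    have h2 := height_ge hz
    have h3 : ‖hor (z - Q)‖ ≤ q / 4 := by
      have : hor (z - Q) = hor (z - P) := by
        rw [hP]; simp only [hor, PiLp.sub_apply, PiLp.add_apply, PiLp.smul_apply, eb_apply, if_true,
          smul_eq_mul]
        module
      rw [this]
      exact (norm_hor_le _).trans hz
    have h4 := hcmp z ⟨mem_closedBall_norm.2 (by linarith), by
      show _ ≤ z 2
      have h5 : ‖hor (z - Q)‖ / (2 * q) ≤ 1 := by
        rw [div_le_one (by linarith)]; linarith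
      calc x₀ 2 * (1 + ‖hor (z - Q)‖ / (2 * q)) ≤ T₀ * (1 + 1) := by gcongr
        _ ≤ z 2 := by linarith⟩
    refine ⟨(hup z (by linarith) (by linarith)).1, ?_⟩
    have h5 : 0 < ‖z - Q‖ := by
      have h2 := coord_le (z - Q) 2
      have h3 : (z - Q) 2 = z 2 - Q 2 := rfl
      linarith
    have h6 : 4 / 7 ≤ q * (1 / ‖z - Q‖) := by
      rw [mul_one_div, le_div_iff₀ h5]; linarith
    linarith
  have h1 := hv.center_ge hΛ0 (P := P) (a := q / 4) (m := 1 / 14) (by linarith) (by norm_num)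
    (by linarith) hball
  have h2 := (hup P (by linarith) (by linarith)).2
  have h3 : (1 / 14 : ℝ) ^ 5 * (q / 4) ^ 2 / (12 * Λ) ≤ 2 := h1.trans h2
  rw [div_le_iff₀ (by positivity)] at h3
  have h4 : 20000 * Λ ≤ q := by rw [hq]; linarith
  have h5 : (20000 * Λ) ^ 2 ≤ q ^ 2 := by gcongr
  nlinarith

theorem no_bubble {Λ : ℝ} (hΛ : 1 ≤ Λ) : ∃ L A : ℝ, 0 < L ∧ 0 < A ∧
    ∀ (ε ρ : ℝ) (v K c : E3 → ℝ), 0 < ε → Sol Λ ε ρ v K c → ∀ x₀ : E3, 0 ≤ x₀ 2 →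
    v x₀ = 1 → (∀ z, 0 ≤ z 2 → ‖z - x₀‖ ≤ L → z ∈ hB ρ ∧ v z ≤ 2) →
    (∀ z, 0 ≤ z 2 → ‖z - x₀‖ ≤ L + 1 / (64 * ε) → z ∈ hB ρ ∧ A * ε ≤ v z) → False := by
  obtain ⟨T₀, L₁, A₁, hT₀, hL₁, hA₁, h1⟩ := no_bubble_interior hΛ
  obtain ⟨L₂, A₂, hL₂, hA₂, h2⟩ := no_bubble_boundary hΛ hT₀
  refine ⟨L₁ + L₂, A₁ + A₂, by positivity, by positivity, ?_⟩
  intro ε ρ v K c hε hv x₀ hx₀ hv1 hv2 hvA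
  rcases le_total T₀ (x₀ 2) with h | h
  · exact h1 (A₁ + A₂) (by linarith) ε ρ v K c hε hv x₀ h hv1
      (fun z h3 h4 => hv2 z h3 (by linarith)) (fun z h3 h4 => hvA z h3 (by linarith))
  · exact h2 (A₁ + A₂) (by linarith) ε ρ v K c hε hv x₀ hx₀ h hv1
      (fun z h3 h4 => hv2 z h3 (by linarith)) (fun z h3 h4 => hvA z h3 (by linarith))

lemma fderiv_dilate (f : E3 → ℝ) {s : ℝ} (z : E3) :
    fderiv ℝ (fun y => f (s • y)) z = s • fderiv ℝ f (s • z) := by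
  exact fderiv_comp_smul s

lemma lap_dilate (f : E3 → ℝ) (a s : ℝ) (z : E3) :
    lap (fun y => a * f (s • y)) z = a * s ^ 2 * lap f (s • z) := by
  unfold lap
  rw [Finset.mul_sum]
  refine Finset.sum_congr rfl fun i _ => ?_
  have h1 : (fun y => fderiv ℝ (fun y => a * f (s • y)) y (EuclideanSpace.single i 1))
      = fun y => (a * s) * fderiv ℝ f (s • y) (EuclideanSpace.single i 1) := by
    ext y
    rw [show (fun y => a * f (s • y)) = a • fun y => f (s • y) from rfl,
      fderiv_const_smul_field, Pi.smul_apply, fderiv_dilate]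
    simp [mul_assoc]
  rw [h1, show (fun y => (a * s) * fderiv ℝ f (s • y) (EuclideanSpace.single i 1))
    = (a * s) • fun y => (fun w => fderiv ℝ f w (EuclideanSpace.single i 1)) (s • y) from rfl,
    fderiv_const_smul_field, Pi.smul_apply,
    fderiv_dilate (fun w => fderiv ℝ f w (EuclideanSpace.single i 1))]
  simp only [_root_.smul_apply, smul_eq_mul]
  ring

lemma smul_mem_up {s : ℝ} (hs : 0 ≤ s) {z : E3} (hz : z ∈ up) : s • z ∈ up := by
  have : 0 ≤ z 2 := hz
  show 0 ≤ (s • z) 2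
  simp; positivity

lemma Sol.scale {Λ ε ρ : ℝ} {v K c : E3 → ℝ} (hv : Sol Λ ε ρ v K c) {a : ℝ} (ha : 0 < a) :
    Sol Λ (a ^ 2 * ε) (ρ / a ^ 2) (fun z => a * v (a ^ 2 • z)) (fun z => K (a ^ 2 • z))
      (fun z => c (a ^ 2 • z)) := by
  have hmem : ∀ z ∈ hB (ρ / a ^ 2), a ^ 2 • z ∈ hB ρ := by
    intro z hz
    refine ⟨?_, smul_mem_up (by positivity) hz.2⟩
    rw [norm_smul, Real.norm_of_nonneg (by positivity), mul_comm]
    exact (lt_div_iff₀ (by positivity)).1 hz.1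
  have hdist : ∀ y z : E3, ‖a ^ 2 • y - a ^ 2 • z‖ = a ^ 2 * ‖y - z‖ := by
    intro y z
    rw [← smul_sub, norm_smul, Real.norm_of_nonneg (by positivity)]
  have hpl : ∀ z : E3, z 2 = 0 → (a ^ 2 • z) 2 = 0 := by intro z hz; simp [hz]
  refine ⟨fun z hz => mul_pos ha (hv.pos _ (hmem z hz)), ?_, ?_, ?_, ?_,
    fun z hz => hv.Klow _ (hmem z hz), fun z hz => hv.Kup _ (hmem z hz), ?_,
    fun z hz h => hv.cbd _ (hmem z hz) (hpl z h), ?_⟩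
  · exact continuousOn_const.mul (hv.cont.comp (by fun_prop) hmem)
  · intro z hz h
    have h1 : 0 < (a ^ 2 • z) 2 := by simp; positivity
    exact contDiffAt_const.mul ((hv.c2 _ (hmem z hz) h1).comp z (by fun_prop))
  · intro z hz h
    have h1 : 0 < (a ^ 2 • z) 2 := by simp; positivity
    rw [lap_dilate, hv.eqn _ (hmem z hz) h1]
    ring
  · intro z hz h
    obtain ⟨G, hG, hG1⟩ := hv.bdry _ (hmem z hz) (hpl z h)
    have h2 : HasFDerivWithinAt (fun y : E3 => a ^ 2 • y) (a ^ 2 • ContinuousLinearMap.id ℝ E3)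
        up z := (hasFDerivWithinAt_id z up).const_smul (a ^ 2)
    have h3 := (hG.comp z h2 fun y hy => smul_mem_up (by positivity) hy).const_mul a
    refine ⟨_, h3, ?_⟩
    simp [hG1]; ring
  · intro y hy z hz
    have := hv.Klip _ (hmem y hy) _ (hmem z hz)
    rw [hdist] at this
    exact this.trans_eq (by ring)
  · intro y hy z hz h1 h2
    have := hv.clip _ (hmem y hy) _ (hmem z hz) (hpl y h1) (hpl z h2)
    rw [hdist] at this
    exact this.trans_eq (by ring)

lemma isCompact_half_ball (x : E3) (r : ℝ) : IsCompact (closedBall x r ∩ up) :=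
  (isCompact_closedBall x r).inter_right isClosed_up

/-- The Harnack type inequality: on small half-balls, the product of the supremum and the infimum
is bounded. -/
theorem sup_mul_inf_le {Λ : ℝ} (hΛ : 1 ≤ Λ) : ∃ B : ℝ, 0 < B ∧ ∀ u K c : E3 → ℝ,
    Sol Λ 1 3 u K c → ∀ x : E3, ‖x‖ ≤ 3 / 2 → 0 ≤ x 2 → ∀ m : ℝ, 0 < m →
    (∀ z, 0 ≤ z 2 → ‖z - x‖ ≤ 1 / 16 → m ≤ u z) →
    ∀ y, 0 ≤ y 2 → ‖y - x‖ ≤ 1 / 64 → u y * m ≤ B := by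
  obtain ⟨L, A, hL, hA, hnb⟩ := no_bubble hΛ
  refine ⟨2 * A + 128 * L, by positivity, ?_⟩
  intro u K c hu x hx hx2 m hm hmu y hy2 hy
  have hBx : ∀ z, 0 ≤ z 2 → ‖z - x‖ ≤ 1 / 16 → z ∈ hB 3 := fun z h1 h2 => by
    refine ⟨?_, h1⟩
    have := norm_le_norm_add_norm_sub' z x
    linarith
  have hyD : y ∈ closedBall x (1 / 32) ∩ up := ⟨mem_closedBall_norm.2 (by linarith), hy2⟩
  obtain ⟨w, hw, hmax⟩ := (isCompact_half_ball x (1 / 32)).exists_isMaxOn ⟨y, hyD⟩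
    (f := fun z => u z ^ 2 * (1 / 32 - ‖z - x‖)) (by
      refine ContinuousOn.mul ((hu.cont.mono fun z hz => ?_).pow 2) (by fun_prop)
      exact hBx z hz.2 (by have := mem_closedBall_norm.1 hz.1; linarith))
  have hw1 : ‖w - x‖ ≤ 1 / 32 := mem_closedBall_norm.1 hw.1
  have hw2 : 0 ≤ w 2 := hw.2
  have hN : 0 < u w := hu.pos w (hBx w hw2 (by linarith))
  have hy0 : 0 < u y := hu.pos y (hBx y hy2 (by linarith))
  have hmy : m ≤ u y := hmu y hy2 (by linarith)
  have hyw : u y ^ 2 * (1 / 64) ≤ u w ^ 2 * (1 / 32 - ‖w - x‖) := by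
    have h1 : u y ^ 2 * (1 / 32 - ‖y - x‖) ≤ u w ^ 2 * (1 / 32 - ‖w - x‖) := hmax hyD
    have h2 : u y ^ 2 * (1 / 64) ≤ u y ^ 2 * (1 / 32 - ‖y - x‖) := by gcongr; linarith
    exact h2.trans h1
  rcases le_or_gt (u w ^ 2 * (1 / 32 - ‖w - x‖)) (2 * L) with h | h
  · have : u y * m ≤ u y ^ 2 := by rw [sq]; exact mul_le_mul_of_nonneg_left hmy hy0.le
    linarith
  rcases lt_or_ge (m * u w) A with h' | h'
  · have h1 : u y ≤ 2 * u w := by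
      apply le_of_sq_le_sq _ (by linarith)
      nlinarith [mul_nonneg (sq_nonneg (u w)) (norm_nonneg (w - x))]
    nlinarith [mul_le_mul_of_nonneg_right h1 hm.le]
  exfalso
  obtain ⟨a, ha⟩ : ∃ a, a = (u w)⁻¹ := ⟨_, rfl⟩
  have ha0 : 0 < a := by rw [ha]; positivity
  have hua : u w * a = 1 := by rw [ha]; field_simp
  have hwa : a ^ 2 • (u w ^ 2 • w) = w := by
    rw [smul_smul, ← mul_pow, mul_comm, hua]; simp
  have hz : ∀ z r, ‖z - u w ^ 2 • w‖ ≤ r → ‖a ^ 2 • z - w‖ ≤ a ^ 2 * r := by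
    intro z r h
    conv_lhs => rw [← hwa]
    rw [← smul_sub, norm_smul, Real.norm_of_nonneg (by positivity)]
    gcongr
  have hLd : a ^ 2 * L ≤ (1 / 32 - ‖w - x‖) / 2 := by
    have := mul_le_mul_of_nonneg_left h.le (sq_nonneg a)
    have e : a ^ 2 * (u w ^ 2 * (1 / 32 - ‖w - x‖)) = 1 / 32 - ‖w - x‖ := by
      rw [← mul_assoc, ← mul_pow, mul_comm a, hua]; ring
    linarith
  have hmem : ∀ z : E3, z ∈ hB (3 / a ^ 2) ↔ a ^ 2 • z ∈ hB 3 := by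
    intro z
    have : 0 < a ^ 2 := by positivity
    simp only [hB, mem_ofPred_eq, norm_smul, Real.norm_of_nonneg this.le,
      PiLp.smul_apply, smul_eq_mul, lt_div_iff₀ this, mul_comm (a ^ 2) ‖z‖,
      mul_nonneg_iff_of_pos_left this]
  have hup : ∀ z : E3, 0 ≤ z 2 → 0 ≤ (a ^ 2 • z) 2 := fun z hz => smul_mem_up (by positivity) hz
  have htri : ∀ z : E3, ‖a ^ 2 • z - x‖ ≤ ‖a ^ 2 • z - w‖ + ‖w - x‖ :=
    fun z => norm_sub_le_norm_sub_add_norm_sub _ _ _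
  refine hnb (a ^ 2 * 1) (3 / a ^ 2) _ _ _ (by positivity) (hu.scale ha0) (u w ^ 2 • w)
    (smul_mem_up (by positivity) hw2) ?_ ?_ ?_
  · rw [hwa, mul_comm, hua]
  · intro z hz2 hzL
    have h1 := hz z _ hzL
    have h2 := htri z
    have h3 : a ^ 2 • z ∈ closedBall x (1 / 32) ∩ up :=
      ⟨mem_closedBall_norm.2 (by linarith), hup z hz2⟩
    have h4 := hBx _ (hup z hz2) (by linarith)
    refine ⟨(hmem z).2 h4, ?_⟩
    have h5 : u (a ^ 2 • z) ^ 2 * (1 / 32 - ‖a ^ 2 • z - x‖) ≤ u w ^ 2 * (1 / 32 - ‖w - x‖) :=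
      hmax h3
    have h6 : 0 < 1 / 32 - ‖w - x‖ := by nlinarith [sq_nonneg (u w)]
    have h7 : u (a ^ 2 • z) ^ 2 * ((1 / 32 - ‖w - x‖) / 2) ≤ u w ^ 2 * (1 / 32 - ‖w - x‖) :=
      le_trans (by gcongr; linarith) h5
    have h8 : u (a ^ 2 • z) ≤ 2 * u w := by
      apply le_of_sq_le_sq _ (by linarith)
      have : u (a ^ 2 • z) ^ 2 ≤ 2 * u w ^ 2 := by
        by_contra! hc
        nlinarith
      nlinarith [sq_nonneg (u w)]
    calc a * u (a ^ 2 • z) ≤ a * (2 * u w) := by gcongr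
      _ = 2 * (u w * a) := by ring
      _ = 2 := by rw [hua]; ring
  · intro z hz2 hzL
    have h1 := hz z _ hzL
    have h2 := htri z
    have e : a ^ 2 * (L + 1 / (64 * (a ^ 2 * 1))) = a ^ 2 * L + 1 / 64 := by field_simp
    rw [e] at h1
    have h3 : ‖a ^ 2 • z - x‖ ≤ 1 / 16 := by
      have := norm_nonneg (w - x)
      linarith
    refine ⟨(hmem z).2 (hBx _ (hup z hz2) h3), ?_⟩
    have h4 := hmu _ (hup z hz2) h3
    calc A * (a ^ 2 * 1) ≤ m * u w * a ^ 2 := by rw [mul_one]; gcongr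
      _ = a * m * (u w * a) := by ring
      _ = a * m := by rw [hua, mul_one]
      _ ≤ _ := by gcongr

/-- The regularised distance `√(|w|² + τ²)`. -/
def mol (τ : ℝ) (w : E3) : ℝ := √(‖w‖ ^ 2 + τ ^ 2)

lemma mol_sq (τ : ℝ) (w : E3) : mol τ w ^ 2 = ‖w‖ ^ 2 + τ ^ 2 := Real.sq_sqrt (by positivity)

lemma le_mol {τ : ℝ} (w : E3) : τ ≤ mol τ w :=
  Real.le_sqrt_of_sq_le (by nlinarith [sq_nonneg ‖w‖])

lemma norm_le_mol (τ : ℝ) (w : E3) : ‖w‖ ≤ mol τ w :=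
  Real.le_sqrt_of_sq_le (by nlinarith [sq_nonneg τ])

lemma mol_pos {τ : ℝ} (hτ : 0 < τ) (w : E3) : 0 < mol τ w := hτ.trans_le (le_mol w)

lemma mol_le {τ : ℝ} (hτ : 0 ≤ τ) (w : E3) : mol τ w ≤ ‖w‖ + τ := by
  rw [mol, Real.sqrt_le_left (by positivity)]
  nlinarith [mul_nonneg (norm_nonneg w) hτ]

lemma continuous_mol (τ : ℝ) : Continuous (mol τ) := by
  unfold mol; fun_prop

lemma hasDerivAt_mol_line {τ : ℝ} (hτ : 0 < τ) (x z : E3) (i : Fin 3) (t : ℝ) :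
    HasDerivAt (fun t : ℝ => mol τ (z + t • eb i - x))
      ((z + t • eb i - x) i / mol τ (z + t • eb i - x)) t := by
  have h := ((hasDerivAt_normSq_line x z i t).add_const (τ ^ 2)).sqrt (by positivity)
  refine h.congr_deriv ?_
  rw [mul_div_mul_left _ _ two_ne_zero]
  rfl

lemma hasDerivAt_inv_mol_line {τ : ℝ} (hτ : 0 < τ) (x z : E3) (i : Fin 3) (t : ℝ) :
    HasDerivAt (fun t : ℝ => 1 / mol τ (z + t • eb i - x))
      (-((z + t • eb i - x) i / mol τ (z + t • eb i - x) ^ 3)) t := by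
  have h0 := mol_pos hτ (z + t • eb i - x)
  simp only [one_div]
  refine ((hasDerivAt_mol_line hτ x z i t).inv h0.ne').congr_deriv ?_
  field_simp

lemma hasDerivAt_inv_mol_line₂ {τ : ℝ} (hτ : 0 < τ) (x z : E3) (i : Fin 3) (t : ℝ) :
    HasDerivAt (fun t : ℝ => -((z + t • eb i - x) i / mol τ (z + t • eb i - x) ^ 3))
      (3 * (z + t • eb i - x) i ^ 2 / mol τ (z + t • eb i - x) ^ 5
        - 1 / mol τ (z + t • eb i - x) ^ 3) t := by
  have h0 := mol_pos hτ (z + t • eb i - x)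
  have h1 := hasDerivAt_coord_line x z i i t
  rw [if_pos rfl] at h1
  refine ((h1.div ((hasDerivAt_mol_line hτ x z i t).pow 3) (pow_pos h0 3).ne').neg).congr_deriv ?_
  simp only [Pi.pow_apply]
  field_simp
  norm_num
  ring

lemma abs_mol_deriv_le {τ : ℝ} (hτ : 0 < τ) (w : E3) (i : Fin 3) :
    |-(w i / mol τ w ^ 3)| ≤ 1 / τ ^ 2 := by
  have h0 := mol_pos hτ w
  have h1 : |w i| ≤ mol τ w := (abs_coord_le w i).trans (norm_le_mol τ w)
  rw [abs_neg, abs_div, abs_of_pos (a := mol τ w ^ 3) (by positivity)]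
  calc |w i| / mol τ w ^ 3 ≤ mol τ w / mol τ w ^ 3 := by gcongr
    _ = 1 / mol τ w ^ 2 := by field_simp
    _ ≤ 1 / τ ^ 2 := by gcongr; exact le_mol w

lemma abs_mol_deriv₂_le {τ : ℝ} (hτ : 0 < τ) (w : E3) (i : Fin 3) :
    |3 * w i ^ 2 / mol τ w ^ 5 - 1 / mol τ w ^ 3| ≤ 4 / τ ^ 3 := by
  have h0 := mol_pos hτ w
  have h1 : |w i| ≤ mol τ w := (abs_coord_le w i).trans (norm_le_mol τ w)
  have h2 : w i ^ 2 ≤ mol τ w ^ 2 := by rw [← sq_abs]; gcongr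
  have h3 : 3 * w i ^ 2 / mol τ w ^ 5 ≤ 3 * mol τ w ^ 2 / mol τ w ^ 5 := by gcongr
  have h4 : 3 * mol τ w ^ 2 / mol τ w ^ 5 = 3 / mol τ w ^ 3 := by field_simp
  have h5 : 1 / mol τ w ^ 3 ≤ 1 / τ ^ 3 := by gcongr; exact le_mol w
  have h6 : 3 / mol τ w ^ 3 = 3 * (1 / mol τ w ^ 3) := by ring
  have h7 : 4 / τ ^ 3 = 4 * (1 / τ ^ 3) := by ring
  have h8 : 0 ≤ 3 * w i ^ 2 / mol τ w ^ 5 := by positivity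
  have h9 : 0 ≤ 1 / mol τ w ^ 3 := by positivity
  rw [abs_le]
  constructor <;> linarith

lemma hasDerivAt_setIntegral {S : Set E3} {f : E3 → ℝ} (hf : IntegrableOn f S)
    {k k' : ℝ → E3 → ℝ} (hk : ∀ t y, HasDerivAt (fun t => k t y) (k' t y) t)
    (hkc : ∀ t, Continuous (k t)) (hkc' : ∀ t, Continuous (k' t)) {C C' : ℝ}
    (hb : ∀ t y, |k t y| ≤ C) (hb' : ∀ t y, |k' t y| ≤ C') (t : ℝ) :
    HasDerivAt (fun t => ∫ y in S, f y * k t y) (∫ y in S, f y * k' t y) t := by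
  refine (hasDerivAt_integral_of_dominated_loc_of_deriv_le (μ := volume.restrict S)
    (F := fun t y => f y * k t y) (F' := fun t y => f y * k' t y) (bound := fun y => |f y| * C')
    (s := univ) univ_mem ?_ ?_ ?_ ?_ ?_ ?_).2
  · exact .of_forall fun s => hf.aestronglyMeasurable.mul (hkc s).aestronglyMeasurable
  · exact hf.mul_bdd (c := C) (hkc t).aestronglyMeasurable (.of_forall fun y => hb t y)
  · exact hf.aestronglyMeasurable.mul (hkc' t).aestronglyMeasurable
  · refine .of_forall fun y s _ => ?_
    rw [Real.norm_eq_abs, abs_mul]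
    gcongr
    exact hb' s y
  · exact hf.abs.mul_const C'
  · exact .of_forall fun y s _ => (hk s y).const_mul _

/-- The regularised Newtonian potential of the density `f` on `S`, transported by `σ`. -/
def pot (S : Set E3) (f : E3 → ℝ) (σ : E3 → E3) (τ : ℝ) (z : E3) : ℝ :=
  ∫ y in S, f y * (1 / mol τ (z - σ y))

section pot
variable {S : Set E3} {f : E3 → ℝ} {σ : E3 → E3} {τ : ℝ}

lemma continuous_inv_mol_pow (hτ : 0 < τ) (n : ℕ) : Continuous fun w => 1 / mol τ w ^ n :=
  continuous_const.div ((continuous_mol τ).pow n) fun w => (pow_pos (mol_pos hτ w) n).ne'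

lemma hasDerivAt_pot_line (hf : IntegrableOn f S) (hσ : Continuous σ) (hτ : 0 < τ) (z : E3)
    (i : Fin 3) (t : ℝ) : HasDerivAt (fun t : ℝ => pot S f σ τ (z + t • eb i))
      (∫ y in S, f y * (-((z + t • eb i - σ y) i / mol τ (z + t • eb i - σ y) ^ 3))) t := by
  refine hasDerivAt_setIntegral hf (fun t y => hasDerivAt_inv_mol_line hτ (σ y) z i t) ?_ ?_
    (C := 1 / τ) (C' := 1 / τ ^ 2) ?_ (fun t y => abs_mol_deriv_le hτ _ i) t
  · intro t
    have := (continuous_inv_mol_pow hτ 1).comp (g := fun y => 1 / mol τ y ^ 1)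
      (f := fun y => z + t • eb i - σ y) (by fun_prop)
    simpa [Function.comp_def] using this
  · intro t
    have := (continuous_inv_mol_pow hτ 3).comp (g := fun y => 1 / mol τ y ^ 3)
      (f := fun y => z + t • eb i - σ y) (by fun_prop)
    have h2 : Continuous fun y => (z + t • eb i - σ y) i := by fun_prop
    exact (h2.mul this).neg.congr fun y => by simp [div_eq_mul_inv]
  · intro t y
    have h0 := mol_pos hτ (z + t • eb i - σ y)
    rw [abs_of_pos (by positivity)]
    gcongr
    exact le_mol _

lemma hasLap_pot (hf : IntegrableOn f S) (hσ : Continuous σ) (hτ : 0 < τ) (z : E3) :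
    HasLap (pot S f σ τ) z (∫ y in S, f y * -(3 * τ ^ 2 / mol τ (z - σ y) ^ 5)) := by
  have key : ∀ (i : Fin 3) (t : ℝ), Continuous fun y =>
      3 * (z + t • eb i - σ y) i ^ 2 / mol τ (z + t • eb i - σ y) ^ 5
        - 1 / mol τ (z + t • eb i - σ y) ^ 3 := by
    intro i t
    have h3 := (continuous_inv_mol_pow hτ 3).comp (g := fun y => 1 / mol τ y ^ 3)
      (f := fun y => z + t • eb i - σ y) (by fun_prop)
    have h5 := (continuous_inv_mol_pow hτ 5).comp (g := fun y => 1 / mol τ y ^ 5)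
      (f := fun y => z + t • eb i - σ y) (by fun_prop)
    have h2 : Continuous fun y => 3 * (z + t • eb i - σ y) i ^ 2 := by fun_prop
    exact ((h2.mul h5).sub h3).congr fun y => by simp [div_eq_mul_inv]
  refine ⟨_, _, fun i => .of_forall fun t => hasDerivAt_pot_line hf hσ hτ z i t, fun i =>
    hasDerivAt_setIntegral hf (fun t y => hasDerivAt_inv_mol_line₂ hτ (σ y) z i t) ?_ (key i)
    (C := 1 / τ ^ 2) (C' := 4 / τ ^ 3) (fun t y => abs_mol_deriv_le hτ _ i)
    (fun t y => abs_mol_deriv₂_le hτ _ i) 0, ?_⟩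
  · intro t
    have := (continuous_inv_mol_pow hτ 3).comp (g := fun y => 1 / mol τ y ^ 3)
      (f := fun y => z + t • eb i - σ y) (by fun_prop)
    have h2 : Continuous fun y => (z + t • eb i - σ y) i := by fun_prop
    exact (h2.mul this).neg.congr fun y => by simp [div_eq_mul_inv]
  · rw [← integral_finsetSum]
    · refine integral_congr_ae (.of_forall fun y => ?_)
      have h0 := mol_pos hτ (z - σ y)
      have h1 := mol_sq τ (z - σ y)
      rw [norm_sq_eq] at h1
      simp only [zero_smul, add_zero, Fin.sum_univ_three]
      have : 3 * τ ^ 2 = 3 * mol τ (z - σ y) ^ 2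
        - 3 * ((z - σ y) 0 ^ 2 + (z - σ y) 1 ^ 2 + (z - σ y) 2 ^ 2) := by rw [h1]; ring
      rw [this]
      field_simp
      ring
    · intro i _
      exact hf.mul_bdd (c := 4 / τ ^ 3) (key i 0).aestronglyMeasurable
        (.of_forall fun y => abs_mol_deriv₂_le hτ _ i)

lemma integrableOn_mul_inv_mol (hf : IntegrableOn f S) (hσ : Continuous σ) (hτ : 0 < τ) (z : E3)
    (n : ℕ) : IntegrableOn (fun y => f y * (1 / mol τ (z - σ y) ^ n)) S := by
  have := (continuous_inv_mol_pow hτ n).comp (g := fun y => 1 / mol τ y ^ n)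
      (f := fun y => z - σ y) (by fun_prop)
  refine hf.mul_bdd (c := 1 / τ ^ n) this.aestronglyMeasurable (.of_forall fun y => ?_)
  have h0 := mol_pos hτ (z - σ y)
  rw [Real.norm_of_nonneg (by positivity)]
  gcongr
  exact le_mol _

lemma continuous_pot (hf : IntegrableOn f S) (hσ : Continuous σ) (hτ : 0 < τ) :
    Continuous (pot S f σ τ) := by
  refine continuous_of_dominated (bound := fun y => |f y| * (1 / τ)) (fun z => ?_) (fun z => ?_)
    (hf.abs.mul_const _) (.of_forall fun y => ?_)
  · simpa using (integrableOn_mul_inv_mol hf hσ hτ z 1).aestronglyMeasurable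
  · refine .of_forall fun y => ?_
    have h0 := mol_pos hτ (z - σ y)
    rw [Real.norm_eq_abs, abs_mul, abs_of_pos (a := 1 / mol τ (z - σ y)) (by positivity)]
    gcongr
    exact le_mol _
  · have := (continuous_inv_mol_pow hτ 1).comp (g := fun y => 1 / mol τ y ^ 1)
      (f := fun z => z - σ y) (by fun_prop)
    exact continuous_const.mul (by simpa [Function.comp_def] using this)

end pot

/-- The area of the unit sphere, normalised through the volume of the unit ball. -/
def area : ℝ := 3 * volume.real (ball (0 : E3) 1)

lemma area_nonneg : 0 ≤ area := by unfold area; positivity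

lemma integral_radial (g : ℝ → ℝ) :
    ∫ w : E3, g ‖w‖ = area * ∫ s in Ioi (0 : ℝ), s ^ 2 * g s := by
  rw [integral_fun_norm_addHaar, area]
  simp [finrank_euclideanSpace, mul_assoc]

lemma integrable_radial (g : ℝ → ℝ) :
    Integrable (fun w : E3 => g ‖w‖) ↔ IntegrableOn (fun s => s ^ 2 * g s) (Ioi 0) := by
  rw [integrable_fun_norm_addHaar]
  simp [finrank_euclideanSpace]

lemma hasDerivAt_poisson {τ : ℝ} (hτ : 0 < τ) (s : ℝ) :
    HasDerivAt (fun s => s ^ 3 / √(s ^ 2 + τ ^ 2) ^ 3)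
      (s ^ 2 * (3 * τ ^ 2 / √(s ^ 2 + τ ^ 2) ^ 5)) s := by
  have hq : 0 < s ^ 2 + τ ^ 2 := by positivity
  have hr : 0 < √(s ^ 2 + τ ^ 2) := Real.sqrt_pos.2 hq
  have h1 : HasDerivAt (fun s => √(s ^ 2 + τ ^ 2)) (2 * s / (2 * √(s ^ 2 + τ ^ 2))) s := by
    have := ((hasDerivAt_pow 2 s).add_const (τ ^ 2)).sqrt hq.ne'
    simpa using this
  refine ((hasDerivAt_pow 3 s).div (h1.pow 3) (pow_pos hr 3).ne').congr_deriv ?_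
  simp only [Pi.pow_apply]
  have h2 : √(s ^ 2 + τ ^ 2) ^ 2 = s ^ 2 + τ ^ 2 := Real.sq_sqrt hq.le
  have h3 : τ ^ 2 = √(s ^ 2 + τ ^ 2) ^ 2 - s ^ 2 := by rw [h2]; ring
  generalize √(s ^ 2 + τ ^ 2) = r at hr h3
  rw [h3]
  field_simp
  norm_num
  ring

lemma tendsto_poisson {τ : ℝ} (hτ : 0 < τ) :
    Tendsto (fun s => s ^ 3 / √(s ^ 2 + τ ^ 2) ^ 3) atTop (𝓝 1) := by
  have h1 : Tendsto (fun s : ℝ => 1 / √(1 + τ ^ 2 * (s⁻¹) ^ 2) ^ 3) atTop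
      (𝓝 (1 / √(1 + τ ^ 2 * 0 ^ 2) ^ 3)) := by
    refine Tendsto.div tendsto_const_nhds (((Real.continuous_sqrt.tendsto _).comp
      ((((tendsto_inv_atTop_zero (𝕜 := ℝ)).pow 2).const_mul _).const_add _)).pow 3) (by simp)
  simp only [ne_eq, OfNat.ofNat_ne_zero, not_false_eq_true, zero_pow, mul_zero, add_zero,
    Real.sqrt_one, one_pow, div_one] at h1
  refine h1.congr' ?_
  filter_upwards [eventually_gt_atTop 0] with s hs
  have : s ^ 2 + τ ^ 2 = s ^ 2 * (1 + τ ^ 2 * (s⁻¹) ^ 2) := by field_simp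
  rw [this, Real.sqrt_mul (by positivity), Real.sqrt_sq hs.le]
  have : 0 < √(1 + τ ^ 2 * (s⁻¹) ^ 2) := Real.sqrt_pos.2 (by positivity)
  field_simp

lemma poisson_integrable {τ : ℝ} (hτ : 0 < τ) (z : E3) :
    Integrable (fun y => 3 * τ ^ 2 / mol τ (z - y) ^ 5) := by
  have := (integrable_radial (fun s => 3 * τ ^ 2 / √(s ^ 2 + τ ^ 2) ^ 5)).2
    (integrableOn_Ioi_deriv_of_nonneg' (fun s _ => hasDerivAt_poisson hτ s)
      (fun s _ => by positivity) (tendsto_poisson hτ))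
  exact this.comp_sub_left z

lemma poisson_integral {τ : ℝ} (hτ : 0 < τ) (z : E3) :
    ∫ y, 3 * τ ^ 2 / mol τ (z - y) ^ 5 = area := by
  rw [integral_sub_left_eq_self (fun y => 3 * τ ^ 2 / mol τ y ^ 5)]
  refine (integral_radial (fun s => 3 * τ ^ 2 / √(s ^ 2 + τ ^ 2) ^ 5)).trans ?_
  rw [integral_Ioi_of_hasDerivAt_of_nonneg' (fun s _ => hasDerivAt_poisson hτ s)
      (fun s _ => by positivity) (tendsto_poisson hτ)]
  simp

/-- The kernel `1 / √(|w|² + τ²)` cut off at distance `a`. -/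
def cutInv (a τ s : ℝ) : ℝ := (Iio a).indicator (fun s => 1 / √(s ^ 2 + τ ^ 2)) s

lemma cutInv_nonneg (a τ s : ℝ) : 0 ≤ cutInv a τ s :=
  indicator_nonneg (fun _ _ => by positivity) _

lemma cutInv_bound {a τ s : ℝ} (hs : 0 < s) : s ^ 2 * cutInv a τ s ≤ (Iio a).indicator id s := by
  by_cases h : s < a
  · rw [cutInv, indicator_of_mem (show s ∈ Iio a from h), indicator_of_mem (show s ∈ Iio a from h)]
    have : s ≤ √(s ^ 2 + τ ^ 2) := Real.le_sqrt_of_sq_le (by nlinarith [sq_nonneg τ])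
    rw [mul_one_div, div_le_iff₀ (by linarith), id]
    nlinarith
  · rw [cutInv, indicator_of_notMem (show s ∉ Iio a from h),
      indicator_of_notMem (show s ∉ Iio a from h), mul_zero]

lemma indicator_integrable (a : ℝ) : IntegrableOn ((Iio a).indicator (id : ℝ → ℝ)) (Ioi 0) := by
  rw [IntegrableOn, integrable_indicator_iff measurableSet_Iio, IntegrableOn,
    Measure.restrict_restrict measurableSet_Iio, Iio_inter_Ioi]
  exact (continuous_id.integrableOn_Icc (a := 0) (b := a)).mono_set Ioo_subset_Icc_self

lemma cutInv_integrableOn (a τ : ℝ) :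
    IntegrableOn (fun s => s ^ 2 * cutInv a τ s) (Ioi 0) := by
  refine (indicator_integrable a).mono' ?_ ?_
  · have h1 : Measurable (cutInv a τ) := by
      refine Measurable.indicator ?_ measurableSet_Iio
      fun_prop
    exact ((measurable_id.pow_const 2).mul h1).aestronglyMeasurable
  · filter_upwards [ae_restrict_mem measurableSet_Ioi] with s hs
    rw [Real.norm_of_nonneg (mul_nonneg (sq_nonneg s) (cutInv_nonneg a τ s))]
    exact cutInv_bound hs

lemma cutInv_integrable (a τ : ℝ) (z : E3) :
    Integrable (fun y : E3 => cutInv a τ ‖z - y‖) :=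
  ((integrable_radial _).2 (cutInv_integrableOn a τ)).comp_sub_left z

lemma cutInv_integral {a : ℝ} (τ : ℝ) (ha : 0 ≤ a) (z : E3) :
    ∫ y : E3, cutInv a τ ‖z - y‖ ≤ area * (a ^ 2 / 2) := by
  rw [integral_sub_left_eq_self (fun y : E3 => cutInv a τ ‖y‖), integral_radial]
  refine mul_le_mul_of_nonneg_left ?_ area_nonneg
  calc ∫ s in Ioi 0, s ^ 2 * cutInv a τ s ≤ ∫ s in Ioi 0, (Iio a).indicator id s :=
        setIntegral_mono_on (cutInv_integrableOn a τ) (indicator_integrable a) measurableSet_Ioi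
          fun s hs => cutInv_bound hs
    _ = ∫ s in (0 : ℝ)..a, s := by
        rw [setIntegral_indicator measurableSet_Iio, Ioi_inter_Iio,
          intervalIntegral.integral_of_le ha, integral_Ioc_eq_integral_Ioo]
        rfl
    _ = a ^ 2 / 2 := by simp

lemma inv_mol_le_split {f F s t d a h θ b : ℝ} (hf : 0 ≤ f) (hfF : f ≤ F) (ha : 0 < a) (hh : 0 < h)
    (hθ : 0 < θ) (hs : 0 < s) (ht : 0 < t) (hds : d ≤ s) (htd : t ≤ d + 2 * h) (hb : 0 ≤ b)
    (hb' : d < a → b = 1 / s) :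
    f * (1 / s) ≤ (27 * θ ^ 2 + 27 * h ^ 3 / a) * (f * (1 / t ^ 3)) + f * (1 / θ) + F * b := by
  have hF : 0 ≤ F := hf.trans hfF
  have e1 : 0 ≤ 27 * θ ^ 2 * (f * (1 / t ^ 3)) := by positivity
  have e2 : 0 ≤ 27 * h ^ 3 / a * (f * (1 / t ^ 3)) := by positivity
  have e3 : 0 ≤ f * (1 / θ) := by positivity
  have e4 : 0 ≤ F * b := by positivity
  rw [add_mul]
  rcases lt_or_ge d a with h1 | h1
  · have : f * (1 / s) ≤ F * b := by rw [hb' h1]; gcongr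
    linarith
  rcases le_or_gt θ s with h2 | h2
  · have : f * (1 / s) ≤ f * (1 / θ) := by gcongr
    linarith
  rcases le_or_gt h d with h3 | h3
  · have h4 : t ^ 3 ≤ (3 * s) ^ 3 := by gcongr; linarith
    have : f * (1 / s) ≤ 27 * θ ^ 2 * (f * (1 / t ^ 3)) := by
      calc f * (1 / s) = 27 * s ^ 2 * (f * (1 / (3 * s) ^ 3)) := by field_simp; norm_num
        _ ≤ 27 * θ ^ 2 * (f * (1 / t ^ 3)) := by gcongr
    linarith
  · have h4 : t ^ 3 ≤ (3 * h) ^ 3 := by gcongr; linarith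
    have : f * (1 / s) ≤ 27 * h ^ 3 / a * (f * (1 / t ^ 3)) := by
      calc f * (1 / s) ≤ f * (1 / a) := by gcongr; linarith
        _ = 27 * h ^ 3 / a * (f * (1 / (3 * h) ^ 3)) := by field_simp; norm_num
        _ ≤ 27 * h ^ 3 / a * (f * (1 / t ^ 3)) := by gcongr
    linarith

/-- A potential of a bounded density is controlled by its reflected normal derivative. -/
lemma pot_lt {S : Set E3} (hS : MeasurableSet S) {f : E3 → ℝ} {σ : E3 → E3} {τ h F κ w : ℝ} {z : E3}
    (hf : IntegrableOn f S) (hσ : Continuous σ) (hτ : 0 < τ) (hτh : τ ≤ h)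
    (hf0 : ∀ y ∈ S, 0 ≤ f y) (hfF : ∀ y ∈ S, f y ≤ F) (h1 : ∀ y ∈ S, ‖z - σ y‖ ≤ ‖z - y‖ + h)
    (h2 : ∀ y ∈ S, h ≤ ‖z - σ y‖)
    (hY : 0 < ∫ y in S, f y * (1 / mol τ (z - σ y) ^ 3)) (hw : 0 < w)
    (hwY : 2048 * (∫ y in S, f y) ^ 2 * (∫ y in S, f y * (1 / mol τ (z - σ y) ^ 3)) ≤ w ^ 3)
    (hF0 : 0 ≤ F) (hF : F * h ^ 3 ≤ κ * ∫ y in S, f y) (hκ : area * κ ≤ 1 / 50) :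
    pot S f id τ z < w := by
  have hh : 0 < h := by linarith
  have hYi := integrableOn_mul_inv_mol hf hσ hτ z 3
  have hIi := integrableOn_mul_inv_mol hf continuous_id hτ z 1
  have hYμ : h ^ 3 * (∫ y in S, f y * (1 / mol τ (z - σ y) ^ 3)) ≤ ∫ y in S, f y := by
    rw [← integral_const_mul]
    refine setIntegral_mono_on (hYi.const_mul _) hf hS fun y hy => ?_
    have h3 := mol_pos hτ (z - σ y)
    have h4 : h ≤ mol τ (z - σ y) := (h2 y hy).trans (norm_le_mol _ _)
    have h5 := hf0 y hy
    calc h ^ 3 * (f y * (1 / mol τ (z - σ y) ^ 3))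
        ≤ mol τ (z - σ y) ^ 3 * (f y * (1 / mol τ (z - σ y) ^ 3)) := by gcongr
      _ = f y := by field_simp
  obtain ⟨Y, hYd⟩ : ∃ Y, Y = ∫ y in S, f y * (1 / mol τ (z - σ y) ^ 3) := ⟨_, rfl⟩
  obtain ⟨μ, hμd⟩ : ∃ μ, μ = ∫ y in S, f y := ⟨_, rfl⟩
  rw [← hYd] at hY hwY hYμ
  rw [← hμd] at hwY hYμ hF
  have hμ0 : 0 < μ := by
    have : 0 < h ^ 3 * Y := by positivity
    linarith
  obtain ⟨θ, hθ⟩ : ∃ θ, θ = 4 * μ / w := ⟨_, rfl⟩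
  obtain ⟨a, ha⟩ : ∃ a, a = 108 * h ^ 3 * Y / w := ⟨_, rfl⟩
  have hθ0 : 0 < θ := by rw [hθ]; positivity
  have ha0 : 0 < a := by rw [ha]; positivity
  have hcut := cutInv_integrable a τ z
  have hsum : IntegrableOn (fun y => (27 * θ ^ 2 + 27 * h ^ 3 / a)
      * (f y * (1 / mol τ (z - σ y) ^ 3)) + f y * (1 / θ)) S :=
    (hYi.const_mul _).add (hf.mul_const _)
  have key : pot S f id τ z ≤ (27 * θ ^ 2 + 27 * h ^ 3 / a) * Y + μ * (1 / θ)
      + F * (area * (a ^ 2 / 2)) := by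
    calc pot S f id τ z ≤ ∫ y in S, ((27 * θ ^ 2 + 27 * h ^ 3 / a)
            * (f y * (1 / mol τ (z - σ y) ^ 3)) + f y * (1 / θ) + F * cutInv a τ ‖z - y‖) := by
          refine setIntegral_mono_on (by simpa using hIi)
            (hsum.add (hcut.integrableOn.const_mul F)) hS fun y hy => ?_
          refine inv_mol_le_split (hf0 y hy) (hfF y hy) ha0 hh hθ0 (mol_pos hτ _) (mol_pos hτ _)
            (norm_le_mol τ (z - y)) ?_ (cutInv_nonneg _ _ _) ?_
          · have := mol_le hτ.le (z - σ y)
            linarith [h1 y hy]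
          · intro h3
            rw [cutInv, indicator_of_mem (show ‖z - y‖ ∈ Iio a from h3)]
            rfl
      _ = (27 * θ ^ 2 + 27 * h ^ 3 / a) * Y + μ * (1 / θ)
            + F * ∫ y in S, cutInv a τ ‖z - y‖ := by
          rw [integral_add hsum (hcut.integrableOn.const_mul F), integral_add (hYi.const_mul _) (hf.mul_const _),
            integral_const_mul, integral_mul_const, integral_const_mul, hYd, hμd]
      _ ≤ _ := by
          gcongr
          exact (setIntegral_le_integral hcut (.of_forall fun y => cutInv_nonneg _ _ _)).trans
            (cutInv_integral τ ha0.le z)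
  have t1 : 27 * θ ^ 2 * Y ≤ w / 4 := by
    rw [hθ]
    have : 27 * (4 * μ / w) ^ 2 * Y = 432 * μ ^ 2 * Y / w ^ 2 := by field_simp; norm_num
    rw [this, div_le_iff₀ (by positivity)]
    have : 0 ≤ μ ^ 2 * Y := by positivity
    linarith
  have t2 : 27 * h ^ 3 / a * Y = w / 4 := by
    rw [ha]; field_simp; norm_num
  have t3 : μ * (1 / θ) = w / 4 := by rw [hθ]; field_simp
  have t4 : F * (area * (a ^ 2 / 2)) < w / 4 := by
    have e : F * (area * (a ^ 2 / 2)) = area * (5832 * (F * h ^ 3) * (h ^ 3 * Y) * Y) / w ^ 2 := by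
      rw [ha]; field_simp; ring
    rw [e, div_lt_iff₀ (by positivity)]
    have harea := area_nonneg
    have hκμ : 0 ≤ κ * μ := le_trans (by positivity) hF
    calc area * (5832 * (F * h ^ 3) * (h ^ 3 * Y) * Y) ≤ area * (5832 * (κ * μ) * μ * Y) := by
          gcongr
      _ = (area * κ) * (5832 * (μ ^ 2 * Y)) := by ring
      _ ≤ 1 / 50 * (5832 * (μ ^ 2 * Y)) := by gcongr
      _ < w / 4 * w ^ 2 := by
          have : 0 < μ ^ 2 * Y := by positivity
          have : w / 4 * w ^ 2 = w ^ 3 / 4 := by ring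
          linarith
  have : (27 * θ ^ 2 + 27 * h ^ 3 / a) * Y = 27 * θ ^ 2 * Y + 27 * h ^ 3 / a * Y := by ring
  linarith

/-- Reflection across the plane at height `-h / 2`. -/
def flip (h : ℝ) (y : E3) : E3 := y - (2 * y 2 + h) • eb 2

lemma continuous_flip (h : ℝ) : Continuous (flip h) := by unfold flip; fun_prop

lemma sub_flip (h : ℝ) (z y : E3) : z - flip h y = (z - y) + (2 * y 2 + h) • eb 2 := by
  unfold flip; abel

lemma sub_flip_two (h : ℝ) (z y : E3) : (z - flip h y) 2 = z 2 + y 2 + h := by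
  rw [sub_flip]; simp; ring

lemma norm_sub_flip_sq (h : ℝ) (z y : E3) :
    ‖z - flip h y‖ ^ 2 = ‖z - y‖ ^ 2 + (2 * z 2 + h) * (2 * y 2 + h) := by
  rw [norm_sq_eq, norm_sq_eq, sub_flip_two, sub_flip]
  simp
  ring

lemma norm_le_norm_sub_flip {h : ℝ} (hh : 0 ≤ h) {z y : E3} (hz : 0 ≤ z 2) (hy : 0 ≤ y 2) :
    ‖z - y‖ ≤ ‖z - flip h y‖ := by
  refine le_of_sq_le_sq ?_ (norm_nonneg _)
  rw [norm_sub_flip_sq]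
  have : 0 ≤ (2 * z 2 + h) * (2 * y 2 + h) := by positivity
  linarith

lemma norm_sub_flip_le {h : ℝ} (hh : 0 ≤ h) {z y : E3} (hz : z 2 = 0) (hy : 0 ≤ y 2) :
    ‖z - flip h y‖ ≤ ‖z - y‖ + h := by
  refine le_of_sq_le_sq ?_ (by positivity)
  rw [norm_sub_flip_sq, hz]
  have h1 := abs_coord_le (z - y) 2
  have h2 : (z - y) 2 = -y 2 := by simp [hz]
  rw [h2, abs_neg, abs_of_nonneg hy] at h1
  nlinarith

lemma le_norm_sub_flip {h : ℝ} {z y : E3} (hz : 0 ≤ z 2) (hy : 0 ≤ y 2) :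
    h ≤ ‖z - flip h y‖ := by
  have := coord_le (z - flip h y) 2
  rw [sub_flip_two] at this
  linarith

lemma pot_nonneg {S : Set E3} (hS : MeasurableSet S) {f : E3 → ℝ} (σ : E3 → E3) {τ : ℝ}
    (hf0 : ∀ y ∈ S, 0 ≤ f y) (z : E3) : 0 ≤ pot S f σ τ z :=
  setIntegral_nonneg hS fun y hy => by
    have := hf0 y hy
    have : 0 ≤ mol τ (z - σ y) := Real.sqrt_nonneg _
    positivity

/-- The Poisson regularisation of a density dominated by `u⁵` stays below `u⁵`. -/
lemma poisson_lt {D S : Set E3} (hD : IsCompact D) (hS : MeasurableSet S) (hSD : S ⊆ D)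
    {u : E3 → ℝ} (hu : ContinuousOn u D) (hu0 : ∀ z ∈ D, 0 < u z) {Λ δ : ℝ} (hΛ : 0 < Λ)
    (hδ : 0 < δ) (hδΛ : δ * (8 * area * Λ) ≤ 1) : ∃ τ₀ > 0, ∀ τ, 0 < τ → τ ≤ τ₀ → ∀ z ∈ D,
    ∫ y in S, δ * u y ^ 5 * (3 * τ ^ 2 / mol τ (z - y) ^ 5) < Λ⁻¹ * u z ^ 5 := by
  rcases D.eq_empty_or_nonempty with rfl | hne
  · exact ⟨1, one_pos, fun τ _ _ z hz => absurd hz (notMem_empty z)⟩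
  have hu5 : ContinuousOn (fun z => u z ^ 5) D := hu.pow 5
  obtain ⟨w, hw, hmin⟩ := hD.exists_isMinOn hne hu5
  have hm : 0 < u w ^ 5 := pow_pos (hu0 w hw) 5
  obtain ⟨η, hη, huc⟩ := Metric.uniformContinuousOn_iff.1
    (hD.uniformContinuousOn_of_continuous hu5) _ hm
  have hfi : IntegrableOn (fun y => δ * u y ^ 5) S :=
    ((continuousOn_const.mul hu5).integrableOn_compact hD).mono_set hSD
  obtain ⟨μ, hμ⟩ : ∃ μ, μ = ∫ y in S, δ * u y ^ 5 := ⟨_, rfl⟩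
  have hμ0 : 0 ≤ μ := by
    rw [hμ]
    exact setIntegral_nonneg hS fun y hy => by have := hu0 y (hSD hy); positivity
  refine ⟨min 1 (u w ^ 5 * η ^ 5 / (12 * Λ * (μ + 1))), by positivity, ?_⟩
  intro τ hτ hττ z hz
  have hτ1 : τ ≤ 1 := hττ.trans (min_le_left _ _)
  have hτ2 : τ * (12 * Λ * (μ + 1)) ≤ u w ^ 5 * η ^ 5 :=
    (le_div_iff₀ (by positivity)).1 (hττ.trans (min_le_right _ _))
  have hPi := poisson_integrable hτ z
  have hz5 : u w ^ 5 ≤ u z ^ 5 := hmin hz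
  have hpt : ∀ y ∈ S, δ * u y ^ 5 * (3 * τ ^ 2 / mol τ (z - y) ^ 5)
      ≤ 2 * δ * u z ^ 5 * (3 * τ ^ 2 / mol τ (z - y) ^ 5) + δ * u y ^ 5 * (3 * τ ^ 2 / η ^ 5) := by
    intro y hy
    have h0 := mol_pos hτ (z - y)
    have h1 := hu0 y (hSD hy)
    have h2 := hu0 z hz
    rcases lt_or_ge (dist y z) η with h | h
    · have h3 := huc y (hSD hy) z hz h
      rw [Real.dist_eq] at h3
      have h4 := (le_abs_self _).trans_lt h3
      have h5 : δ * u y ^ 5 * (3 * τ ^ 2 / mol τ (z - y) ^ 5)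
          ≤ δ * (2 * u z ^ 5) * (3 * τ ^ 2 / mol τ (z - y) ^ 5) := by
        gcongr; linarith
      have h6 : 0 ≤ δ * u y ^ 5 * (3 * τ ^ 2 / η ^ 5) := by positivity
      linarith
    · have h3 : η ≤ mol τ (z - y) := by
        rw [dist_comm, dist_eq_norm] at h
        exact h.trans (norm_le_mol _ _)
      have h5 : δ * u y ^ 5 * (3 * τ ^ 2 / mol τ (z - y) ^ 5)
          ≤ δ * u y ^ 5 * (3 * τ ^ 2 / η ^ 5) := by gcongr
      have h6 : 0 ≤ 2 * δ * u z ^ 5 * (3 * τ ^ 2 / mol τ (z - y) ^ 5) := by positivity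
      linarith
  have hz0 := hu0 z hz
  have hL : IntegrableOn (fun y => δ * u y ^ 5 * (3 * τ ^ 2 / mol τ (z - y) ^ 5)) S := by
    have := (integrableOn_mul_inv_mol hfi continuous_id hτ z 5).const_mul (3 * τ ^ 2)
    refine this.congr (.of_forall fun y => ?_)
    simp only [id]
    ring
  have hsum : IntegrableOn (fun y => 2 * δ * u z ^ 5 * (3 * τ ^ 2 / mol τ (z - y) ^ 5)
      + δ * u y ^ 5 * (3 * τ ^ 2 / η ^ 5)) S :=
    (hPi.integrableOn.const_mul _).add (hfi.mul_const _)
  calc ∫ y in S, δ * u y ^ 5 * (3 * τ ^ 2 / mol τ (z - y) ^ 5)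
      ≤ ∫ y in S, (2 * δ * u z ^ 5 * (3 * τ ^ 2 / mol τ (z - y) ^ 5)
          + δ * u y ^ 5 * (3 * τ ^ 2 / η ^ 5)) :=
        setIntegral_mono_on hL hsum hS hpt
    _ = 2 * δ * u z ^ 5 * (∫ y in S, 3 * τ ^ 2 / mol τ (z - y) ^ 5) + μ * (3 * τ ^ 2 / η ^ 5) := by
        rw [integral_add (hPi.integrableOn.const_mul _) (hfi.mul_const _), integral_const_mul,
          integral_mul_const, hμ]
    _ ≤ 2 * δ * u z ^ 5 * area + (μ + 1) * (3 * τ / η ^ 5) := by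
        gcongr ?_ * ?_ + ?_ * (3 * ?_ / _)
        · rw [← poisson_integral hτ z]
          refine setIntegral_le_integral hPi (.of_forall fun y => ?_)
          have h0 := mol_pos hτ (z - y)
          show 0 ≤ 3 * τ ^ 2 / mol τ (z - y) ^ 5
          positivity
        · linarith
        · nlinarith
    _ ≤ Λ⁻¹ * u z ^ 5 / 4 + Λ⁻¹ * u z ^ 5 / 4 := by
        gcongr ?_ + ?_
        · have : 2 * δ * u z ^ 5 * area = δ * (8 * area * Λ) * (Λ⁻¹ * u z ^ 5 / 4) := by
            field_simp; ring
          rw [this]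
          exact mul_le_of_le_one_left (by positivity) hδΛ
        · have : (μ + 1) * (3 * τ / η ^ 5) = τ * (12 * Λ * (μ + 1)) * (Λ⁻¹ / (4 * η ^ 5)) := by
            field_simp; norm_num
          rw [this]
          calc _ ≤ u z ^ 5 * η ^ 5 * (Λ⁻¹ / (4 * η ^ 5)) := by
                gcongr ?_ * _
                exact hτ2.trans (by gcongr)
            _ = _ := by field_simp
    _ < Λ⁻¹ * u z ^ 5 := by
        have : 0 < Λ⁻¹ * u z ^ 5 := by positivity
        linarith

/-- Lower bound of a solution by the potential of its own nonlinearity. -/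
lemma Sol.pot_le {Λ ε ρ : ℝ} {u K c : E3 → ℝ} (hu : Sol Λ ε ρ u K c) (hΛ : 1 ≤ Λ) {x : E3}
    {S D : Set E3}
    (hS : S = closedBall x (1 / 64) ∩ up) (hD : D = closedBall x 1 ∩ up) (hDB : D ⊆ hB ρ)
    {δ κ F h : ℝ} (hδ : 0 < δ) (hδΛ : δ * (8 * area * Λ) ≤ 1) (hF : ∀ y ∈ S, δ * u y ^ 5 ≤ F)
    (hF0 : 0 ≤ F) (hμ : 0 < ∫ y in S, δ * u y ^ 5)
    (hh : h = 4096 * Λ * (∫ y in S, δ * u y ^ 5) ^ 2)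
    (hκ : area * κ ≤ 1 / 50) (hFκ : F * h ^ 3 ≤ κ * ∫ y in S, δ * u y ^ 5) :
    ∃ τ₀ > 0, ∀ τ, 0 < τ → τ ≤ τ₀ → ∀ z ∈ D,
      pot S (fun y => δ * u y ^ 5) id τ z - 1 / 2 * pot S (fun y => δ * u y ^ 5) (flip h) τ z
        - 2 * (∫ y in S, δ * u y ^ 5) ≤ u z := by
  have hDc : IsCompact D := hD ▸ isCompact_half_ball x 1
  have hSm : MeasurableSet S := hS ▸ (isCompact_half_ball x _).isClosed.measurableSet
  have hSD : S ⊆ D := by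
    rw [hS, hD]
    exact inter_subset_inter_left _ (closedBall_subset_closedBall (by norm_num))
  have hSup : ∀ y ∈ S, 0 ≤ y 2 := fun y hy => by rw [hS] at hy; exact hy.2
  have hDup : ∀ y ∈ D, 0 ≤ y 2 := fun y hy => by rw [hD] at hy; exact hy.2
  have hu0 : ∀ z ∈ D, 0 < u z := fun z hz => hu.pos z (hDB hz)
  have huc : ContinuousOn u D := hu.cont.mono hDB
  have hΛ0 : 0 < Λ := by linarith
  have hh0 : 0 < h := by rw [hh]; positivity
  obtain ⟨τ₁, hτ₁, hpo⟩ := poisson_lt hDc hSm hSD huc hu0 hΛ0 hδ hδΛ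
  refine ⟨min τ₁ h, by positivity, ?_⟩
  intro τ hτ hττ
  have hτh : τ ≤ h := hττ.trans (min_le_right _ _)
  replace hpo := hpo τ hτ (hττ.trans (min_le_left _ _))
  obtain ⟨f, hf⟩ : ∃ f : E3 → ℝ, f = fun y => δ * u y ^ 5 := ⟨_, rfl⟩
  have hfi : IntegrableOn f S := by
    rw [hf]
    exact ((continuousOn_const.mul (huc.pow 5)).integrableOn_compact hDc).mono_set hSD
  have hf0 : ∀ y ∈ S, 0 ≤ f y := fun y hy => by
    have := hu0 y (hSD hy)
    rw [hf]; positivity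
  obtain ⟨μ, hμd⟩ : ∃ μ, μ = ∫ y in S, f y := ⟨_, rfl⟩
  have hμf : ∫ y in S, δ * u y ^ 5 = μ := by rw [hμd, hf]
  rw [hμf] at hμ hh hFκ
  rw [hμf, ← hf]
  have hfσ := continuous_flip h
  have hcont : ContinuousOn (fun z => u z - (pot S f id τ z - 1 / 2 * pot S f (flip h) τ z) + 2 * μ)
      D := by
    refine (huc.sub (Continuous.continuousOn ?_)).add continuousOn_const
    exact (continuous_pot hfi continuous_id hτ).sub
      (continuous_const.mul (continuous_pot hfi hfσ hτ))
  suffices h0 : ∀ z ∈ D, 0 ≤ u z - (pot S f id τ z - 1 / 2 * pot S f (flip h) τ z) + 2 * μ by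
    intro z hz
    linarith [h0 z hz]
  refine nonneg_of_no_min hDc hcont ?_
  intro z hz hneg hmin
  have hz2 : 0 ≤ z 2 := hDup z hz
  have huz := hu0 z hz
  have hpf := pot_nonneg hSm (flip h) (τ := τ) hf0 z
  have hzx : ‖z - x‖ ≤ 1 := by rw [hD] at hz; exact mem_closedBall_norm.1 hz.1
  rcases hzx.eq_or_lt with h1 | h1
  · have : pot S f id τ z ≤ 2 * μ := by
      rw [hμd, ← integral_const_mul]
      refine setIntegral_mono_on (by simpa using integrableOn_mul_inv_mol hfi continuous_id hτ z 1)
        (hfi.const_mul 2) hSm fun y hy => ?_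
      have h2 := norm_sub_le_norm_sub_add_norm_sub z y x
      have h3 : ‖y - x‖ ≤ 1 / 64 := by rw [hS] at hy; exact mem_closedBall_norm.1 hy.1
      have h4 : 1 / 2 ≤ mol τ (z - y) := le_trans (by linarith) (norm_le_mol τ (z - y))
      have h5 : 1 / mol τ (z - y) ≤ 2 := by rw [div_le_iff₀ (by linarith)]; linarith
      have h6 := hf0 y hy
      calc f y * (1 / mol τ (z - id y)) ≤ f y * 2 := mul_le_mul_of_nonneg_left h5 h6
        _ = 2 * f y := mul_comm _ _
    linarith
  have hball : ∀ᶠ y in 𝓝 z, y ∈ closedBall x 1 := by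
    filter_upwards [isOpen_ball.mem_nhds (show z ∈ ball x 1 from mem_ball_iff_norm.2 h1)] with y hy
      using ball_subset_closedBall hy
  have hlu : ∀ᶠ y in 𝓝[up] z, y ∈ D := by
    rw [hD]
    exact (hball.filter_mono nhdsWithin_le_nhds).and self_mem_nhdsWithin
  rcases hz2.eq_or_lt with h2 | h2
  · obtain ⟨G, hG, hG1⟩ := hu.bdry z (hDB hz) h2.symm
    have d1 := hasDerivWithinAt_vert hz2 hG
    have d2 := (hasDerivAt_pot_line hfi continuous_id hτ z 2 0).hasDerivWithinAt (s := Ici 0)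
    have d3 := (hasDerivAt_pot_line hfi hfσ hτ z 2 0).hasDerivWithinAt (s := Ici 0)
    have d4 := vert_deriv_nonneg (f := fun z => u z -
      (pot S f id τ z - 1 / 2 * pot S f (flip h) τ z) + 2 * μ) hz2
      ((d1.sub (d2.sub (d3.const_mul (1 / 2)))).add_const (2 * μ))
      (by filter_upwards [hlu] with y hy using hmin y hy)
    simp only [zero_smul, add_zero] at d4
    have e1 : 0 ≤ ∫ y in S, f y * -((z - id y) 2 / mol τ (z - id y) ^ 3) := by
      refine setIntegral_nonneg hSm fun y hy => ?_
      have h3 := hSup y hy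
      have h4 := hf0 y hy
      have h5 := mol_pos hτ (z - id y)
      have h6 : -((z - id y) 2 / mol τ (z - id y) ^ 3) = y 2 / mol τ (z - id y) ^ 3 := by
        simp [← h2, neg_div]
      rw [h6]
      positivity
    have hYi := integrableOn_mul_inv_mol hfi hfσ hτ z 3
    have e2 : h * (∫ y in S, f y * (1 / mol τ (z - flip h y) ^ 3))
        ≤ -∫ y in S, f y * -((z - flip h y) 2 / mol τ (z - flip h y) ^ 3) := by
      rw [← integral_const_mul, ← integral_neg]
      refine setIntegral_mono_on (hYi.const_mul h) ?_ hSm fun y hy => ?_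
      · refine Integrable.neg (hfi.mul_bdd (c := 1 / τ ^ 2) ?_
          (.of_forall fun y => abs_mol_deriv_le hτ _ 2))
        have c1 : Continuous fun y => z - flip h y := by fun_prop
        have c2 := (continuous_inv_mol_pow hτ 3).comp c1
        exact (((by fun_prop : Continuous fun y => (z - flip h y) 2).mul c2).neg.congr
          fun y => by simp [div_eq_mul_inv]).aestronglyMeasurable
      · have h3 := hSup y hy
        have h4 := hf0 y hy
        have h5 := mol_pos hτ (z - flip h y)
        rw [sub_flip_two, ← h2, zero_add]
        calc h * (f y * (1 / mol τ (z - flip h y) ^ 3))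
            = f y * (h / mol τ (z - flip h y) ^ 3) := by ring
          _ ≤ f y * ((y 2 + h) / mol τ (z - flip h y) ^ 3) := by gcongr; linarith
          _ = _ := by ring
    have e3 : c z * u z ^ 3 ≤ Λ * u z ^ 3 := by
      gcongr
      exact (le_abs_self _).trans (hu.cbd z (hDB hz) h2.symm)
    obtain ⟨Y, hY⟩ : ∃ Y, Y = ∫ y in S, f y * (1 / mol τ (z - flip h y) ^ 3) := ⟨_, rfl⟩
    have hY0 : 0 < Y := by
      have : μ * (1 / (3 + h + τ) ^ 3) ≤ Y := by
        rw [hY, hμd, ← integral_mul_const]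
        refine setIntegral_mono_on (hfi.mul_const _) hYi hSm fun y hy => ?_
        have h4 := hf0 y hy
        have h5 := mol_pos hτ (z - flip h y)
        have h6 := mol_le hτ.le (z - flip h y)
        have h7 := norm_sub_flip_le hh0.le h2.symm (hSup y hy)
        have h8 := norm_sub_le_norm_sub_add_norm_sub z x y
        have h9 : ‖x - y‖ ≤ 1 / 64 := by
          rw [hS] at hy; rw [norm_sub_rev]; exact mem_closedBall_norm.1 hy.1
        gcongr
        linarith
      exact lt_of_lt_of_le (by positivity) this
    rw [← hY] at e2
    have e4 : 2048 * μ ^ 2 * Y ≤ u z ^ 3 := by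
      have : 1 / 2 * (h * Y) ≤ Λ * u z ^ 3 := by linarith
      rw [hh] at this
      refine le_of_mul_le_mul_left (a := Λ) ?_ hΛ0
      linarith
    have e5 := pot_lt hSm hfi hfσ hτ hτh hf0 (by rw [hf]; exact hF) (z := z) (w := u z) (κ := κ)
      (fun y hy => norm_sub_flip_le hh0.le h2.symm (hSup y hy))
      (fun y hy => le_norm_sub_flip hz2 (hSup y hy)) (hY ▸ hY0) huz (by rw [← hY, ← hμd]; exact e4)
      hF0 (by rw [← hμd]; exact hFκ) hκ
    linarith
  · have hDz : D ∈ 𝓝 z := by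
      rw [nhdsWithin_up_of_pos h2] at hlu
      exact hlu
    have l1 := ((hasLap_lap (hu.c2 z (hDB hz) h2)).sub ((hasLap_pot hfi continuous_id hτ z).sub
      ((hasLap_pot hfi hfσ hτ z).const_mul (1 / 2)))).add (hasLap_const (2 * μ) z)
    have l2 := l1.nonneg_of_min (by filter_upwards [hDz] with y hy using hmin y hy)
    rw [hu.eqn z (hDB hz) h2] at l2
    have l3 : Λ⁻¹ * u z ^ 5 ≤ K z * u z ^ 5 := by
      gcongr
      exact hu.Klow z (hDB hz)
    have l4 := hpo z hz
    have l5 : 0 ≤ ∫ y in S, f y * (3 * τ ^ 2 / mol τ (z - flip h y) ^ 5) := by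
      refine setIntegral_nonneg hSm fun y hy => ?_
      have h4 := hf0 y hy
      have h5 := mol_pos hτ (z - flip h y)
      positivity
    simp only [mul_neg, integral_neg] at l2
    have l6 : ∫ y in S, f y * (3 * τ ^ 2 / mol τ (z - id y) ^ 5) < Λ⁻¹ * u z ^ 5 := by
      rw [hf]; exact l4
    linarith

lemma le_pot_sub_half_pot_flip {x : E3} {S : Set E3} (hS : S = closedBall x (1 / 64) ∩ up)
    {f : E3 → ℝ} (hf : IntegrableOn f S) (hf0 : ∀ y ∈ S, 0 ≤ f y) {h τ : ℝ} (hh : 0 ≤ h)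
    (hτ : 0 < τ) (hτ1 : τ ≤ 1 / 100) {z : E3} (hz : 0 ≤ z 2) (hzx : ‖z - x‖ ≤ 1 / 16) :
    5 * (∫ y in S, f y) ≤ pot S f id τ z - 1 / 2 * pot S f (flip h) τ z := by
  have hSm : MeasurableSet S := hS ▸ (isCompact_half_ball x _).isClosed.measurableSet
  have i1 : IntegrableOn (fun y => f y * (1 / mol τ (z - id y))) S := by
    simpa using integrableOn_mul_inv_mol hf continuous_id hτ z 1
  have i2 : IntegrableOn (fun y => f y * (1 / mol τ (z - flip h y))) S := by
    simpa using integrableOn_mul_inv_mol hf (continuous_flip h) hτ z 1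
  rw [pot, pot, ← integral_const_mul, ← integral_const_mul, ← integral_sub i1 (i2.const_mul _)]
  refine setIntegral_mono_on (hf.const_mul 5) (i1.sub (i2.const_mul _)) hSm fun y hy => ?_
  have hy' := hy
  rw [hS] at hy'
  have h1 := mol_pos hτ (z - y)
  have h2 : mol τ (z - y) ≤ mol τ (z - flip h y) := by
    unfold mol
    gcongr
    exact norm_le_norm_sub_flip hh hz hy'.2
  have h3 : mol τ (z - y) ≤ 1 / 10 := by
    have a1 := mol_le hτ.le (z - y)
    have a2 := mem_closedBall_norm.1 hy'.1
    have a3 := norm_sub_le_norm_sub_add_norm_sub z x y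
    rw [norm_sub_rev x y] at a3
    linarith
  have h4 : 1 / mol τ (z - flip h y) ≤ 1 / mol τ (z - y) := one_div_le_one_div_of_le h1 h2
  have h5 : 10 ≤ 1 / mol τ (z - y) := by
    rw [le_div_iff₀ h1]; linarith
  have h6 := hf0 y hy
  simp only [id]
  nlinarith [mul_le_mul_of_nonneg_left h4 h6, mul_le_mul_of_nonneg_left h5 h6]

/-- Energy bound on small half-balls. -/
theorem integral_pow_six_le_local {Λ : ℝ} (hΛ : 1 ≤ Λ) : ∃ C : ℝ, 0 < C ∧ ∀ u K c : E3 → ℝ,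
    Sol Λ 1 3 u K c → ∀ x : E3, ‖x‖ ≤ 3 / 2 → 0 ≤ x 2 →
    ∫ y in closedBall x (1 / 64) ∩ up, u y ^ 6 ≤ C := by
  obtain ⟨B, hB0, hsup⟩ := sup_mul_inf_le hΛ
  have ha := area_nonneg
  have hΛ0 : 0 < Λ := by linarith
  obtain ⟨Q, hQ⟩ : ∃ Q, Q = 1 + 8 * area * Λ + 50 * area * ((4096 * Λ) ^ 3 * B ^ 5) := ⟨_, rfl⟩
  have hQ0 : 0 < Q := by rw [hQ]; positivity
  refine ⟨B * Q, by positivity, fun u K c hu x hx hx2 => ?_⟩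
  obtain ⟨S, hS⟩ : ∃ S, S = closedBall x (1 / 64) ∩ up := ⟨_, rfl⟩
  rw [← hS]
  have hSc : IsCompact S := hS ▸ isCompact_half_ball x _
  have hSm := hSc.isClosed.measurableSet
  have hDB : closedBall x 1 ∩ up ⊆ hB 3 := fun z hz => by
    refine ⟨?_, hz.2⟩
    have a1 := mem_closedBall_norm.1 hz.1
    have a2 := norm_le_norm_add_norm_sub' z x
    linarith
  have hSB : S ⊆ hB 3 := by
    rw [hS]
    exact (inter_subset_inter_left _ (closedBall_subset_closedBall (by norm_num))).trans hDB
  have huS := hu.cont.mono hSB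
  obtain ⟨w, hw, hmax⟩ := hSc.exists_isMaxOn ⟨x, by
    rw [hS]; exact ⟨mem_closedBall_self (by norm_num), hx2⟩⟩ huS
  have hM : 0 < u w := hu.pos w (hSB hw)
  have i5 : IntegrableOn (fun y => u y ^ 5) S := (huS.pow 5).integrableOn_compact hSc
  have i6 : IntegrableOn (fun y => u y ^ 6) S := (huS.pow 6).integrableOn_compact hSc
  have h6 : ∫ y in S, u y ^ 6 ≤ u w * ∫ y in S, u y ^ 5 := by
    rw [← integral_const_mul]
    refine setIntegral_mono_on i6 (i5.const_mul _) hSm fun y hy => ?_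
    have h0 := hu.pos y (hSB hy)
    have h1 : u y ≤ u w := hmax hy
    calc u y ^ 6 = u y * u y ^ 5 := by ring
      _ ≤ _ := by gcongr
  refine h6.trans ?_
  by_contra! hlt
  obtain ⟨I, hI⟩ : ∃ I, I = ∫ y in S, u y ^ 5 := ⟨_, rfl⟩
  rw [← hI] at hlt
  have hI0 : 0 < I := by
    have : 0 < u w * I := lt_trans (by positivity) hlt
    exact (mul_pos_iff_of_pos_left hM).1 this
  obtain ⟨δ, hδ⟩ : ∃ δ, δ = B / (u w * I) := ⟨_, rfl⟩
  have hδ0 : 0 < δ := by rw [hδ]; positivity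
  have hδQ : δ * Q ≤ 1 := by
    rw [hδ, div_mul_eq_mul_div, div_le_one (by positivity)]; exact hlt.le
  have hμ : ∫ y in S, δ * u y ^ 5 = B / u w := by
    rw [integral_const_mul, ← hI, hδ]; field_simp
  have hδ1 : δ * (8 * area * Λ) ≤ 1 := by
    refine le_trans ?_ hδQ
    gcongr
    rw [hQ]
    have : 0 ≤ 50 * area * ((4096 * Λ) ^ 3 * B ^ 5) := by positivity
    linarith
  have hκ : area * (δ * ((4096 * Λ) ^ 3 * B ^ 5)) ≤ 1 / 50 := by
    have : δ * (50 * area * ((4096 * Λ) ^ 3 * B ^ 5)) ≤ 1 := by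
      refine le_trans ?_ hδQ
      gcongr
      rw [hQ]
      have : 0 ≤ 8 * area * Λ := by positivity
      linarith
    linarith
  obtain ⟨τ₀, hτ₀, hψ⟩ := hu.pot_le (κ := δ * ((4096 * Λ) ^ 3 * B ^ 5)) (F := δ * u w ^ 5) hΛ hS
    rfl hDB hδ0 hδ1
    (fun y hy => by
      have h0 := hu.pos y (hSB hy)
      have h1 : u y ≤ u w := hmax hy
      gcongr)
    (by positivity) (by rw [hμ]; positivity) rfl hκ (by rw [hμ]; apply le_of_eq; field_simp)
  have hτ1 : 0 < min τ₀ (1 / 100) := by positivity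
  have hfin := hsup u K c hu x hx hx2 (3 * (B / u w)) (by positivity) (fun z hz2 hz => by
    refine le_trans ?_ (hψ (min τ₀ (1 / 100)) hτ1 (min_le_left _ _) z
      ⟨mem_closedBall_norm.2 (by linarith), hz2⟩)
    have := le_pot_sub_half_pot_flip hS (i5.const_mul δ)
      (fun y hy => by have := hu.pos y (hSB hy); positivity)
      (h := 4096 * Λ * (∫ y in S, δ * u y ^ 5) ^ 2) (by positivity) hτ1 (min_le_right _ _) hz2 hz
    rw [hμ] at this ⊢
    linarith) w (by rw [hS] at hw; exact hw.2)
    (by rw [hS] at hw; exact mem_closedBall_norm.1 hw.1)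
  have : u w * (3 * (B / u w)) = 3 * B := by field_simp
  linarith

lemma setIntegral_finset_iUnion_le {ι : Type*} (t : Finset ι) (s : ι → Set E3) {f : E3 → ℝ}
    (hf : 0 ≤ f) (hi : ∀ i ∈ t, IntegrableOn f (s i)) :
    ∫ y in ⋃ i ∈ t, s i, f y ≤ ∑ i ∈ t, ∫ y in s i, f y := by
  classical
  induction t using Finset.induction_on with
  | empty => simp
  | insert a t ha ih =>
    have h1 := hi a (Finset.mem_insert_self a t)
    have h2 : ∀ i ∈ t, IntegrableOn f (s i) := fun i h => hi i (Finset.mem_insert_of_mem h)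
    have h3 : IntegrableOn f (⋃ i ∈ t, s i) := (integrableOn_finset_iUnion).2 h2
    rw [Finset.set_biUnion_insert, Finset.sum_insert ha]
    calc _ ≤ ∫ y, f y ∂(volume.restrict (s a) + volume.restrict (⋃ i ∈ t, s i)) :=
          integral_mono_measure (Measure.restrict_union_le _ _) (.of_forall hf)
            (Integrable.add_measure h1 h3)
      _ = _ := integral_add_measure h1 h3
      _ ≤ _ := by gcongr; exact ih h2

/-- Energy bound on a half-ball of fixed radius. -/
theorem integral_pow_six_le {Λ : ℝ} (hΛ : 1 ≤ Λ) : ∃ C : ℝ, 0 < C ∧ ∀ u K c : E3 → ℝ,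
    Sol Λ 1 3 u K c → ∫ y in closedBall 0 (3 / 2) ∩ up, u y ^ 6 ≤ C := by
  obtain ⟨C, hC, hloc⟩ := integral_pow_six_le_local hΛ
  have hD := isCompact_half_ball 0 (3 / 2)
  obtain ⟨t, htD, hcov⟩ := hD.elim_nhds_subcover (fun x => closedBall x (1 / 64))
    fun x _ => closedBall_mem_nhds x (by norm_num)
  refine ⟨t.card * C + 1, by positivity, fun u K c hu => ?_⟩
  have hsub : ∀ x ∈ t, closedBall x (1 / 64) ∩ up ⊆ hB 3 := fun x hx z hz => by
    refine ⟨?_, hz.2⟩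
    have a1 := mem_closedBall_norm.1 hz.1
    have a2 := norm_le_norm_add_norm_sub' z x
    have a3 := mem_closedBall_norm.1 (htD x hx).1
    rw [sub_zero] at a3
    linarith
  have hint : ∀ x ∈ t, IntegrableOn (fun y => u y ^ 6) (closedBall x (1 / 64) ∩ up) := fun x hx =>
    ((hu.cont.mono (hsub x hx)).pow 6).integrableOn_compact (isCompact_half_ball x _)
  have hle : ∫ y in closedBall 0 (3 / 2) ∩ up, u y ^ 6
      ≤ ∫ y in ⋃ x ∈ t, closedBall x (1 / 64) ∩ up, u y ^ 6 := by
    refine setIntegral_mono_set ((integrableOn_finset_iUnion).2 hint)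
      (.of_forall fun y => by show 0 ≤ u y ^ 6; positivity) (LE.le.eventuallyLE ?_)
    intro z hz
    obtain ⟨x, hx, hzx⟩ := mem_iUnion₂.1 (hcov hz)
    exact mem_iUnion₂.2 ⟨x, hx, hzx, hz.2⟩
  have hsum : ∫ y in ⋃ x ∈ t, closedBall x (1 / 64) ∩ up, u y ^ 6
      ≤ ∑ x ∈ t, ∫ y in closedBall x (1 / 64) ∩ up, u y ^ 6 :=
    setIntegral_finset_iUnion_le t _ (fun y => by show 0 ≤ u y ^ 6; positivity) hint
  have := Finset.sum_le_card_nsmul t (fun x => ∫ y in closedBall x (1 / 64) ∩ up, u y ^ 6) C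
    fun x hx => hloc u K c hu x
      (by have := mem_closedBall_norm.1 (htD x hx).1; rwa [sub_zero] at this) (htD x hx).2
  rw [nsmul_eq_mul] at this
  linarith

/-- The coordinate box with opposite corners `a` and `b`. -/
def box (a b : Fin 3 → ℝ) : Set E3 := {z | ∀ i, a i ≤ z i ∧ z i ≤ b i}

lemma isClosed_box (a b : Fin 3 → ℝ) : IsClosed (box a b) := by
  rw [box, Set.ofPred_forall]
  exact isClosed_iInter fun i => (isClosed_le continuous_const (continuous_coord i)).inter
    (isClosed_le (continuous_coord i) continuous_const)

/-- The divergence theorem on a box, for a field with outward flux of nonpositive density. -/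
lemma integral_div_nonpos {a b : Fin 3 → ℝ} (hab : a ≤ b) {F : Fin 3 → E3 → ℝ}
    {F' : Fin 3 → E3 → E3 →L[ℝ] ℝ} {DF : E3 → ℝ} (hc : ∀ i, ContinuousOn (F i) (box a b))
    (hd : ∀ z, (∀ i, a i < z i ∧ z i < b i) → ∀ i, HasFDerivAt (F i) (F' i z) z)
    (hDF : ContinuousOn DF (box a b))
    (hDF' : ∀ z, (∀ i, a i < z i ∧ z i < b i) → ∑ i, F' i z (eb i) = DF z)
    (hb : ∀ i, ∀ z ∈ box a b, z i = b i → F i z ≤ 0)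
    (ha : ∀ i, ∀ z ∈ box a b, z i = a i → 0 ≤ F i z) : ∫ z in box a b, DF z ≤ 0 := by
  let T : (Fin 3 → ℝ) ≃L[ℝ] E3 := (PiLp.continuousLinearEquiv 2 ℝ (fun _ : Fin 3 => ℝ)).symm
  have hTi : ∀ (v : Fin 3 → ℝ) i, T v i = v i := fun v i => rfl
  have hTe : ∀ i, T (Pi.single i 1) = eb i := fun i => rfl
  have hpre : T ⁻¹' box a b = Icc a b := by
    ext v
    simp only [mem_preimage, box, mem_ofPred_eq, hTi, mem_Icc, Pi.le_def, forall_and]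
  have hTm : MapsTo T (Icc a b) (box a b) := hpre ▸ mapsTo_preimage _ _
  have hint : ∀ g : E3 → ℝ, ∫ v in Icc a b, g (T v) = ∫ z in box a b, g z := fun g => by
    rw [← hpre]
    exact (PiLp.volume_preserving_toLp (Fin 3)).setIntegral_preimage_emb
      (MeasurableEquiv.toLp 2 _).measurableEmbedding g _
  have hIoo : (pi univ fun i => Ioo (a i) (b i)) =ᵐ[volume] Icc a b :=
    Measure.univ_pi_Ioo_ae_eq_Icc
  have hTo : ∀ v ∈ pi univ fun i => Ioo (a i) (b i), ∀ i, a i < T v i ∧ T v i < b i :=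
    fun v hv i => hv i (mem_univ i)
  have hmo : MeasurableSet (pi univ fun i => Ioo (a i) (b i)) :=
    MeasurableSet.univ_pi fun i => measurableSet_Ioo
  have heq : EqOn (fun v => DF (T v))
      (fun v => ∑ i, ((F' i (T v)).comp (T : (Fin 3 → ℝ) →L[ℝ] E3)) (Pi.single i 1))
      (pi univ fun i => Ioo (a i) (b i)) := fun v hv => by
    simp only [ContinuousLinearMap.comp_apply, ContinuousLinearEquiv.coe_coe, hTe]
    exact (hDF' _ (hTo v hv)).symm
  have hi1 : IntegrableOn (fun v => DF (T v)) (Icc a b) :=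
    (hDF.comp T.continuous.continuousOn hTm).integrableOn_compact isCompact_Icc
  have key := integral_divergence_of_hasFDerivAt_off_countable' a b hab (fun i v => F i (T v))
    (fun i v => (F' i (T v)).comp (T : (Fin 3 → ℝ) →L[ℝ] E3)) ∅ countable_empty
    (fun i => (hc i).comp T.continuous.continuousOn hTm)
    (fun v hv i => (hd _ (hTo v hv.1) i).comp v T.hasFDerivAt)
    ((integrableOn_congr_set_ae hIoo).1
      (((integrableOn_congr_set_ae hIoo).2 hi1).congr_fun heq hmo))
  have hface : ∀ (i : Fin 3) (s : ℝ), a i ≤ s → s ≤ b i →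
      ∀ x ∈ Icc (a ∘ i.succAbove) (b ∘ i.succAbove), T (i.insertNth s x) ∈ box a b := by
    intro i s h1 h2 x hx
    simp only [box, mem_ofPred_eq, hTi]
    rw [Fin.forall_iff_succAbove i]
    simp only [Fin.insertNth_apply_same, Fin.insertNth_apply_succAbove]
    exact ⟨⟨h1, h2⟩, fun j => ⟨hx.1 j, hx.2 j⟩⟩
  rw [← hint, ← setIntegral_congr_set hIoo, setIntegral_congr_fun hmo heq,
    setIntegral_congr_set hIoo, key]
  refine Finset.sum_nonpos fun i _ => ?_
  refine sub_nonpos.2 (le_trans (b := 0) ?_ ?_)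
  · refine setIntegral_nonpos measurableSet_Icc fun x hx => hb i _ (hface i _ (hab i) le_rfl x hx) ?_
    simp [hTi]
  · refine setIntegral_nonneg measurableSet_Icc fun x hx => ha i _ (hface i _ le_rfl (hab i) x hx) ?_
    simp [hTi]

lemma hasDerivAt_sq_max (s : ℝ) : HasDerivAt (fun s : ℝ => max s 0 ^ 2) (2 * max s 0) s := by
  rcases lt_trichotomy s 0 with h | rfl | h
  · rw [max_eq_right h.le]
    refine ((hasDerivAt_const s (0:ℝ)).congr_of_eventuallyEq ?_).congr_deriv (by simp)
    filter_upwards [Iio_mem_nhds h] with t ht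
    simp [max_eq_right (mem_Iio.1 ht).le]
  · rw [hasDerivAt_iff_isLittleO]
    have h1 : (fun t : ℝ => (t - 0) ^ 2) =o[𝓝 0] fun t => t - 0 := by
      simpa using Asymptotics.isLittleO_pow_id (n := 2) (by norm_num)
    refine (Asymptotics.IsBigO.of_bound 1 (.of_forall fun t => ?_)).trans_isLittleO h1
    have h2 : max t 0 ^ 2 ≤ t ^ 2 := by
      rcases le_total t 0 with h | h
      · rw [max_eq_right h, zero_pow two_ne_zero]; positivity
      · rw [max_eq_left h]
    simpa [abs_of_nonneg (sq_nonneg (max t 0))] using h2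
  · rw [max_eq_left h.le]
    refine ((hasDerivAt_pow 2 s).congr_of_eventuallyEq ?_).congr_deriv (by simp)
    filter_upwards [Ioi_mem_nhds h] with t ht
    simp [max_eq_left (mem_Ioi.1 ht).le]

/-- The base of the cutoff function on the ball of radius `3 / 2`. -/
def cutBase (z : E3) : ℝ := max (9 / 4 - ‖z‖ ^ 2) 0

lemma continuous_cutBase : Continuous cutBase := by unfold cutBase; fun_prop

lemma cutBase_nonneg (z : E3) : 0 ≤ cutBase z := le_max_right _ _

lemma hasFDerivAt_cut (z : E3) :
    HasFDerivAt (fun z => cutBase z ^ 2) ((-(4 * cutBase z)) • innerSL ℝ z) z := by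
  have h1 : HasFDerivAt (fun z : E3 => 9 / 4 - ‖z‖ ^ 2) (-(2 • innerSL ℝ z)) z :=
    (hasStrictFDerivAt_norm_sq z).hasFDerivAt.const_sub _
  have h2 := (hasDerivAt_sq_max (9 / 4 - ‖z‖ ^ 2)).comp_hasFDerivAt z h1
  refine h2.congr_fderiv ?_
  ext w
  simp [cutBase]
  ring

lemma innerSL_eb (z : E3) (i : Fin 3) : innerSL ℝ z (eb i) = z i := by
  rw [innerSL_apply_apply, eb, EuclideanSpace.inner_single_right]; simp

lemma norm_clm_sq_le (G : E3 →L[ℝ] ℝ) : ‖G‖ ^ 2 ≤ G (eb 0) ^ 2 + G (eb 1) ^ 2 + G (eb 2) ^ 2 := by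
  have h : ‖G‖ ≤ √(G (eb 0) ^ 2 + G (eb 1) ^ 2 + G (eb 2) ^ 2) := by
    refine G.opNorm_le_bound (Real.sqrt_nonneg _) fun v => ?_
    refine abs_le_of_sq_le_sq ?_ (by positivity)
    rw [mul_pow, Real.sq_sqrt (by positivity), norm_sq_eq, clm_expand]
    nlinarith [sq_nonneg (v 0 * G (eb 1) - v 1 * G (eb 0)),
      sq_nonneg (v 0 * G (eb 2) - v 2 * G (eb 0)), sq_nonneg (v 1 * G (eb 2) - v 2 * G (eb 1))]
  calc ‖G‖ ^ 2 ≤ √(G (eb 0) ^ 2 + G (eb 1) ^ 2 + G (eb 2) ^ 2) ^ 2 := by gcongr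
    _ = _ := Real.sq_sqrt (by positivity)

lemma convex_hB (ρ : ℝ) : Convex ℝ (hB ρ) := by
  have : hB ρ = ball 0 ρ ∩ {z : E3 | 0 ≤ z 2} := by ext; simp [hB]
  rw [this]
  refine (convex_ball _ _).inter ?_
  exact convex_halfSpace_ge (f := fun z : E3 => z 2) ⟨fun _ _ => rfl, fun _ _ => rfl⟩ 0

lemma hB_mem_nhds {ρ : ℝ} {z : E3} (hz : z ∈ hB ρ) (hz2 : 0 < z 2) : hB ρ ∈ 𝓝 z := by
  filter_upwards [(isOpen_lt continuous_norm continuous_const).mem_nhds hz.1,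
    (isOpen_lt continuous_const (continuous_coord 2)).mem_nhds hz2] with w h1 h2
  exact ⟨h1, le_of_lt h2⟩

lemma uniqueDiffOn_hB {ρ : ℝ} (hρ : 0 < ρ) : UniqueDiffOn ℝ (hB ρ) := by
  refine uniqueDiffOn_convex (convex_hB ρ) ⟨(ρ / 2) • eb 2, mem_interior_iff_mem_nhds.2 ?_⟩
  refine hB_mem_nhds ⟨?_, ?_⟩ ?_
  · rw [norm_smul, norm_eb, Real.norm_of_nonneg (by positivity)]; linarith
  · simp; positivity
  · simp; positivity

lemma cut_gradient_bound {Λ p u K z0 z1 z2 g0 g1 g2 : ℝ} (hΛ : 1 ≤ Λ) (hp : 0 ≤ p)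
    (hu : 0 < u) (hK : K ≤ Λ) (hpz : p = 9 / 4 - (z0 ^ 2 + z1 ^ 2 + z2 ^ 2)) :
    1 / 2 * (p ^ 2 * (g0 ^ 2 + g1 ^ 2 + g2 ^ 2)) - 160 * Λ ^ 2 * (1 + u ^ 6)
      ≤ p ^ 2 * (-(K * u ^ 6) + (g0 ^ 2 + g1 ^ 2 + g2 ^ 2) + 4 * Λ * u ^ 3 * g2)
        - 4 * p * (u * (g0 * z0 + g1 * z1 + g2 * z2) + Λ * u ^ 4 * z2) := by
  have e1 := sq_nonneg (p * g0 / 2 - 4 * u * z0)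
  have e2 := sq_nonneg (p * g1 / 2 - 4 * u * z1)
  have e3 := sq_nonneg (p * g2 / 2 - 4 * u * z2)
  have e4 := sq_nonneg (p * g2 / 2 + 4 * Λ * p * u ^ 3)
  have e5 := sq_nonneg (p * g0)
  have e6 := sq_nonneg (p * g1)
  have hp1 : p ≤ 9 / 4 := by nlinarith [sq_nonneg z0, sq_nonneg z1, sq_nonneg z2]
  have hp2 : p ^ 2 ≤ 6 := by nlinarith
  have hz : z0 ^ 2 + z1 ^ 2 + z2 ^ 2 ≤ 9 / 4 := by linarith
  have hz2 : z2 ≤ 3 / 2 := by nlinarith [sq_nonneg z0, sq_nonneg z1, sq_nonneg z2]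
  have hu2 : u ^ 2 ≤ 1 + u ^ 6 := by
    rcases le_total u 1 with h | h
    · have : u ^ 2 ≤ 1 := pow_le_one₀ hu.le h
      have : 0 ≤ u ^ 6 := by positivity
      linarith
    · have := pow_le_pow_right₀ h (show 2 ≤ 6 by norm_num)
      linarith
  have hu4 : u ^ 4 ≤ 1 + u ^ 6 := by
    rcases le_total u 1 with h | h
    · have : u ^ 4 ≤ 1 := pow_le_one₀ hu.le h
      have : 0 ≤ u ^ 6 := by positivity
      linarith
    · have := pow_le_pow_right₀ h (show 4 ≤ 6 by norm_num)
      linarith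
  have b1 : 16 * u ^ 2 * (z0 ^ 2 + z1 ^ 2 + z2 ^ 2) ≤ 36 * (1 + u ^ 6) := by
    calc _ ≤ 16 * (1 + u ^ 6) * (9 / 4) := by gcongr
      _ = _ := by ring
  have b2 : 16 * Λ ^ 2 * p ^ 2 * u ^ 6 ≤ 96 * Λ ^ 2 * (1 + u ^ 6) := by
    calc _ ≤ 16 * Λ ^ 2 * 6 * (1 + u ^ 6) := by gcongr; linarith
      _ = _ := by ring
  have b3 : p ^ 2 * (K * u ^ 6) ≤ 6 * Λ * (1 + u ^ 6) := by
    calc p ^ 2 * (K * u ^ 6) ≤ p ^ 2 * (Λ * u ^ 6) := by gcongr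
      _ ≤ 6 * (Λ * (1 + u ^ 6)) := by gcongr; linarith
      _ = _ := by ring
  have b4 : 4 * p * (Λ * u ^ 4 * z2) ≤ 14 * Λ * (1 + u ^ 6) := by
    calc 4 * p * (Λ * u ^ 4 * z2) ≤ 4 * p * (Λ * u ^ 4 * (3 / 2)) := by gcongr
      _ ≤ 4 * (9 / 4) * (Λ * (1 + u ^ 6) * (3 / 2)) := by gcongr
      _ = 27 / 2 * (Λ * (1 + u ^ 6)) := by ring
      _ ≤ 14 * (Λ * (1 + u ^ 6)) := by gcongr; norm_num
      _ = _ := by ring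
  have hΛ2 : Λ ≤ Λ ^ 2 := by nlinarith
  have hone : 1 ≤ Λ ^ 2 := by nlinarith
  have hq : 0 ≤ 1 + u ^ 6 := by positivity
  have b5 : 36 * (1 + u ^ 6) ≤ 36 * Λ ^ 2 * (1 + u ^ 6) := by gcongr; linarith
  have b6 : 20 * Λ * (1 + u ^ 6) ≤ 20 * Λ ^ 2 * (1 + u ^ 6) := by gcongr
  have b7 : 0 ≤ Λ ^ 2 * (1 + u ^ 6) := by positivity
  nlinarith

lemma Sol.continuousOn_K {Λ ε ρ : ℝ} {v K c : E3 → ℝ} (hv : Sol Λ ε ρ v K c) :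
    ContinuousOn K (hB ρ) := by
  have : LipschitzOnWith (Λ * ε).toNNReal K (hB ρ) :=
    LipschitzOnWith.of_dist_le_mul fun y hy z hz => by
      rw [Real.dist_eq, dist_eq_norm]
      refine (hv.Klip y hy z hz).trans ?_
      gcongr
      exact Real.le_coe_toNNReal _
  exact this.continuousOn

/-- The gradient is controlled by the sixth power in the energy. -/
theorem integral_cut_gradient_le {Λ : ℝ} (hΛ : 1 ≤ Λ) {u K c : E3 → ℝ} (hu : Sol Λ 1 3 u K c)
    (h1 : ContDiffOn ℝ 1 u (hB 3)) {g : Fin 3 → E3 → ℝ}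
    (hg : g = fun i z => fderivWithin ℝ u (hB 3) z (eb i)) :
    ∫ z in closedBall 0 (3 / 2) ∩ up, (1 / 2 * ((cutBase z ^ 2) * (g 0 z ^ 2 + g 1 z ^ 2 + g 2 z ^ 2))
      - 160 * Λ ^ 2 * (1 + u z ^ 6)) ≤ 0 := by
  obtain ⟨P, hP⟩ : ∃ P : Set E3, P = closedBall 0 (3 / 2) ∩ up := ⟨_, rfl⟩
  rw [← hP]
  have hPc : IsCompact P := hP ▸ isCompact_half_ball 0 _
  have hgc : ∀ i, ContinuousOn (g i) (hB 3) := fun i => by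
    rw [hg]
    exact (h1.continuousOn_fderivWithin (uniqueDiffOn_hB (by norm_num)) le_rfl).clm_apply
      continuousOn_const
  have huc := hu.cont
  have hKc := hu.continuousOn_K
  have hcc := continuous_cutBase.continuousOn (s := hB 3)
  have hzc : ∀ i : Fin 3, ContinuousOn (fun z : E3 => z i) (hB 3) :=
    fun i => (continuous_coord i).continuousOn
  obtain ⟨a, ha⟩ : ∃ a : Fin 3 → ℝ, a = ![-(3 / 2), -(3 / 2), 0] := ⟨_, rfl⟩
  obtain ⟨b, hb⟩ : ∃ b : Fin 3 → ℝ, b = fun _ => 3 / 2 := ⟨_, rfl⟩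
  have hab : a ≤ b := by
    rw [ha, hb]; intro i; fin_cases i <;> norm_num
  have hbox : box a b ⊆ hB 3 := by
    intro z hz
    have h0 := hz 0
    have h1 := hz 1
    have h2 := hz 2
    simp only [ha, hb, Matrix.cons_val] at h0 h1 h2
    refine ⟨lt_of_pow_lt_pow_left₀ 2 (by norm_num) ?_, h2.1⟩
    rw [norm_sq_eq]
    nlinarith
  have hPB : P ⊆ box a b := by
    intro z hz i
    rw [hP] at hz
    have h0 := mem_closedBall_norm.1 hz.1
    rw [sub_zero] at h0
    have h1 := abs_le.1 ((abs_coord_le z i).trans h0)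
    have h2 : 0 ≤ z 2 := hz.2
    fin_cases i
    · simp [ha, hb]; exact h1
    · simp [ha, hb]; exact h1
    · simp [ha, hb]; exact ⟨h2, h1.2⟩
  obtain ⟨l, hl⟩ : ∃ l : Fin 3 → ℝ, l = fun i => if i = 2 then Λ else 0 := ⟨_, rfl⟩
  have hl0 : l 0 = 0 := by simp [hl]
  have hl1 : l 1 = 0 := by simp [hl]
  have hl2 : l 2 = Λ := by simp [hl]
  obtain ⟨DF, hDF⟩ : ∃ DF : E3 → ℝ, DF = fun z => cutBase z ^ 2 * (-(K z * u z ^ 6) +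
      (g 0 z ^ 2 + g 1 z ^ 2 + g 2 z ^ 2) + 4 * Λ * u z ^ 3 * g 2 z) - 4 * cutBase z *
      (u z * (g 0 z * z 0 + g 1 z * z 1 + g 2 z * z 2) + Λ * u z ^ 4 * z 2) := ⟨_, rfl⟩
  have hDFc : ContinuousOn DF (hB 3) := by
    rw [hDF]
    have := hgc 0
    have := hgc 1
    have := hgc 2
    have := hzc 0
    have := hzc 1
    have := hzc 2
    fun_prop
  have hcut0 : ∀ i, ∀ z ∈ box a b, z i = b i → cutBase z = 0 := fun i z _ hz => by
    rw [cutBase, max_eq_right]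
    have h1 := sq_le_sq.2 (by simpa using abs_coord_le z i : |z i| ≤ |‖z‖|)
    rw [hz, hb] at h1
    norm_num at h1
    linarith
  have hcut1 : ∀ i ≠ 2, ∀ z ∈ box a b, z i = a i → cutBase z = 0 := fun i hi z _ hz => by
    rw [cutBase, max_eq_right]
    have h1 := sq_le_sq.2 (by simpa using abs_coord_le z i : |z i| ≤ |‖z‖|)
    have h2 : a i ^ 2 = 9 / 4 := by
      rw [ha]
      fin_cases i
      · norm_num
      · norm_num
      · exact absurd rfl hi
    rw [hz, h2] at h1
    linarith
  have hint : ∀ z, (∀ i, a i < z i ∧ z i < b i) → z ∈ hB 3 ∧ 0 < z 2 := fun z hz =>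
    ⟨hbox fun i => ⟨(hz i).1.le, (hz i).2.le⟩, by have := (hz 2).1; simpa [ha] using this⟩
  have hdiv := integral_div_nonpos (a := a) (b := b) hab
    (F := fun i z => cutBase z ^ 2 * (u z * g i z + l i * u z ^ 4))
    (F' := fun i z => cutBase z ^ 2 • ((u z • fderiv ℝ (fun y => fderiv ℝ u y (eb i)) z +
      g i z • fderiv ℝ u z) + l i • ((4 * u z ^ 3) • fderiv ℝ u z)) +
      (u z * g i z + l i * u z ^ 4) • ((-(4 * cutBase z)) • innerSL ℝ z))
    (DF := DF)
    (fun i => by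
      have h1 := (huc.mono hbox)
      have h2 := (hgc i).mono hbox
      have h3 := hcc.mono hbox
      fun_prop)
    (fun z hz i => by
      obtain ⟨hzB, hz2⟩ := hint z hz
      have hc2 := hu.c2 z hzB hz2
      have hdu : HasFDerivAt u (fderiv ℝ u z) z := (hc2.differentiableAt (by norm_num)).hasFDerivAt
      have hev : g i =ᶠ[𝓝 z] fun y => fderiv ℝ u y (eb i) := by
        filter_upwards [eventually_mem_nhds_iff.2 (hB_mem_nhds hzB hz2)] with y hy
        rw [hg]
        simp only [fderivWithin_of_mem_nhds hy]
      have hdg : HasFDerivAt (g i) (fderiv ℝ (fun y => fderiv ℝ u y (eb i)) z) z := by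
        refine HasFDerivAt.congr_of_eventuallyEq ?_ hev
        refine DifferentiableAt.hasFDerivAt ?_
        exact ((hc2.fderiv_right (m := 1) (by norm_num)).differentiableAt (by norm_num)).clm_apply
          (differentiableAt_const _)
      have h4 := ((hasDerivAt_pow 4 (u z)).comp_hasFDerivAt z hdu).const_mul (l i)
      refine ((hasFDerivAt_cut z).mul ((hdu.mul hdg).add h4)).congr_fderiv ?_
      norm_num)
    (hDFc.mono hbox)
    (fun z hz => by
      obtain ⟨hzB, hz2⟩ := hint z hz
      have hgz : ∀ i, g i z = fderiv ℝ u z (eb i) := fun i => by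
        rw [hg]; simp only [fderivWithin_of_mem_nhds (hB_mem_nhds hzB hz2)]
      have hlap := hu.eqn z hzB hz2
      have hlap' : lap u z = ∑ i, fderiv ℝ (fun y => fderiv ℝ u y (eb i)) z (eb i) := rfl
      rw [hlap', Fin.sum_univ_three] at hlap
      rw [Fin.sum_univ_three, hDF]
      simp only [add_apply, smul_apply, smul_eq_mul,
        innerSL_eb, ← hgz, hl0, hl1, hl2]
      linear_combination (cutBase z ^ 2 * u z) * hlap)
    (fun i z hz hzi => by simp [hcut0 i z hz hzi])
    (fun i z hz hzi => by
      by_cases hi : i = 2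
      · subst hi
        have hz2 : z 2 = 0 := by rw [hzi, ha]; rfl
        obtain ⟨G, hG, hGe⟩ := hu.bdry z (hbox hz) hz2
        have e1 : g 2 z = c z * u z ^ 3 := by
          rw [← hGe, hg]
          simp only
          rw [(hG.mono fun w hw => hw.2).fderivWithin (uniqueDiffOn_hB (by norm_num) z (hbox hz)),
            eb_two]
        rw [e1, hl2]
        have h1 := (abs_le.1 (hu.cbd z (hbox hz) hz2)).1
        have h2 := hu.pos z (hbox hz)
        have h3 : u z * (c z * u z ^ 3) + Λ * u z ^ 4 = (c z + Λ) * u z ^ 4 := by ring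
        rw [h3]
        have h4 : 0 ≤ c z + Λ := by linarith
        positivity
      · simp [hcut1 i hi z hz hzi])
  have hP0 : ∀ z ∈ box a b \ P, DF z = 0 := fun z hz => by
    have h0 : 0 ≤ z 2 := (hbox hz.1).2
    have h1 : 3 / 2 < ‖z‖ := by
      by_contra! h
      exact hz.2 (hP ▸ ⟨mem_closedBall_norm.2 (by rwa [sub_zero]), h0⟩)
    have h2 : cutBase z = 0 := by
      rw [cutBase, max_eq_right]; nlinarith
    simp [hDF, h2]
  rw [setIntegral_eq_of_subset_of_forall_sdiff_eq_zero (isClosed_box a b).measurableSet hPB hP0]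
    at hdiv
  refine le_trans (setIntegral_mono_on ?_ ((hDFc.mono (hPB.trans hbox)).integrableOn_compact hPc)
    hPc.isClosed.measurableSet fun z hz => ?_) hdiv
  · refine ContinuousOn.integrableOn_compact hPc ?_
    refine ContinuousOn.mono ?_ (hPB.trans hbox)
    have := hgc 0
    have := hgc 1
    have := hgc 2
    fun_prop
  · have hzB := hbox (hPB hz)
    rw [hP] at hz
    have h1 := mem_closedBall_norm.1 hz.1
    rw [sub_zero] at h1
    have h2 : cutBase z = 9 / 4 - ‖z‖ ^ 2 := by
      rw [cutBase, max_eq_left]; nlinarith [norm_nonneg z]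
    rw [hDF]
    exact cut_gradient_bound hΛ (cutBase_nonneg z) (hu.pos z hzB) (hu.Kup z hzB)
      (by rw [h2, norm_sq_eq])

/-- The energy estimate on a half-ball of radius one. -/
theorem energy_unit {Λ : ℝ} (hΛ : 1 ≤ Λ) : ∃ C : ℝ, 0 < C ∧ ∀ u K c : E3 → ℝ,
    Sol Λ 1 3 u K c → ContDiffOn ℝ 1 u (hB 3) →
    ∫ z in oB 1, (‖fderiv ℝ u z‖ ^ 2 + u z ^ 6) ≤ C := by
  obtain ⟨C, hC, hen⟩ := integral_pow_six_le hΛ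
  obtain ⟨P, hP⟩ : ∃ P : Set E3, P = closedBall 0 (3 / 2) ∩ up := ⟨_, rfl⟩
  have hPc : IsCompact P := hP ▸ isCompact_half_ball 0 _
  have hPm := hPc.isClosed.measurableSet
  refine ⟨320 * Λ ^ 2 * (volume.real P + C) + C, by positivity, fun u K c hu h1 => ?_⟩
  have hE := hen u K c hu
  obtain ⟨g, hg⟩ : ∃ g : Fin 3 → E3 → ℝ, g = fun i z => fderivWithin ℝ u (hB 3) z (eb i) := ⟨_, rfl⟩
  have hG := integral_cut_gradient_le hΛ hu h1 hg
  rw [← hP] at hE hG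
  have hPB : P ⊆ hB 3 := fun z hz => by
    rw [hP] at hz
    have h1 := mem_closedBall_norm.1 hz.1
    rw [sub_zero] at h1
    exact ⟨by linarith, hz.2⟩
  have huc := hu.cont.mono hPB
  have hgc : ∀ i, ContinuousOn (g i) P := fun i => by
    rw [hg]
    exact ((h1.continuousOn_fderivWithin (uniqueDiffOn_hB (by norm_num)) le_rfl).clm_apply
      continuousOn_const).mono hPB
  have hcc := continuous_cutBase.continuousOn (s := P)
  have i6 : IntegrableOn (fun z => u z ^ 6) P := (huc.pow 6).integrableOn_compact hPc
  have i1 : IntegrableOn (fun _ => (1 : ℝ)) P := continuousOn_const.integrableOn_compact hPc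
  have i7 : IntegrableOn (fun z => 1 + u z ^ 6) P := i1.add i6
  obtain ⟨W, hW⟩ : ∃ W : E3 → ℝ, W = fun z => cutBase z ^ 2 * (g 0 z ^ 2 + g 1 z ^ 2 + g 2 z ^ 2) :=
    ⟨_, rfl⟩
  have iW : IntegrableOn W P := by
    refine ContinuousOn.integrableOn_compact hPc ?_
    rw [hW]
    have := hgc 0
    have := hgc 1
    have := hgc 2
    fun_prop
  have hG' : ∫ z in P, (1 / 2 * W z - 160 * Λ ^ 2 * (1 + u z ^ 6)) ≤ 0 := by
    rw [hW]; exact hG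
  rw [integral_sub (iW.const_mul _) (i7.const_mul _), integral_const_mul, integral_const_mul,
    integral_add i1 i6, setIntegral_const, smul_eq_mul, mul_one] at hG'
  have iWu : IntegrableOn (fun z => W z + u z ^ 6) P := iW.add i6
  have hW0 : ∀ z, 0 ≤ W z + u z ^ 6 := fun z => by rw [hW]; positivity
  have hoP : oB 1 ⊆ P := fun z hz => by
    rw [hP]
    exact ⟨mem_closedBall_norm.2 (by rw [sub_zero]; have := hz.1; linarith), hz.2.le⟩
  have hom : MeasurableSet (oB 1) :=
    ((isOpen_lt continuous_norm continuous_const).inter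
      (isOpen_lt continuous_const (continuous_coord 2))).measurableSet
  have hle : ∫ z in oB 1, (‖fderiv ℝ u z‖ ^ 2 + u z ^ 6) ≤ ∫ z in oB 1, (W z + u z ^ 6) := by
    refine integral_mono_of_nonneg (.of_forall fun z => by positivity) (iWu.mono_set hoP) ?_
    filter_upwards [ae_restrict_mem hom] with z hz
    gcongr
    refine (norm_clm_sq_le _).trans ?_
    have e : ∀ i, fderiv ℝ u z (eb i) = g i z := fun i => by
      rw [hg]
      simp only [fderivWithin_of_mem_nhds (hB_mem_nhds (hPB (hoP hz)) hz.2)]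
    rw [e, e, e, hW]
    refine le_mul_of_one_le_left (by positivity) (one_le_pow₀ ?_)
    refine le_max_of_le_left ?_
    have := hz.1
    nlinarith [norm_nonneg z]
  have hle2 : ∫ z in oB 1, (W z + u z ^ 6) ≤ ∫ z in P, (W z + u z ^ 6) :=
    setIntegral_mono_set iWu (.of_forall hW0) (LE.le.eventuallyLE hoP)
  rw [integral_add iW i6] at hle2
  have hΛ2 : 0 ≤ Λ ^ 2 := by positivity
  nlinarith [mul_le_mul_of_nonneg_left hE hΛ2]

open scoped Pointwise

lemma convex_plane_ball {ρ : ℝ} : Convex ℝ (fB ρ) := by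
  have : fB ρ = ball 0 ρ ∩ {z : E3 | z 2 = 0} := by ext; simp [fB]
  rw [this]
  exact (convex_ball _ _).inter
    (convex_hyperplane (f := fun z : E3 => z 2) ⟨fun _ _ => rfl, fun _ _ => rfl⟩ 0)

lemma convex_cB {ρ : ℝ} : Convex ℝ (cB ρ) := by
  have : cB ρ = closedBall 0 ρ ∩ {z : E3 | 0 ≤ z 2} := by ext; simp [cB]
  rw [this]
  exact (convex_closedBall _ _).inter
    (convex_halfSpace_ge (f := fun z : E3 => z 2) ⟨fun _ _ => rfl, fun _ _ => rfl⟩ 0)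

lemma isOpen_oB (ρ : ℝ) : IsOpen (oB ρ) :=
  (isOpen_lt continuous_norm continuous_const).inter
    (isOpen_lt continuous_const (continuous_coord 2))

lemma hB_subset_cB (ρ : ℝ) : hB ρ ⊆ cB ρ := fun _ hz => ⟨hz.1.le, hz.2⟩

lemma sol_of_contDiffOn {Λ R : ℝ} {u K c : E3 → ℝ} (hpos : ∀ x ∈ cB (3 * R), 0 < u x)
    (hcont : ContinuousOn u (cB (3 * R)))
    (h1 : ContDiffOn ℝ 1 u (oB (3 * R) ∪ fB (3 * R))) (h2 : ContDiffOn ℝ 2 u (oB (3 * R)))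
    (hK1 : ContDiffOn ℝ 1 K (cB (3 * R)))
    (hK : ∀ x ∈ cB (3 * R), Λ⁻¹ ≤ K x ∧ K x ≤ Λ ∧
      ‖fderivWithin ℝ K (cB (3 * R)) x‖ ≤ Λ / R)
    (hc1 : ContDiffOn ℝ 1 c (fB (3 * R)))
    (hc : ∀ x ∈ fB (3 * R), |c x| ≤ Λ ∧ ‖fderivWithin ℝ c (fB (3 * R)) x‖ ≤ Λ / R)
    (heq : ∀ x ∈ oB (3 * R), lap u x + K x * u x ^ 5 = 0)
    (hbd : ∀ x ∈ fB (3 * R),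
      fderivWithin ℝ u (oB (3 * R) ∪ fB (3 * R)) x e3 = c x * u x ^ 3) :
    Sol Λ R⁻¹ (3 * R) u K c := by
  have hsub := hB_subset_cB (3 * R)
  refine ⟨fun z hz => hpos z (hsub hz), hcont.mono hsub, fun z hz hz2 => ?_, fun z hz hz2 => ?_,
    fun z hz hz2 => ?_, fun z hz => (hK z (hsub hz)).1, fun z hz => (hK z (hsub hz)).2.1,
    fun y hy z hz => ?_, fun z hz hz2 => (hc z ⟨hz.1, hz2⟩).1, fun y hy z hz hy2 hz2 => ?_⟩
  · exact h2.contDiffAt ((isOpen_oB _).mem_nhds ⟨hz.1, hz2⟩)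
  · linarith [heq z ⟨hz.1, hz2⟩]
  · refine ⟨_, ?_, hbd z ⟨hz.1, hz2⟩⟩
    rw [← hB_eq_union] at h1 ⊢
    refine ((h1.differentiableOn one_ne_zero) z hz).hasFDerivWithinAt.mono_of_mem_nhdsWithin ?_
    filter_upwards [self_mem_nhdsWithin, mem_nhdsWithin_of_mem_nhds
      ((isOpen_lt continuous_norm continuous_const).mem_nhds hz.1)] with w hw1 hw2
    exact ⟨hw2, hw1⟩
  · have := convex_cB.norm_image_sub_le_of_norm_fderivWithin_le (hK1.differentiableOn one_ne_zero)
      (fun x hx => (hK x hx).2.2) (hsub hz) (hsub hy)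
    rwa [Real.norm_eq_abs, div_eq_mul_inv] at this
  · have := convex_plane_ball.norm_image_sub_le_of_norm_fderivWithin_le
      (hc1.differentiableOn one_ne_zero) (fun x hx => (hc x hx).2)
      (show z ∈ fB (3 * R) from ⟨hz.1, hz2⟩) (show y ∈ fB (3 * R) from ⟨hy.1, hy2⟩)
    rwa [Real.norm_eq_abs, div_eq_mul_inv] at this

lemma integral_dilate {R : ℝ} (hR : 0 < R) (u : E3 → ℝ) :
    ∫ z in oB 1, (‖fderiv ℝ (fun y => √R * u (R • y)) z‖ ^ 2 + (√R * u (R • z)) ^ 6)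
      = ∫ z in oB R, (‖fderiv ℝ u z‖ ^ 2 + u z ^ 6) := by
  have hs : √R ^ 2 = R := Real.sq_sqrt hR.le
  have hset : R • oB 1 = oB R := by
    ext z
    rw [mem_smul_set_iff_inv_smul_mem₀ hR.ne']
    simp only [oB, mem_ofPred_eq, norm_smul, PiLp.smul_apply, smul_eq_mul, norm_inv,
      Real.norm_of_nonneg hR.le]
    rw [inv_mul_lt_iff₀ hR, mul_one, mul_pos_iff_of_pos_left (inv_pos.2 hR)]
  have hfd : ∀ z, fderiv ℝ (fun y => √R * u (R • y)) z = √R • (R • fderiv ℝ u (R • z)) := fun z => by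
    rw [← fderiv_dilate, ← Pi.smul_apply, ← fderiv_const_smul_field √R]
    rfl
  have hpt : ∀ z, ‖fderiv ℝ (fun y => √R * u (R • y)) z‖ ^ 2 + (√R * u (R • z)) ^ 6
      = R ^ 3 * (‖fderiv ℝ u (R • z)‖ ^ 2 + u (R • z) ^ 6) := fun z => by
    rw [hfd, norm_smul, norm_smul, Real.norm_of_nonneg (Real.sqrt_nonneg R),
      Real.norm_of_nonneg hR.le, mul_pow, hs, mul_pow, mul_pow,
      show √R ^ 6 = (√R ^ 2) ^ 3 by ring, hs]
    ring
  simp only [hpt]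
  rw [integral_const_mul, Measure.setIntegral_comp_smul_of_pos volume
    (fun z => ‖fderiv ℝ u z‖ ^ 2 + u z ^ 6) _ hR, hset]
  simp
  field_simp

end HalfBall

/-- Corollary mar30cor1, energy estimate. -/
theorem stmt2 (Λ : ℝ) (hΛ : 0 < Λ) :
    ∃ C : ℝ, 0 < C ∧
      ∀ (R : ℝ) (u K c : E3 → ℝ), 0 < R →
        (∀ x ∈ cB (3 * R), 0 < u x) →
        ContinuousOn u (cB (3 * R)) →
        ContDiffOn ℝ 1 u (oB (3 * R) ∪ fB (3 * R)) →
        ContDiffOn ℝ 2 u (oB (3 * R)) →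
        ContDiffOn ℝ 1 K (cB (3 * R)) →
        (∀ x ∈ cB (3 * R), Λ⁻¹ ≤ K x ∧ K x ≤ Λ ∧
          ‖fderivWithin ℝ K (cB (3 * R)) x‖ ≤ Λ / R) →
        ContDiffOn ℝ 1 c (fB (3 * R)) →
        (∀ x ∈ fB (3 * R), |c x| ≤ Λ ∧ ‖fderivWithin ℝ c (fB (3 * R)) x‖ ≤ Λ / R) →
        (∀ x ∈ oB (3 * R), lap u x + K x * u x ^ 5 = 0) →
        (∀ x ∈ fB (3 * R),
          fderivWithin ℝ u (oB (3 * R) ∪ fB (3 * R)) x e3 = c x * u x ^ 3) →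
        ∫ x in oB R, (‖fderiv ℝ u x‖ ^ 2 + u x ^ 6) ≤ C := by
  by_cases hΛ1 : 1 ≤ Λ
  · obtain ⟨C, hC, hE⟩ := HalfBall.energy_unit hΛ1
    refine ⟨C, hC, fun R u K c hR hpos hcont h1 h2 hK1 hK hc1 hc heq hbd => ?_⟩
    have hs : √R ^ 2 = R := Real.sq_sqrt hR.le
    have hsol := (HalfBall.sol_of_contDiffOn hpos hcont h1 h2 hK1 hK hc1 hc heq hbd).scale
      (Real.sqrt_pos.2 hR)
    rw [hs, mul_inv_cancel₀ hR.ne', mul_div_assoc, div_self hR.ne', mul_one] at hsol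
    rw [← HalfBall.integral_dilate hR]
    refine hE _ _ _ hsol ?_
    rw [← HalfBall.hB_eq_union] at h1
    refine contDiffOn_const.mul (h1.comp (contDiff_const_smul R).contDiffOn fun z hz => ?_)
    refine ⟨?_, HalfBall.smul_mem_up hR.le hz.2⟩
    rw [norm_smul, Real.norm_of_nonneg hR.le]
    nlinarith [hz.1]
  · refine ⟨1, one_pos, fun R u K c hR _ _ _ _ _ hK => absurd ?_ hΛ1⟩
    have h0 : (0 : E3) ∈ cB (3 * R) := ⟨by rw [norm_zero]; positivity, le_rfl⟩
    have h1 := (hK 0 h0).1.trans (hK 0 h0).2.1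
    rw [inv_le_iff_one_le_mul₀ hΛ] at h1
    nlinarith
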